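/- Let s ∈ (0,1) and let u ∈ C(ℝ) satisfy (−Δ)^s u = 0 in (0,∞), u ≡ 0 on ℝ₋, together with the growth conditions |u(x)| ≤ C|x|^{δ−1} for x ∈ (0,1) for some δ > 0, and |u(x)| ≤ C|x|^β for x ≥ 1 for some β ∈ (0,2s). Then u(x) = a (x_+)^s + b (x_+)^{s−1} for some constants a, b ∈ ℝ. -/

import Mathlib

open MeasureTheory

namespace FL
open Complex Set Filter Topology

/-- Holomorphic parametric integrals. -/
theorem holo_integral {α : Type*} [MeasurableSpace α] {μ : Measure α} {f : ℂ → α → ℂ}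
    {U : Set ℂ} (hU : IsOpen U)
    (hm : ∀ z ∈ U, AEStronglyMeasurable (f z) μ)
    (hd : ∀ᵐ a ∂μ, DifferentiableOn ℂ (fun z => f z a) U)
    (hb : ∀ z0 ∈ U, ∃ ε > 0, ∃ bound : α → ℝ, Integrable bound μ ∧
      ∀ᵐ a ∂μ, ∀ z ∈ Metric.ball z0 ε, ‖f z a‖ ≤ bound a) :
    DifferentiableOn ℂ (fun z => ∫ a, f z a ∂μ) U := by
  intro z0 hz0
  obtain ⟨ε1, hε1, bound, hbi, hbd⟩ := hb z0 hz0
  obtain ⟨ε2, hε2, hball⟩ := Metric.isOpen_iff.1 hU z0 hz0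
  set ε := min ε1 ε2 with hε
  have hεpos : 0 < ε := lt_min hε1 hε2
  have hsubU : Metric.ball z0 ε ⊆ U := (Metric.ball_subset_ball (min_le_right _ _)).trans hball
  have hsub1 : Metric.ball z0 ε ⊆ Metric.ball z0 ε1 := Metric.ball_subset_ball (min_le_left _ _)
  have hdiff : ∀ᵐ a ∂μ, ∀ z ∈ Metric.ball z0 (ε/2),
      HasDerivAt (fun z => f z a) (deriv (fun z => f z a) z) z := by
    filter_upwards [hd] with a ha z hz
    have : z ∈ U := hsubU (Metric.ball_subset_ball (by linarith) hz)
    exact ((ha z this).differentiableAt (hU.mem_nhds this)).hasDerivAt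
  have hbound : ∀ᵐ a ∂μ, ∀ z ∈ Metric.ball z0 (ε/2),
      ‖deriv (fun z => f z a) z‖ ≤ bound a / (ε/4) := by
    filter_upwards [hd, hbd] with a ha hba z hz
    have hsub : Metric.closedBall z (ε/4) ⊆ Metric.ball z0 ε := by
      intro w hw
      rw [Metric.mem_ball] at *
      rw [Metric.mem_closedBall] at hw
      have := dist_triangle w z z0
      linarith
    refine Complex.norm_deriv_le_of_forall_mem_sphere_norm_le (by positivity) ?_ ?_
    · refine DifferentiableOn.diffContOnCl ?_
      refine ha.mono ?_
      rw [closure_ball _ (by positivity)]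
      exact hsub.trans hsubU
    · intro w hw
      exact hba w (hsub1 (hsub (Metric.sphere_subset_closedBall hw)))
  have hmeas' : AEStronglyMeasurable (fun a => deriv (fun z => f z a) z0) μ := by
    obtain ⟨v, hv0, hvt⟩ : ∃ v : ℕ → ℂ, (∀ n, v n ≠ 0 ∧ z0 + v n ∈ U) ∧ Tendsto v atTop (𝓝 0) := by
      refine ⟨fun n => ((ε/2) * (1/((n:ℝ)+1)) : ℝ), fun n => ⟨?_, ?_⟩, ?_⟩
      · have : (0:ℝ) < (ε/2) * (1/((n:ℝ)+1)) := by positivity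
        exact Complex.ofReal_ne_zero.2 this.ne'
      · apply hsubU
        rw [Metric.mem_ball, dist_eq_norm]
        simp only [add_sub_cancel_left, Complex.norm_real, Real.norm_eq_abs]
        rw [abs_of_pos (by positivity)]
        have : (1/((n:ℝ)+1)) ≤ 1 := by
          rw [div_le_one (by positivity)]
          have : (0:ℝ) ≤ n := by positivity
          linarith
        nlinarith
      · have := (tendsto_one_div_add_atTop_nhds_zero_nat (𝕜 := ℝ)).const_mul (ε/2)
        rw [mul_zero] at this
        exact_mod_cast (Complex.continuous_ofReal.tendsto 0).comp this
    refine aestronglyMeasurable_of_tendsto_ae (u := atTop)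
      (f := fun n a => (v n)⁻¹ • (f (z0 + v n) a - f z0 a)) ?_ ?_
    · intro n
      exact ((hm _ (hv0 n).2).sub (hm _ hz0)).const_smul ((v n)⁻¹)
    · filter_upwards [hdiff] with a ha
      have h1 := (ha z0 (Metric.mem_ball_self (by positivity))).tendsto_slope_zero
      refine h1.comp ?_
      rw [tendsto_nhdsWithin_iff]
      exact ⟨hvt, Eventually.of_forall fun n => (hv0 n).1⟩
  have := hasDerivAt_integral_of_dominated_loc_of_deriv_le (μ := μ) (F := f)
    (F' := fun z a => deriv (fun z => f z a) z) (x₀ := z0)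
    (bound := fun a => bound a / (ε/4))
    (Metric.ball_mem_nhds z0 (by positivity : 0 < ε/2))
    (by filter_upwards [hU.mem_nhds hz0] with z hz using hm z hz)
    (by
      refine hbi.mono' (hm z0 hz0) ?_
      filter_upwards [hbd] with a ha using ha z0 (Metric.mem_ball_self hε1))
    hmeas' hbound (hbi.div_const _) hdiff
  exact this.2.differentiableAt.differentiableWithinAt

/-- Maximum principle for the real part on a rectangle in the upper half plane. -/
theorem rect_max {f : ℂ → ℂ} (hf : DifferentiableOn ℂ f {z : ℂ | 0 < z.im})
    {x1 x2 η h M : ℝ} (hx : x1 < x2) (hη : 0 < η) (hh : η < h)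
    (hbot : ∀ x ∈ Icc x1 x2, (f (x + η * I)).re ≤ M)
    (htop : ∀ x ∈ Icc x1 x2, (f (x + h * I)).re ≤ M)
    (hl : ∀ t ∈ Icc η h, (f (x1 + t * I)).re ≤ M)
    (hr : ∀ t ∈ Icc η h, (f (x2 + t * I)).re ≤ M)
    {x t : ℝ} (hxm : x ∈ Icc x1 x2) (ht : t ∈ Icc η h) : (f (x + t * I)).re ≤ M := by
  have hcl : closure (Ioo x1 x2 ×ℂ Ioo η h) = Icc x1 x2 ×ℂ Icc η h := by
    rw [closure_reProdIm, closure_Ioo hx.ne, closure_Ioo hh.ne]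
  have hsub : Icc x1 x2 ×ℂ Icc η h ⊆ {z : ℂ | 0 < z.im} := by
    intro z hz
    rw [mem_reProdIm] at hz
    exact lt_of_lt_of_le hη hz.2.1
  have hrep : ∀ z : ℂ, z = (z.re : ℂ) + (z.im : ℂ) * I := fun z => (re_add_im z).symm
  have key := Complex.norm_le_of_forall_mem_frontier_norm_le (f := fun z => cexp (f z))
    (U := Ioo x1 x2 ×ℂ Ioo η h) (C := Real.exp M) (z := (x + t * I : ℂ))
    ((Metric.isBounded_Ioo _ _).reProdIm (Metric.isBounded_Ioo _ _)) ?_ ?_ ?_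
  · rw [Complex.norm_exp] at key
    exact Real.exp_le_exp.1 key
  · refine DifferentiableOn.diffContOnCl ?_
    rw [hcl]
    exact (hf.mono hsub).cexp
  · intro z hz
    rw [frontier_reProdIm, closure_Ioo hx.ne, closure_Ioo hh.ne, frontier_Ioo hx,
      frontier_Ioo hh] at hz
    rw [Complex.norm_exp]
    apply Real.exp_le_exp.2
    rw [hrep z]
    rcases hz with hz | hz
    · rw [mem_reProdIm] at hz
      rcases hz.2 with h1 | h1
      · rw [h1]; exact hbot _ hz.1
      · rw [mem_singleton_iff.1 h1]; exact htop _ hz.1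
    · rw [mem_reProdIm] at hz
      rcases hz.1 with h1 | h1
      · rw [h1]; exact hl _ hz.2
      · rw [mem_singleton_iff.1 h1]; exact hr _ hz.2
  · rw [hcl, mem_reProdIm]
    simpa using ⟨hxm, ht⟩

end FL

namespace FL
open Complex Set Filter Topology

theorem re_cpow_ge {γ : ℝ} (hγ0 : 0 < γ) (hγ : γ < 2) {w : ℂ} (hre : 0 < w.re)
    (him : |w.im| ≤ w.re) :
    Real.cos (γ * (Real.pi / 4)) * ‖w‖ ^ (-γ) ≤ (w ^ ((-γ : ℝ) : ℂ)).re := by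
  have hw : w ≠ 0 := by
    intro h; simp [h] at hre
  have harg : |w.arg| ≤ Real.pi / 4 := by
    have h1 : |w.arg| < Real.pi / 2 := Complex.abs_arg_lt_pi_div_two_iff.2 (Or.inl hre)
    have h2 := Real.arctan_tan (neg_lt_of_abs_lt h1) (lt_of_abs_lt h1)
    rw [Complex.tan_arg] at h2
    rw [← h2, ← Real.arctan_one, abs_le, ← Real.arctan_neg]
    rw [abs_le] at him
    constructor
    · apply Real.arctan_mono
      rw [le_div_iff₀ hre]; linarith
    · apply Real.arctan_mono
      rw [div_le_iff₀ hre]; linarith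
  rw [Complex.cpow_ofReal_re, mul_comm]
  refine mul_le_mul_of_nonneg_left ?_ (by positivity)
  have e1 : Real.cos (w.arg * -γ) = Real.cos (γ * |w.arg|) := by
    rw [mul_neg, Real.cos_neg, mul_comm, ← Real.cos_abs, abs_mul, abs_of_pos hγ0]
  rw [e1]
  apply Real.cos_le_cos_of_nonneg_of_le_pi
  · positivity
  · nlinarith [Real.pi_pos]
  · exact mul_le_mul_of_nonneg_left harg hγ0.le

theorem barrier {γ : ℝ} (hγ0 : 0 < γ) (hγ : γ < 2) : ∃ c : ℝ, 0 < c ∧ ∀ a : ℝ,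
    ∃ QL QR : ℂ → ℂ, DifferentiableOn ℂ QL {z : ℂ | 0 < z.im} ∧
      DifferentiableOn ℂ QR {z : ℂ | 0 < z.im} ∧
      (∀ x t : ℝ, 0 < t → a ≤ x → c * ‖(x + t * I : ℂ) - a‖ ^ (-γ) ≤ (QL (x + t * I)).re) ∧
      (∀ x t : ℝ, 0 < t → x ≤ a → c * ‖(x + t * I : ℂ) - a‖ ^ (-γ) ≤ (QR (x + t * I)).re) ∧
      (∀ x t : ℝ, 0 < t → ‖QL (x + t * I)‖ ≤ ‖(x + t * I : ℂ) - a‖ ^ (-γ)) ∧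
      (∀ x t : ℝ, 0 < t → ‖QR (x + t * I)‖ ≤ ‖(x + t * I : ℂ) - a‖ ^ (-γ)) := by
  have hs2 : (0:ℝ) < Real.sqrt 2 := by positivity
  have hs1 : (1:ℝ) ≤ Real.sqrt 2 := by
    rw [Real.one_le_sqrt]; norm_num
  have hcos : 0 < Real.cos (γ * (Real.pi / 4)) := by
    apply Real.cos_pos_of_mem_Ioo
    constructor <;> nlinarith [Real.pi_pos]
  have hn1 : ‖(1 - I : ℂ)‖ = Real.sqrt 2 := by
    rw [Complex.norm_def, normSq_apply]; norm_num
  have hn2 : ‖(-1 - I : ℂ)‖ = Real.sqrt 2 := by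
    rw [Complex.norm_def, normSq_apply]; norm_num
  have hpow : ∀ v : ℂ, (Real.sqrt 2 * ‖v‖) ^ (-γ) = Real.sqrt 2 ^ (-γ) * ‖v‖ ^ (-γ) := fun v =>
    Real.mul_rpow hs2.le (norm_nonneg _)
  have hle1 : Real.sqrt 2 ^ (-γ) ≤ 1 := Real.rpow_le_one_of_one_le_of_nonpos hs1 (by linarith)
  refine ⟨Real.cos (γ * (Real.pi / 4)) * Real.sqrt 2 ^ (-γ), by positivity, fun a => ?_⟩
  refine ⟨fun z => ((1 - I) * (z - a)) ^ ((-γ : ℝ) : ℂ),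
    fun z => ((-1 - I) * (z - a)) ^ ((-γ : ℝ) : ℂ), ?_, ?_, ?_, ?_, ?_, ?_⟩
  · refine DifferentiableOn.cpow_const (by fun_prop) ?_
    intro z hz
    simp only [mem_ofPred_eq] at hz
    rw [Complex.mem_slitPlane_iff]
    simp
    by_contra! h
    linarith [h.1, h.2]
  · refine DifferentiableOn.cpow_const (by fun_prop) ?_
    intro z hz
    simp only [mem_ofPred_eq] at hz
    rw [Complex.mem_slitPlane_iff]
    simp
    by_contra! h
    linarith [h.1, h.2]
  · intro x t ht hx
    have := re_cpow_ge hγ0 hγ (w := (1 - I) * ((x + t * I : ℂ) - a)) (by simp; linarith)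
      (by simp; rw [abs_le]; constructor <;> linarith)
    rwa [norm_mul, hn1, hpow, ← mul_assoc] at this
  · intro x t ht hx
    have := re_cpow_ge hγ0 hγ (w := (-1 - I) * ((x + t * I : ℂ) - a)) (by simp; linarith)
      (by simp; rw [abs_le]; constructor <;> linarith)
    rwa [norm_mul, hn2, hpow, ← mul_assoc] at this
  · intro x t ht
    simp only
    rw [Complex.norm_cpow_real, norm_mul, hn1, hpow]
    exact mul_le_of_le_one_left (by positivity) hle1
  · intro x t ht
    simp only
    rw [Complex.norm_cpow_real, norm_mul, hn2, hpow]
    exact mul_le_of_le_one_left (by positivity) hle1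

theorem norm_ge_im (x t a : ℝ) : |t| ≤ ‖(x + t * I : ℂ) - a‖ := by
  have := Complex.abs_im_le_norm ((x + t * I : ℂ) - a)
  simpa using this
theorem norm_ge_re (x t a : ℝ) : |x - a| ≤ ‖(x + t * I : ℂ) - a‖ := by
  have := Complex.abs_re_le_norm ((x + t * I : ℂ) - a)
  simpa using this
theorem norm_le_add (x t a : ℝ) : ‖(x + t * I : ℂ) - a‖ ≤ |x - a| + |t| := by
  have := Complex.norm_le_abs_re_add_abs_im ((x + t * I : ℂ) - a)
  simpa using this

/-- uniform smallness on compact subintervals -/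
theorem unif_of_loc {W : ℝ → ℝ → Prop} {x1 x2 : ℝ}
    (h : ∀ x ∈ Icc x1 x2, ∀ᶠ q : ℝ × ℝ in 𝓝 x ×ˢ 𝓝[>] (0:ℝ), W q.1 q.2) :
    ∃ η0 > 0, ∀ η, 0 < η → η < η0 → ∀ x ∈ Icc x1 x2, W x η := by
  have h2 : ∀ᶠ η in 𝓝[>] (0:ℝ), ∀ x ∈ Icc x1 x2, W x η := by
    have h3 : ∀ᶠ q : ℝ × ℝ in 𝓝ˢ (Icc x1 x2) ×ˢ 𝓝[>] (0:ℝ), W q.1 q.2 := by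
      rw [isCompact_Icc.nhdsSet_prod_eq_biSup]
      simpa using h
    obtain ⟨U, hU, V, hV, hUV⟩ := Filter.mem_prod_iff.1 h3
    filter_upwards [hV] with η hη x hx
    exact hUV (Set.mk_mem_prod (subset_of_mem_nhdsSet hU hx) hη)
  obtain ⟨η0, h0, h1⟩ := mem_nhdsGT_iff_exists_Ioo_subset.1 h2
  exact ⟨η0, h0, fun η ha hb => h1 ⟨ha, hb⟩⟩

/-- preliminary bound near the bottom side -/
theorem pl_beta {s : ℝ} (hs0 : 0 < s) (hs1 : s < 1) : ∃ K : ℝ, 1 ≤ K ∧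
    ∀ {H : ℂ → ℂ} (_ : DifferentiableOn ℂ H {z : ℂ | 0 < z.im}) {a b C : ℝ}
    (_ : b - a ≤ 1) (_ : 0 ≤ C)
    (_ : ∀ x ∈ Icc a b, ∀ t ∈ Ioc (0:ℝ) 1, (H (x + t * I)).re ≤ C * t ^ (-(2*s)))
    (_ : ∀ x ∈ Ioo a b, ∀ᶠ q : ℝ × ℝ in 𝓝 x ×ˢ 𝓝[>] (0:ℝ), (H (q.1 + q.2 * I)).re ≤ 1),
    ∀ x ∈ Ioo a b, ∀ t ∈ Ioc (0:ℝ) 1,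
      (H (x + t * I)).re ≤ K * C * (min (x - a) (b - x) / 2) ^ (-(2*s)) + 1 := by
  obtain ⟨c, hc, hbar⟩ := barrier (γ := 2*s) (by linarith) (by linarith)
  refine ⟨1 + 2 / c, by have : 0 < 2 / c := by positivity
                        linarith, ?_⟩
  intro H hH a b C hab hC hbd hloc x hx t ht
  set r := min (x - a) (b - x) / 2 with hr
  have hr0 : 0 < r := by
    have : 0 < min (x - a) (b - x) := lt_min (by linarith [hx.1]) (by linarith [hx.2])
    positivity
  have hra : 2 * r ≤ x - a := by
    have := min_le_left (x - a) (b - x); linarith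
  have hrb : 2 * r ≤ b - x := by
    have := min_le_right (x - a) (b - x); linarith
  have hrpow : 0 < r ^ (-(2*s)) := by positivity
  have hdc : 0 ≤ C / c := by positivity
  have hneg : -(2*s) ≤ 0 := by linarith
  rcases le_or_gt r t with hrt | hrt
  · have h1 := hbd x ⟨hx.1.le, hx.2.le⟩ t ht
    have h2 : t ^ (-(2*s)) ≤ r ^ (-(2*s)) := Real.rpow_le_rpow_of_nonpos hr0 hrt hneg
    have h3 : C * t ^ (-(2*s)) ≤ C * r ^ (-(2*s)) := mul_le_mul_of_nonneg_left h2 hC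
    have h4 : 0 ≤ 2 / c * C * r ^ (-(2*s)) := by positivity
    nlinarith
  · obtain ⟨QL, -, hQLd, -, hQL, -, hQLn, -⟩ := hbar (x - r)
    obtain ⟨-, QR, -, hQRd, -, hQR, -, hQRn⟩ := hbar (x + r)
    obtain ⟨η0, hη0, hη⟩ := unif_of_loc (W := fun x η => (H (x + η * I)).re ≤ 1)
      (x1 := x - r) (x2 := x + r) (fun y hy => hloc y ⟨by linarith [hy.1], by linarith [hy.2]⟩)
    set η := min (η0 / 2) (t / 2) with hηd
    have hηpos : 0 < η := lt_min (by linarith) (by linarith [ht.1])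
    have hη1 : η < η0 := lt_of_le_of_lt (min_le_left _ _) (by linarith)
    have hη2 : η < t := lt_of_le_of_lt (min_le_right _ _) (by linarith [ht.1])
    have hLnn : ∀ y τ : ℝ, 0 < τ → x - r ≤ y → 0 ≤ (QL (y + τ * I)).re := fun y τ h1 h2 =>
      le_trans (by positivity) (hQL y τ h1 h2)
    have hRnn : ∀ y τ : ℝ, 0 < τ → y ≤ x + r → 0 ≤ (QR (y + τ * I)).re := fun y τ h1 h2 =>
      le_trans (by positivity) (hQR y τ h1 h2)
    have hre : ∀ z, (H z - ((C / c : ℝ) : ℂ) * (QL z + QR z)).re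
        = (H z).re - C / c * ((QL z).re + (QR z).re) := by
      intro z; rw [sub_re, re_ofReal_mul, add_re]
    have main := rect_max (f := fun z => H z - ((C / c : ℝ) : ℂ) * (QL z + QR z))
      (hH.sub ((hQLd.add hQRd).const_mul _))
      (x1 := x - r) (x2 := x + r) (η := η) (h := r) (M := C * r ^ (-(2*s)) + 1)
      (by linarith) hηpos (by linarith) ?_ ?_ ?_ ?_ (x := x) (t := t)
      ⟨by linarith, by linarith⟩ ⟨hη2.le, hrt.le⟩
    · rw [hre] at main
      have e1 : (QL (x + t * I)).re ≤ r ^ (-(2*s)) := by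
        refine ((Complex.re_le_norm _).trans (hQLn x t ht.1)).trans ?_
        refine Real.rpow_le_rpow_of_nonpos hr0 ?_ hneg
        refine le_trans ?_ (norm_ge_re x t (x - r))
        rw [sub_sub_cancel, abs_of_pos hr0]
      have e2 : (QR (x + t * I)).re ≤ r ^ (-(2*s)) := by
        refine ((Complex.re_le_norm _).trans (hQRn x t ht.1)).trans ?_
        refine Real.rpow_le_rpow_of_nonpos hr0 ?_ hneg
        refine le_trans ?_ (norm_ge_re x t (x + r))
        rw [sub_add_cancel_left, abs_neg, abs_of_pos hr0]
      have e3 : C / c * ((QL (x + t * I)).re + (QR (x + t * I)).re)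
          ≤ C / c * (r ^ (-(2*s)) + r ^ (-(2*s))) :=
        mul_le_mul_of_nonneg_left (by linarith) hdc
      have e4 : (1 + 2 / c) * C * r ^ (-(2*s)) = C * r ^ (-(2*s)) +
          C / c * (r ^ (-(2*s)) + r ^ (-(2*s))) := by ring
      linarith
    · intro y hy
      rw [hre]
      have h1 := hη η hηpos hη1 y hy
      have h2 := mul_nonneg hdc (add_nonneg (hLnn y η hηpos hy.1) (hRnn y η hηpos hy.2))
      have h3 : 0 ≤ C * r ^ (-(2*s)) := by positivity
      linarith
    · intro y hy
      rw [hre]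
      have h1 := hbd y ⟨by linarith [hy.1], by linarith [hy.2]⟩ r ⟨hr0, by linarith⟩
      have h2 := mul_nonneg hdc (add_nonneg (hLnn y r hr0 hy.1) (hRnn y r hr0 hy.2))
      linarith
    · intro τ hτ
      have hτ0 : 0 < τ := lt_of_lt_of_le hηpos hτ.1
      rw [hre]
      have h1 := hbd (x - r) ⟨by linarith, by linarith⟩ τ ⟨hτ0, by linarith [hτ.2]⟩
      have h2 := hRnn (x - r) τ hτ0 (by linarith)
      have h3 := hQL (x - r) τ hτ0 le_rfl
      have h4 : ‖((x - r : ℝ) : ℂ) + τ * I - ((x - r : ℝ) : ℂ)‖ = τ := by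
        rw [add_sub_cancel_left, norm_mul, Complex.norm_I, mul_one, Complex.norm_real,
          Real.norm_eq_abs, abs_of_pos hτ0]
      rw [h4] at h3
      have h5 := mul_le_mul_of_nonneg_left (add_le_add h3 h2) hdc
      have h6 : C / c * (c * τ ^ (-(2*s)) + 0) = C * τ ^ (-(2*s)) := by field_simp; ring
      rw [h6] at h5
      have h7 : 0 ≤ C * r ^ (-(2*s)) := by positivity
      linarith
    · intro τ hτ
      have hτ0 : 0 < τ := lt_of_lt_of_le hηpos hτ.1
      rw [hre]
      have h1 := hbd (x + r) ⟨by linarith, by linarith⟩ τ ⟨hτ0, by linarith [hτ.2]⟩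
      have h2 := hLnn (x + r) τ hτ0 (by linarith)
      have h3 := hQR (x + r) τ hτ0 le_rfl
      have h4 : ‖((x + r : ℝ) : ℂ) + τ * I - ((x + r : ℝ) : ℂ)‖ = τ := by
        rw [add_sub_cancel_left, norm_mul, Complex.norm_I, mul_one, Complex.norm_real,
          Real.norm_eq_abs, abs_of_pos hτ0]
      rw [h4] at h3
      have h5 := mul_le_mul_of_nonneg_left (add_le_add h2 h3) hdc
      have h6 : C / c * (0 + c * τ ^ (-(2*s))) = C * τ ^ (-(2*s)) := by field_simp; ring
      rw [h6] at h5
      have h7 : 0 ≤ C * r ^ (-(2*s)) := by positivity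
      linarith

/-- Phragmen-Lindelof on a rectangle over a good interval. -/
theorem pl_rect {s : ℝ} (hs0 : 0 < s) (hs1 : s < 1)
    {H : ℂ → ℂ} (hH : DifferentiableOn ℂ H {z : ℂ | 0 < z.im}) {a b C N : ℝ} (hab : a < b)
    (hab1 : b - a ≤ 1) (hC : 0 ≤ C)
    (hbd : ∀ x ∈ Icc a b, ∀ t ∈ Ioc (0:ℝ) 1, (H (x + t * I)).re ≤ C * t ^ (-(2*s)))
    (hloc : ∀ x ∈ Ioo a b, ∀ᶠ q : ℝ × ℝ in 𝓝 x ×ˢ 𝓝[>] (0:ℝ), (H (q.1 + q.2 * I)).re ≤ 1)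
    (hN : 1 ≤ N) (hl : ∀ t ∈ Ioc (0:ℝ) 1, (H (a + t * I)).re ≤ N)
    (hr : ∀ t ∈ Ioc (0:ℝ) 1, (H (b + t * I)).re ≤ N)
    (ht : ∀ x ∈ Icc a b, (H (x + (1:ℝ) * I)).re ≤ N) :
    ∀ x ∈ Icc a b, ∀ t ∈ Ioc (0:ℝ) 1, (H (x + t * I)).re ≤ N := by
  obtain ⟨K, hK, hbeta⟩ := pl_beta hs0 hs1
  have hbeta' := hbeta hH hab1 hC hbd hloc
  have hneg : -(2*s) ≤ 0 := by linarith
  have hKC : 0 ≤ K * C := by positivity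
  -- combined bound
  have hβ : ∀ x ∈ Ioo a b, ∀ t ∈ Ioc (0:ℝ) 1,
      (H (x + t * I)).re ≤ K * C * ((min (x - a) (b - x) + t) / 4) ^ (-(2*s)) + 1 := by
    intro x hx t ht
    have hd0 : 0 < min (x - a) (b - x) := lt_min (by linarith [hx.1]) (by linarith [hx.2])
    set d := min (x - a) (b - x)
    rcases le_or_gt t d with h | h
    · refine (hbeta' x hx t ht).trans ?_
      have : (d / 2) ^ (-(2*s)) ≤ ((d + t) / 4) ^ (-(2*s)) :=
        Real.rpow_le_rpow_of_nonpos (by linarith [ht.1]) (by linarith) hneg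
      have := mul_le_mul_of_nonneg_left this hKC
      linarith
    · have h1 := hbd x ⟨hx.1.le, hx.2.le⟩ t ht
      have h2 : t ^ (-(2*s)) ≤ ((d + t) / 4) ^ (-(2*s)) :=
        Real.rpow_le_rpow_of_nonpos (by linarith [ht.1]) (by linarith) hneg
      have h3 := mul_le_mul_of_nonneg_left h2 hKC
      have h4 : 0 ≤ t ^ (-(2*s)) := Real.rpow_nonneg ht.1.le _
      have h5 : C * t ^ (-(2*s)) ≤ K * C * t ^ (-(2*s)) := by
        apply mul_le_mul_of_nonneg_right _ h4
        nlinarith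
      linarith
  -- the barrier
  obtain ⟨c, hc, hbar⟩ := barrier (γ := s + 1) (by linarith) (by linarith)
  obtain ⟨QL, -, hQLd, -, hQL, -, hQLn, -⟩ := hbar a
  obtain ⟨-, QR, -, hQRd, -, hQR, -, hQRn⟩ := hbar b
  have hLnn : ∀ y τ : ℝ, 0 < τ → a ≤ y → 0 ≤ (QL (y + τ * I)).re := fun y τ h1 h2 =>
      le_trans (by positivity) (hQL y τ h1 h2)
  have hRnn : ∀ y τ : ℝ, 0 < τ → y ≤ b → 0 ≤ (QR (y + τ * I)).re := fun y τ h1 h2 =>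
      le_trans (by positivity) (hQR y τ h1 h2)
  intro x hx t htm
  -- epsilon version
  have heps : ∀ ε : ℝ, 0 < ε →
      (H (x + t * I)).re - ε * ((QL (x + t * I)).re + (QR (x + t * I)).re) ≤ N := by
    intro ε hε
    have hre : ∀ z, (H z - ((ε : ℝ) : ℂ) * (QL z + QR z)).re
        = (H z).re - ε * ((QL z).re + (QR z).re) := by
      intro z; rw [sub_re, re_ofReal_mul, add_re]
    obtain ⟨σ0, hσ0, hσ⟩ : ∃ σ0 > 0, ∀ σ, 0 < σ → σ < σ0 →
        K * C * (σ / 4) ^ (-(2*s)) ≤ ε * (c * σ ^ (-(s+1))) := by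
      have htd : Tendsto (fun σ : ℝ => K * C * (4:ℝ) ^ (2*s) * σ ^ (1 - s)) (𝓝[>] 0) (𝓝 0) := by
        have h1 : Tendsto (fun σ : ℝ => σ ^ (1 - s)) (𝓝[>] 0) (𝓝 0) := by
          have := (Real.continuousAt_rpow_const 0 (1 - s) (Or.inr (by linarith))).tendsto
          rw [Real.zero_rpow (by linarith)] at this
          exact this.mono_left nhdsWithin_le_nhds
        simpa using h1.const_mul (K * C * (4:ℝ) ^ (2*s))
      have hev := htd.eventually (gt_mem_nhds (show (0:ℝ) < ε * c by positivity))
      obtain ⟨σ0, h0, h1⟩ := mem_nhdsGT_iff_exists_Ioo_subset.1 hev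
      refine ⟨σ0, h0, fun σ ha hb => ?_⟩
      have h2 : K * C * (4:ℝ) ^ (2*s) * σ ^ (1 - s) < ε * c := h1 ⟨ha, hb⟩
      have h3 : 0 < σ ^ (-(s+1)) := by positivity
      have h4 : (σ / 4) ^ (-(2*s)) = (4:ℝ) ^ (2*s) * (σ ^ (1 - s) * σ ^ (-(s+1))) := by
        rw [← Real.rpow_add ha, Real.div_rpow ha.le (by norm_num), Real.rpow_neg (by norm_num : (0:ℝ) ≤ 4)]
        rw [div_inv_eq_mul, mul_comm]
        congr 2; ring
      rw [h4]
      have := mul_le_mul_of_nonneg_right h2.le h3.le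
      linarith
    set ρ := min (σ0 / 2) ((b - a) / 4) with hρ
    have hρ0 : 0 < ρ := lt_min (by linarith) (by linarith)
    obtain ⟨η0, hη0, hη⟩ := unif_of_loc (W := fun x η => (H (x + η * I)).re ≤ 1)
      (x1 := a + ρ) (x2 := b - ρ) (fun y hy => hloc y ⟨by linarith [hy.1], by linarith [hy.2]⟩)
    rcases eq_or_lt_of_le htm.2 with ht1 | ht1
    · rw [ht1]
      have h1 := ht x hx
      have := mul_nonneg hε.le (add_nonneg (hLnn x 1 one_pos hx.1) (hRnn x 1 one_pos hx.2))
      linarith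
    set η := min (η0 / 2) (min (t / 2) (σ0 / 4)) with hηd
    have hηpos : 0 < η := lt_min (by linarith) (lt_min (by linarith [htm.1]) (by linarith))
    have hη1 : η < η0 := lt_of_le_of_lt (min_le_left _ _) (by linarith)
    have hη2 : η < t := lt_of_le_of_lt ((min_le_right _ _).trans (min_le_left _ _)) (by linarith [htm.1])
    have hη3 : η < σ0 / 2 := lt_of_le_of_lt ((min_le_right _ _).trans (min_le_right _ _)) (by linarith)
    rw [← hre]
    refine rect_max (f := fun z => H z - ((ε : ℝ) : ℂ) * (QL z + QR z))
      (hH.sub ((hQLd.add hQRd).const_mul _))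
      (x1 := a) (x2 := b) (η := η) (h := 1) (M := N) hab hηpos (by linarith) ?_ ?_ ?_ ?_
      hx ⟨hη2.le, ht1.le⟩
    · intro y hy
      rw [hre]
      have hL0 := hLnn y η hηpos hy.1
      have hR0 := hRnn y η hηpos hy.2
      have hsum := mul_nonneg hε.le (add_nonneg hL0 hR0)
      rcases eq_or_lt_of_le hy.1 with hya | hya
      · rw [← hya]; rw [← hya] at hsum
        have := hl η ⟨hηpos, by linarith⟩
        linarith
      rcases eq_or_lt_of_le hy.2 with hyb | hyb
      · rw [hyb]; rw [hyb] at hsum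
        have := hr η ⟨hηpos, by linarith⟩
        linarith
      rcases lt_or_ge y (a + ρ) with hy1 | hy1
      · have hmin : min (y - a) (b - y) = y - a := by
          apply min_eq_left
          have := min_le_right (σ0 / 2) ((b - a) / 4)
          linarith
        have h1 := hβ y ⟨hya, hyb⟩ η ⟨hηpos, by linarith⟩
        rw [hmin] at h1
        have h2 := hσ (y - a + η) (by linarith) (by
          have := min_le_left (σ0 / 2) ((b - a) / 4)
          linarith)
        have h3 := hQL y η hηpos hya.le
        have h4 : (y - a + η) ^ (-(s+1)) ≤ ‖(y + η * I : ℂ) - a‖ ^ (-(s+1)) := by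
          refine Real.rpow_le_rpow_of_nonpos ?_ ?_ (by linarith)
          · refine lt_of_lt_of_le ?_ (norm_ge_im y η a)
            rw [abs_of_pos hηpos]; exact hηpos
          · refine (norm_le_add y η a).trans (le_of_eq ?_)
            rw [abs_of_pos hηpos, abs_of_pos (by linarith)]
        have h5 := mul_le_mul_of_nonneg_left h4 hc.le
        have h6 := mul_le_mul_of_nonneg_left (h5.trans h3) hε.le
        have h7 := mul_nonneg hε.le hR0
        linarith
      rcases lt_or_ge (b - ρ) y with hy2 | hy2
      · have hmin : min (y - a) (b - y) = b - y := by
          apply min_eq_right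
          have := min_le_right (σ0 / 2) ((b - a) / 4)
          linarith
        have h1 := hβ y ⟨hya, hyb⟩ η ⟨hηpos, by linarith⟩
        rw [hmin] at h1
        have h2 := hσ (b - y + η) (by linarith) (by
          have := min_le_left (σ0 / 2) ((b - a) / 4)
          linarith)
        have h3 := hQR y η hηpos hyb.le
        have h4 : (b - y + η) ^ (-(s+1)) ≤ ‖(y + η * I : ℂ) - b‖ ^ (-(s+1)) := by
          refine Real.rpow_le_rpow_of_nonpos ?_ ?_ (by linarith)
          · refine lt_of_lt_of_le ?_ (norm_ge_im y η b)
            rw [abs_of_pos hηpos]; exact hηpos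
          · refine (norm_le_add y η b).trans (le_of_eq ?_)
            rw [abs_of_pos hηpos, abs_of_neg (by linarith)]; ring
        have h5 := mul_le_mul_of_nonneg_left h4 hc.le
        have h6 := mul_le_mul_of_nonneg_left (h5.trans h3) hε.le
        have h7 := mul_nonneg hε.le hL0
        linarith
      · have := hη η hηpos hη1 y ⟨hy1, hy2⟩
        linarith
    · intro y hy
      rw [hre]
      have h1 := ht y hy
      have h2 := mul_nonneg hε.le (add_nonneg (hLnn y 1 one_pos hy.1) (hRnn y 1 one_pos hy.2))
      linarith
    · intro τ hτ
      rw [hre]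
      have hτ0 : 0 < τ := lt_of_lt_of_le hηpos hτ.1
      have h1 := hl τ ⟨hτ0, hτ.2⟩
      have h2 := mul_nonneg hε.le (add_nonneg (hLnn a τ hτ0 le_rfl) (hRnn a τ hτ0 hab.le))
      linarith
    · intro τ hτ
      rw [hre]
      have hτ0 : 0 < τ := lt_of_lt_of_le hηpos hτ.1
      have h1 := hr τ ⟨hτ0, hτ.2⟩
      have h2 := mul_nonneg hε.le (add_nonneg (hLnn b τ hτ0 hab.le) (hRnn b τ hτ0 le_rfl))
      linarith
  have hlim : Tendsto (fun ε : ℝ =>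
      (H (x + t * I)).re - ε * ((QL (x + t * I)).re + (QR (x + t * I)).re)) (𝓝[>] 0)
      (𝓝 ((H (x + t * I)).re - 0 * ((QL (x + t * I)).re + (QR (x + t * I)).re))) := by
    refine Tendsto.mono_left ?_ nhdsWithin_le_nhds
    exact Continuous.tendsto (by fun_prop) 0
  rw [zero_mul, sub_zero] at hlim
  refine le_of_tendsto hlim ?_
  filter_upwards [self_mem_nhdsWithin] with ε hε using heps ε hε

end FL

namespace FL
open Complex Set Filter Topology

/-- Cauchy-type integral along a parametrised path. -/
noncomputable def cau (g γ : ℝ → ℂ) (a b : ℝ) (z : ℂ) : ℂ := ∫ y in a..b, g y / (γ y - z)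

theorem cau_holo {g γ : ℝ → ℂ} {a b M : ℝ} (hab : a ≤ b) (hg : ContinuousOn g (Ioc a b))
    (hgM : ∀ y ∈ Ioc a b, ‖g y‖ ≤ M) (hγ : Continuous γ) {U : Set ℂ} (hU : IsOpen U)
    (hUγ : ∀ z ∈ U, ∀ y ∈ Icc a b, γ y ≠ z) : DifferentiableOn ℂ (cau g γ a b) U := by
  have : cau g γ a b = fun z => ∫ y in Ioc a b, g y / (γ y - z) := by
    funext z; rw [cau, intervalIntegral.integral_of_le hab]
  rw [this]
  refine holo_integral hU ?_ ?_ ?_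
  · intro z hz
    refine ContinuousOn.aestronglyMeasurable ?_ measurableSet_Ioc
    refine hg.div (by fun_prop) ?_
    intro y hy
    exact sub_ne_zero.2 (hUγ z hz y ⟨hy.1.le, hy.2⟩)
  · filter_upwards [ae_restrict_mem measurableSet_Ioc] with y hy
    intro z hz
    have := sub_ne_zero.2 (hUγ z hz y ⟨hy.1.le, hy.2⟩)
    refine DifferentiableAt.differentiableWithinAt ?_
    refine DifferentiableAt.div (by fun_prop) (by fun_prop) this
  · intro z0 hz0
    have hK : IsCompact (γ '' Icc a b) := isCompact_Icc.image hγ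
    have hz : z0 ∉ γ '' Icc a b := by
      rintro ⟨y, hy, h⟩; exact hUγ z0 hz0 y hy h
    obtain ⟨ε, hε, hd⟩ := Metric.mem_nhds_iff.1 (hK.isClosed.isOpen_compl.mem_nhds hz)
    refine ⟨ε/2, by positivity, fun _ => M / (ε/2), ?_, ?_⟩
    · exact integrable_const _
    · filter_upwards [ae_restrict_mem measurableSet_Ioc] with y hy z hz
      have h1 : ε ≤ dist (γ y) z0 := by
        by_contra h
        push Not at h
        exact hd (Metric.mem_ball.2 h) ⟨y, ⟨hy.1.le, hy.2⟩, rfl⟩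
      have h2 : ε/2 ≤ ‖γ y - z‖ := by
        rw [← dist_eq_norm]
        have := dist_triangle (γ y) z z0
        rw [Metric.mem_ball] at hz
        linarith
      rw [norm_div]
      have hM : 0 ≤ M := (norm_nonneg _).trans (hgM y hy)
      exact div_le_div₀ hM (hgM y hy) (by positivity) h2

theorem cau_sub_const {g γ : ℝ → ℂ} {a b : ℝ} (hab : a ≤ b) (hg : ContinuousOn g (Icc a b))
    (hγ : Continuous γ) {z : ℂ} (hz : ∀ y ∈ Icc a b, γ y ≠ z) (w : ℂ) :
    ∫ y in a..b, (g y - w) / (γ y - z) = cau g γ a b z - w * cau (fun _ => 1) γ a b z := by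
  have hne : ∀ y ∈ Icc a b, γ y - z ≠ 0 := fun y hy => sub_ne_zero.2 (hz y hy)
  have hsub : ContinuousOn (fun y => γ y - z) (Icc a b) := by fun_prop
  rw [cau, cau, ← intervalIntegral.integral_const_mul, ← intervalIntegral.integral_sub]
  · congr 1; funext y; ring
  · refine ContinuousOn.intervalIntegrable ?_
    rw [uIcc_of_le hab]
    exact hg.div hsub hne
  · refine ContinuousOn.intervalIntegrable ?_
    rw [uIcc_of_le hab]
    exact continuousOn_const.mul (continuousOn_const.div hsub hne)

theorem cau_tendsto {g : ℝ → ℝ → ℂ} {g0 γ : ℝ → ℂ} {a b M : ℝ} (hab : a ≤ b)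
    (hg : ∀ᶠ η in 𝓝[>] (0:ℝ), ContinuousOn (g η) (Ioc a b))
    (hM : ∀ᶠ η in 𝓝[>] (0:ℝ), ∀ y ∈ Ioc a b, ‖g η y‖ ≤ M)
    (hlim : ∀ y ∈ Ioc a b, Tendsto (fun η => g η y) (𝓝[>] 0) (𝓝 (g0 y)))
    (hγ : Continuous γ) {z : ℂ} (hz : ∀ y ∈ Icc a b, γ y ≠ z) :
    Tendsto (fun η => cau (g η) γ a b z) (𝓝[>] 0) (𝓝 (cau g0 γ a b z)) := by
  have hne : ∀ y ∈ Icc a b, γ y - z ≠ 0 := fun y hy => sub_ne_zero.2 (hz y hy)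
  have hsub : ContinuousOn (fun y => γ y - z) (Icc a b) := by fun_prop
  unfold cau
  refine intervalIntegral.tendsto_integral_filter_of_dominated_convergence
    (fun y => M / ‖γ y - z‖) ?_ ?_ ?_ ?_
  · filter_upwards [hg] with η h
    rw [uIoc_of_le hab]
    refine ContinuousOn.aestronglyMeasurable ?_ measurableSet_Ioc
    exact h.div (hsub.mono Ioc_subset_Icc_self) fun y hy => hne y (Ioc_subset_Icc_self hy)
  · filter_upwards [hM] with η h
    refine Eventually.of_forall fun y hy => ?_
    rw [uIoc_of_le hab] at hy
    rw [norm_div]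
    exact div_le_div_of_nonneg_right (h y hy) (norm_nonneg _)
  · refine ContinuousOn.intervalIntegrable ?_
    rw [uIcc_of_le hab]
    exact continuousOn_const.div hsub.norm fun y hy => norm_ne_zero_iff.2 (hne y hy)
  · refine Eventually.of_forall fun y hy => ?_
    rw [uIoc_of_le hab] at hy
    exact (hlim y hy).div_const _

/-- Boundary Cauchy integral of a function and its reflection over a symmetric rectangle. -/
noncomputable def Gam (p q R : ℝ) (W : ℂ → ℂ) (z : ℂ) : ℂ :=
  - cau (fun x => W (x + R * I)) (fun x => x + R * I) p q z
  + cau (fun x => - (starRingEnd ℂ) (W (x + R * I))) (fun x => x - R * I) p q z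
  + I * (cau (fun y => W (q + y * I)) (fun y => q + y * I) 0 R z
    + cau (fun y => - (starRingEnd ℂ) (W (q + y * I))) (fun y => q - y * I) 0 R z)
  - I * (cau (fun y => W (p + y * I)) (fun y => p + y * I) 0 R z
    + cau (fun y => - (starRingEnd ℂ) (W (p + y * I))) (fun y => p - y * I) 0 R z)

theorem ne_top {R : ℝ} {z : ℂ} (hz : z.im < R) (x : ℝ) : (x + R * I : ℂ) ≠ z := by
  rintro rfl; simp at hz
theorem ne_bot {R : ℝ} {z : ℂ} (hz : -R < z.im) (x : ℝ) : (x - R * I : ℂ) ≠ z := by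
  rintro rfl; simp at hz
theorem ne_side {q : ℝ} {z : ℂ} (hz : z.re ≠ q) (x : ℝ) : (q + x * I : ℂ) ≠ z := by
  rintro rfl; simp at hz
theorem ne_side' {q : ℝ} {z : ℂ} (hz : z.re ≠ q) (x : ℝ) : (q - x * I : ℂ) ≠ z := by
  rintro rfl; simp at hz

theorem Gam_holo {p q R M : ℝ} (hpq : p ≤ q) (hR : 0 < R) {W : ℂ → ℂ}
    (hW : ContinuousOn W {z : ℂ | 0 < z.im})
    (htop : ∀ x ∈ Ioc p q, ‖W (x + R * I)‖ ≤ M)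
    (hr : ∀ y ∈ Ioc 0 R, ‖W (q + y * I)‖ ≤ M)
    (hl : ∀ y ∈ Ioc 0 R, ‖W (p + y * I)‖ ≤ M) :
    DifferentiableOn ℂ (Gam p q R W) (Ioo p q ×ℂ Ioo (-R) R) := by
  have hU : IsOpen (Ioo p q ×ℂ Ioo (-R) R) := isOpen_Ioo.reProdIm isOpen_Ioo
  have hconj : Continuous (fun z : ℂ => -(starRingEnd ℂ) z) := by fun_prop
  have c1 : ContinuousOn (fun x : ℝ => W (x + R * I)) (Ioc p q) :=
    hW.comp (by fun_prop) (fun x _ => by simpa using hR)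
  have c2 : ContinuousOn (fun y : ℝ => W (q + y * I)) (Ioc 0 R) :=
    hW.comp (by fun_prop) (fun x hx => by simpa using hx.1)
  have c3 : ContinuousOn (fun y : ℝ => W (p + y * I)) (Ioc 0 R) :=
    hW.comp (by fun_prop) (fun x hx => by simpa using hx.1)
  have b1 := cau_holo (γ := fun x => x + R * I) hpq c1 htop (by fun_prop) hU
    (fun z hz y _ => ne_top hz.2.2 y)
  have b2 := cau_holo (γ := fun x => x - R * I) (M := M) hpq (hconj.comp_continuousOn c1)
    (by simpa using htop) (by fun_prop) hU (fun z hz y _ => ne_bot hz.2.1 y)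
  have b3 := cau_holo (γ := fun y => q + y * I) hR.le c2 hr (by fun_prop) hU
    (fun z hz y _ => ne_side hz.1.2.ne y)
  have b4 := cau_holo (γ := fun y => q - y * I) (M := M) hR.le (hconj.comp_continuousOn c2)
    (by simpa using hr) (by fun_prop) hU (fun z hz y _ => ne_side' hz.1.2.ne y)
  have b5 := cau_holo (γ := fun y => p + y * I) hR.le c3 hl (by fun_prop) hU
    (fun z hz y _ => ne_side hz.1.1.ne' y)
  have b6 := cau_holo (γ := fun y => p - y * I) (M := M) hR.le (hconj.comp_continuousOn c3)
    (by simpa using hl) (by fun_prop) hU (fun z hz y _ => ne_side' hz.1.1.ne' y)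
  exact ((b1.neg.add b2).add ((b3.add b4).const_mul I)).sub ((b5.add b6).const_mul I)

theorem Gam_tendsto {p q R M : ℝ} (hpq : p ≤ q) (hR : 0 < R) {W : ℝ → ℂ → ℂ} {W0 : ℂ → ℂ}
    (hW : ∀ᶠ η in 𝓝[>] (0:ℝ), ContinuousOn (W η) {z : ℂ | 0 < z.im})
    (htop : ∀ᶠ η in 𝓝[>] (0:ℝ), ∀ x ∈ Ioc p q, ‖W η (x + R * I)‖ ≤ M)
    (hr : ∀ᶠ η in 𝓝[>] (0:ℝ), ∀ y ∈ Ioc 0 R, ‖W η (q + y * I)‖ ≤ M)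
    (hl : ∀ᶠ η in 𝓝[>] (0:ℝ), ∀ y ∈ Ioc 0 R, ‖W η (p + y * I)‖ ≤ M)
    (hlim : ∀ ζ : ℂ, 0 < ζ.im → Tendsto (fun η => W η ζ) (𝓝[>] 0) (𝓝 (W0 ζ)))
    {z : ℂ} (hz : z ∈ (Ioo p q ×ℂ Ioo (-R) R)) :
    Tendsto (fun η => Gam p q R (W η) z) (𝓝[>] 0) (𝓝 (Gam p q R W0 z)) := by
  have hconj : Continuous (fun z : ℂ => -(starRingEnd ℂ) z) := by fun_prop
  have c1 : ∀ᶠ η in 𝓝[>] (0:ℝ), ContinuousOn (fun x : ℝ => W η (x + R * I)) (Ioc p q) :=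
    hW.mono fun η h => h.comp (by fun_prop) (fun x _ => by simpa using hR)
  have c2 : ∀ᶠ η in 𝓝[>] (0:ℝ), ContinuousOn (fun y : ℝ => W η (q + y * I)) (Ioc 0 R) :=
    hW.mono fun η h => h.comp (by fun_prop) (fun x hx => by simpa using hx.1)
  have c3 : ∀ᶠ η in 𝓝[>] (0:ℝ), ContinuousOn (fun y : ℝ => W η (p + y * I)) (Ioc 0 R) :=
    hW.mono fun η h => h.comp (by fun_prop) (fun x hx => by simpa using hx.1)
  have l1 : ∀ x ∈ Ioc p q, Tendsto (fun η => W η (x + R * I)) (𝓝[>] 0) (𝓝 (W0 (x + R * I))) :=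
    fun x _ => hlim _ (by simpa using hR)
  have l2 : ∀ y ∈ Ioc 0 R, Tendsto (fun η => W η (q + y * I)) (𝓝[>] 0) (𝓝 (W0 (q + y * I))) :=
    fun x hx => hlim _ (by simpa using hx.1)
  have l3 : ∀ y ∈ Ioc 0 R, Tendsto (fun η => W η (p + y * I)) (𝓝[>] 0) (𝓝 (W0 (p + y * I))) :=
    fun x hx => hlim _ (by simpa using hx.1)
  have b1 := cau_tendsto (γ := fun x => x + R * I) hpq c1 htop l1 (by fun_prop)
    (fun y _ => ne_top hz.2.2 y)
  have b2 := cau_tendsto (γ := fun x => x - R * I) (M := M) hpq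
    (c1.mono fun _ h => hconj.comp_continuousOn h)
    (by simpa using htop) (fun x hx => (hconj.tendsto _).comp (l1 x hx))
    (by fun_prop) (fun y _ => ne_bot hz.2.1 y)
  have b3 := cau_tendsto (γ := fun y => q + y * I) hR.le c2 hr l2 (by fun_prop)
    (fun y _ => ne_side hz.1.2.ne y)
  have b4 := cau_tendsto (γ := fun y => q - y * I) (M := M) hR.le
    (c2.mono fun _ h => hconj.comp_continuousOn h)
    (by simpa using hr) (fun x hx => (hconj.tendsto _).comp (l2 x hx))
    (by fun_prop) (fun y _ => ne_side' hz.1.2.ne y)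
  have b5 := cau_tendsto (γ := fun y => p + y * I) hR.le c3 hl l3 (by fun_prop)
    (fun y _ => ne_side hz.1.1.ne' y)
  have b6 := cau_tendsto (γ := fun y => p - y * I) (M := M) hR.le
    (c3.mono fun _ h => hconj.comp_continuousOn h)
    (by simpa using hl) (fun x hx => (hconj.tendsto _).comp (l3 x hx))
    (by fun_prop) (fun y _ => ne_side' hz.1.1.ne' y)
  exact ((b1.neg.add b2).add ((b3.add b4).const_mul I)).sub ((b5.add b6).const_mul I)

/-- The winding integral. -/
noncomputable def om (p q R : ℝ) (z : ℂ) : ℂ :=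
  - cau (fun _ => 1) (fun x => x + R * I) p q z
  + cau (fun _ => 1) (fun x => x - R * I) p q z
  + I * (cau (fun _ => 1) (fun y => q + y * I) 0 R z
    + cau (fun _ => 1) (fun y => q - y * I) 0 R z)
  - I * (cau (fun _ => 1) (fun y => p + y * I) 0 R z
    + cau (fun _ => 1) (fun y => p - y * I) 0 R z)

theorem om_holo {p q R : ℝ} (hpq : p ≤ q) (hR : 0 < R) :
    DifferentiableOn ℂ (om p q R) (Ioo p q ×ℂ Ioo (-R) R) := by
  have hU : IsOpen (Ioo p q ×ℂ Ioo (-R) R) := isOpen_Ioo.reProdIm isOpen_Ioo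
  have h1 : ∀ y : ℝ, ‖(fun _ : ℝ => (1:ℂ)) y‖ ≤ 1 := by simp
  have b1 := cau_holo (γ := fun x => x + R * I) (g := fun _ => 1) hpq continuousOn_const
    (fun y _ => h1 y) (by fun_prop) hU (fun z hz y _ => ne_top hz.2.2 y)
  have b2 := cau_holo (γ := fun x => x - R * I) (g := fun _ => 1) hpq continuousOn_const
    (fun y _ => h1 y) (by fun_prop) hU (fun z hz y _ => ne_bot hz.2.1 y)
  have b3 := cau_holo (γ := fun y => q + y * I) (g := fun _ => 1) hR.le continuousOn_const
    (fun y _ => h1 y) (by fun_prop) hU (fun z hz y _ => ne_side hz.1.2.ne y)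
  have b4 := cau_holo (γ := fun y => q - y * I) (g := fun _ => 1) hR.le continuousOn_const
    (fun y _ => h1 y) (by fun_prop) hU (fun z hz y _ => ne_side' hz.1.2.ne y)
  have b5 := cau_holo (γ := fun y => p + y * I) (g := fun _ => 1) hR.le continuousOn_const
    (fun y _ => h1 y) (by fun_prop) hU (fun z hz y _ => ne_side hz.1.1.ne' y)
  have b6 := cau_holo (γ := fun y => p - y * I) (g := fun _ => 1) hR.le continuousOn_const
    (fun y _ => h1 y) (by fun_prop) hU (fun z hz y _ => ne_side' hz.1.1.ne' y)
  exact ((b1.neg.add b2).add ((b3.add b4).const_mul I)).sub ((b5.add b6).const_mul I)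

theorem cau_re_im {γ : ℝ → ℂ} {a b : ℝ} (hab : a ≤ b) (hγ : Continuous γ) {z : ℂ}
    (hz : ∀ y ∈ Icc a b, γ y ≠ z) :
    (cau (fun _ => 1) γ a b z).re = ∫ y in a..b, (γ y - z).re / normSq (γ y - z) ∧
    (cau (fun _ => 1) γ a b z).im = ∫ y in a..b, -(γ y - z).im / normSq (γ y - z) := by
  have hne : ∀ y ∈ Icc a b, γ y - z ≠ 0 := fun y hy => sub_ne_zero.2 (hz y hy)
  have hsub : ContinuousOn (fun y => γ y - z) (Icc a b) := by fun_prop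
  have hIntg : IntervalIntegrable (fun y => 1 / (γ y - z)) volume a b := by
    refine ContinuousOn.intervalIntegrable ?_
    rw [uIcc_of_le hab]
    exact continuousOn_const.div hsub hne
  unfold cau
  constructor
  · have := (Complex.reCLM.intervalIntegral_comp_comm hIntg)
    simp only [Complex.reCLM_apply] at this
    rw [← this]
    congr 1; funext y; simp [Complex.inv_re]
  · have := (Complex.imCLM.intervalIntegral_comp_comm hIntg)
    simp only [Complex.imCLM_apply] at this
    rw [← this]
    congr 1; funext y; simp [Complex.inv_im]

theorem ii_nonpos {f : ℝ → ℝ} {a b : ℝ} (hab : a ≤ b) (hf : ∀ y, f y ≤ 0) :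
    ∫ y in a..b, f y ≤ 0 := by
  have := intervalIntegral.integral_nonneg_of_forall (μ := volume) (f := fun y => - f y) hab
    (fun y => by linarith [hf y])
  rw [intervalIntegral.integral_neg] at this
  linarith

theorem om_ne {p q R : ℝ} (hpq : p < q) (hR : 0 < R) {z : ℂ}
    (hz : z ∈ (Ioo p q ×ℂ Ioo (-R) R)) : om p q R z ≠ 0 := by
  obtain ⟨⟨h1, h2⟩, h3, h4⟩ := hz
  have a1 := cau_re_im (γ := fun x => x + R * I) hpq.le (by fun_prop) (fun y _ => ne_top h4 y)
  have a2 := cau_re_im (γ := fun x => x - R * I) hpq.le (by fun_prop) (fun y _ => ne_bot h3 y)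
  have a3 := cau_re_im (γ := fun y => q + y * I) hR.le (by fun_prop) (fun y _ => ne_side h2.ne y)
  have a4 := cau_re_im (γ := fun y => q - y * I) hR.le (by fun_prop) (fun y _ => ne_side' h2.ne y)
  have a5 := cau_re_im (γ := fun y => p + y * I) hR.le (by fun_prop) (fun y _ => ne_side h1.ne' y)
  have a6 := cau_re_im (γ := fun y => p - y * I) hR.le (by fun_prop) (fun y _ => ne_side' h1.ne' y)
  intro h0
  have him : (om p q R z).im = 0 := by rw [h0]; rfl
  simp only [om, sub_im, add_im, neg_im, mul_im, I_re, I_im, zero_mul, one_mul, add_re, zero_add]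
    at him
  rw [a1.2, a2.2, a3.1, a4.1, a5.1, a6.1] at him
  have t1 : (∫ y in p..q, -((y + R * I : ℂ) - z).im / normSq ((y + R * I : ℂ) - z)) ≤ 0 := by
    refine ii_nonpos hpq.le ?_ 
    intro y
    refine div_nonpos_of_nonpos_of_nonneg ?_ (normSq_nonneg _)
    simp; linarith
  have t2 : 0 < (∫ y in p..q, -((y - R * I : ℂ) - z).im / normSq ((y - R * I : ℂ) - z)) := by
    refine intervalIntegral.intervalIntegral_pos_of_pos_on ?_ ?_ hpq
    · refine ContinuousOn.intervalIntegrable ?_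
      refine ContinuousOn.div (by fun_prop) (by fun_prop) ?_
      intro y _
      exact (normSq_pos.2 (sub_ne_zero.2 (ne_bot h3 y))).ne'
    · intro y _
      refine div_pos ?_ (normSq_pos.2 (sub_ne_zero.2 (ne_bot h3 y)))
      simp; linarith
  have t3 : 0 ≤ ∫ y in (0:ℝ)..R, ((q + y * I : ℂ) - z).re / normSq ((q + y * I : ℂ) - z) := by
    refine intervalIntegral.integral_nonneg_of_forall hR.le ?_
    intro y
    refine div_nonneg ?_ (normSq_nonneg _)
    simp; linarith
  have t4 : 0 ≤ ∫ y in (0:ℝ)..R, ((q - y * I : ℂ) - z).re / normSq ((q - y * I : ℂ) - z) := by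
    refine intervalIntegral.integral_nonneg_of_forall hR.le ?_
    intro y
    refine div_nonneg ?_ (normSq_nonneg _)
    simp; linarith
  have t5 : ∫ y in (0:ℝ)..R, ((p + y * I : ℂ) - z).re / normSq ((p + y * I : ℂ) - z) ≤ 0 := by
    refine ii_nonpos hR.le ?_
    intro y
    refine div_nonpos_of_nonpos_of_nonneg ?_ (normSq_nonneg _)
    simp; linarith
  have t6 : ∫ y in (0:ℝ)..R, ((p - y * I : ℂ) - z).re / normSq ((p - y * I : ℂ) - z) ≤ 0 := by
    refine ii_nonpos hR.le ?_
    intro y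
    refine div_nonpos_of_nonpos_of_nonneg ?_ (normSq_nonneg _)
    simp; linarith
  linarith

end FL

namespace FL
open Complex Set Filter Topology

theorem im_conj_pos {z : ℂ} : ((starRingEnd ℂ) z).im = - z.im := by simp

theorem refl_diff {A : ℂ → ℂ} {η : ℝ} (hA : DifferentiableOn ℂ A {z : ℂ | -η < z.im}) :
    DifferentiableOn ℂ (fun z => -(starRingEnd ℂ) (A ((starRingEnd ℂ) z))) {z : ℂ | z.im < η} := by
  intro z hz
  have hz' : -η < ((starRingEnd ℂ) z).im := by
    rw [im_conj_pos]; have : z.im < η := hz; linarith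
  have ho : IsOpen {z : ℂ | -η < z.im} := isOpen_lt continuous_const continuous_im
  have h1 := (hA _ hz').differentiableAt (ho.mem_nhds hz')
  have h2 := (differentiableAt_conj_conj_iff (f := A) (x := z)).2 (by simpa using h1)
  exact h2.neg.differentiableWithinAt

/-- Cauchy identity with jump. -/
theorem cauchy_jump {p q R η : ℝ} (hpq : p < q) (hR : 0 < R) (hη : 0 < η) {A : ℂ → ℂ}
    (hA : DifferentiableOn ℂ A {z : ℂ | -η < z.im}) {z : ℂ} (hz : z ∈ (Ioo p q ×ℂ Ioo 0 R)) :
    Gam p q R A z - A z * om p q R z + ∫ x in p..q, (2 * (A x).re : ℂ) / (x - z) = 0 := by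
  obtain ⟨⟨h1, h2⟩, h3, h4⟩ := hz
  have h3' : -R < z.im := by linarith
  have ho : IsOpen {z : ℂ | -η < z.im} := isOpen_lt continuous_const continuous_im
  set B : ℂ → ℂ := fun z => -(starRingEnd ℂ) (A ((starRingEnd ℂ) z)) with hB
  have hBd := refl_diff hA
  have hconj : Continuous (fun z : ℂ => -(starRingEnd ℂ) z) := by fun_prop
  have hAc := hA.continuousOn
  have hBc := hBd.continuousOn
  have hd1 : DifferentiableOn ℂ (dslope A z) {z : ℂ | -η < z.im} :=
    (Complex.differentiableOn_dslope (ho.mem_nhds (show -η < z.im by linarith))).2 hA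
  have hd2 : DifferentiableOn ℂ (fun ζ => (B ζ - A z) / (ζ - z)) ({ζ : ℂ | ζ.im < η} ∩ {z}ᶜ) := by
    refine DifferentiableOn.div ((hBd.mono inter_subset_left).sub_const _) (by fun_prop) ?_
    intro ζ hζ
    exact sub_ne_zero.2 hζ.2
  have i1 := Complex.integral_boundary_rect_eq_zero_of_differentiableOn (dslope A z)
    (p : ℂ) (q + R * I) (hd1.mono (by
      intro w hw
      have := hw.2
      simp [uIcc_of_le hR.le] at this
      change -η < w.im
      linarith [this.1]))
  have i2 := Complex.integral_boundary_rect_eq_zero_of_differentiableOn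
    (fun ζ => (B ζ - A z) / (ζ - z)) (p - R * I : ℂ) (q : ℂ) (hd2.mono (by
      intro w hw
      have := hw.2
      simp [uIcc_of_le (show -R ≤ 0 by linarith)] at this
      refine ⟨by change w.im < η; linarith [this.2], ?_⟩
      rintro rfl
      linarith [this.2]))
  have hds : ∀ ζ, ζ ≠ z → dslope A z ζ = (A ζ - A z) / (ζ - z) := by
    intro ζ h
    rw [dslope_of_ne _ h, slope_def_field]
  have nr : ∀ x : ℝ, (x : ℂ) ≠ z := by rintro x rfl; simp at h3
  simp only [ofReal_re, ofReal_im, add_re, mul_re, I_re, mul_zero, I_im, mul_one, sub_self, add_zero,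
    add_im, mul_im, zero_add, smul_eq_mul, ofReal_zero, zero_mul, sub_re, sub_im, zero_sub, sub_zero,
    ofReal_neg, neg_mul, ← sub_eq_add_neg] at i1 i2
  simp only [hds _ (nr _), hds _ (ne_top h4 _), hds _ (ne_side h2.ne _), hds _ (ne_side h1.ne' _)]
    at i1
  have neg1 : ∀ f : ℝ → ℂ, ∫ y in (-R)..0, f y = ∫ y in (0:ℝ)..R, f (-y) := by
    intro f
    rw [intervalIntegral.integral_comp_neg]; simp
  rw [neg1, neg1] at i2
  simp only [ofReal_neg, neg_mul, ← sub_eq_add_neg] at i2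
  have cA : ∀ γ : ℝ → ℂ, Continuous γ → ∀ a b : ℝ, (∀ y ∈ Icc a b, 0 ≤ (γ y).im) →
      ContinuousOn (fun y => A (γ y)) (Icc a b) := by
    intro γ hγ a b h
    refine hAc.comp hγ.continuousOn ?_
    intro y hy
    change -η < _
    linarith [h y hy]
  have cB : ∀ γ : ℝ → ℂ, Continuous γ → ∀ a b : ℝ, (∀ y ∈ Icc a b, (γ y).im ≤ 0) →
      ContinuousOn (fun y => B (γ y)) (Icc a b) := by
    intro γ hγ a b h
    refine hBc.comp hγ.continuousOn ?_
    intro y hy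
    change _ < η
    linarith [h y hy]
  have e1 := cau_sub_const (g := fun x => A (x + R * I)) (γ := fun x => x + R * I) (z := z) hpq.le
    (cA _ (by fun_prop) _ _ (by intro y hy; simp; linarith)) (by fun_prop)
    (fun y _ => ne_top h4 y) (A z)
  have e2 := cau_sub_const (g := fun x => B (x - R * I)) (γ := fun x => x - R * I) (z := z) hpq.le
    (cB _ (by fun_prop) _ _ (by intro y hy; simp; linarith)) (by fun_prop)
    (fun y _ => ne_bot h3' y) (A z)
  have e3 := cau_sub_const (g := fun y => A (q + y * I)) (γ := fun y => q + y * I) (z := z) hR.le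
    (cA _ (by fun_prop) _ _ (by intro y hy; simp; linarith [hy.1])) (by fun_prop)
    (fun y _ => ne_side h2.ne y) (A z)
  have e4 := cau_sub_const (g := fun y => B (q - y * I)) (γ := fun y => q - y * I) (z := z) hR.le
    (cB _ (by fun_prop) _ _ (by intro y hy; simp; linarith [hy.1])) (by fun_prop)
    (fun y _ => ne_side' h2.ne y) (A z)
  have e5 := cau_sub_const (g := fun y => A (p + y * I)) (γ := fun y => p + y * I) (z := z) hR.le
    (cA _ (by fun_prop) _ _ (by intro y hy; simp; linarith [hy.1])) (by fun_prop)
    (fun y _ => ne_side h1.ne' y) (A z)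
  have e6 := cau_sub_const (g := fun y => B (p - y * I)) (γ := fun y => p - y * I) (z := z) hR.le
    (cB _ (by fun_prop) _ _ (by intro y hy; simp; linarith [hy.1])) (by fun_prop)
    (fun y _ => ne_side' h1.ne' y) (A z)
  have e7 := cau_sub_const (g := fun x => A x) (γ := fun x => x) (z := z) hpq.le
    (cA _ (by fun_prop) _ _ (by intro y hy; simp)) (by fun_prop)
    (fun y _ => nr y) (A z)
  have e8 := cau_sub_const (g := fun x => B x) (γ := fun x => x) (z := z) hpq.le
    (cB _ (by fun_prop) _ _ (by intro y hy; simp)) (by fun_prop)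
    (fun y _ => nr y) (A z)
  have e9 : ∫ x in p..q, (2 * (A x).re : ℂ) / (x - z)
      = cau (fun x => A x) (fun x => x) p q z - cau (fun x => B x) (fun x => x) p q z := by
    have hne : ∀ y ∈ Icc p q, (y : ℂ) - z ≠ 0 := fun y hy => sub_ne_zero.2 (nr y)
    rw [cau, cau, ← intervalIntegral.integral_sub]
    · congr 1; funext x
      rw [← sub_div]
      congr 1
      simp only [hB, conj_ofReal, sub_neg_eq_add, Complex.add_conj]
      push_cast; ring
    · refine ContinuousOn.intervalIntegrable ?_
      rw [uIcc_of_le hpq.le]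
      exact (cA (fun x => x) (by fun_prop) _ _ (by intro y hy; simp)).div (by fun_prop) hne
    · refine ContinuousOn.intervalIntegrable ?_
      rw [uIcc_of_le hpq.le]
      exact (cB (fun x => x) (by fun_prop) _ _ (by intro y hy; simp)).div (by fun_prop) hne
  rw [e7, e1, e3, e5] at i1
  rw [e8, e2, e4, e6] at i2
  rw [e9]
  have f1 : (fun x : ℝ => B (x - R * I)) = fun x : ℝ => -(starRingEnd ℂ) (A (x + R * I)) := by
    funext x; simp [hB]
  have f2 : ∀ q : ℝ, (fun x : ℝ => B (q - x * I)) = fun x : ℝ => -(starRingEnd ℂ) (A (q + x * I)) := by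
    intro q; funext x; simp [hB]
  rw [f1, f2, f2] at i2
  unfold Gam om
  linear_combination i1 + i2

end FL

namespace FL
open Complex Set Filter Topology

theorem ext_lemma {s : ℝ} (hs0 : 0 < s) (hs1 : s < 1) {H : ℂ → ℂ}
    (hH : DifferentiableOn ℂ H {z : ℂ | 0 < z.im}) {c R C N : ℝ} (hR : 0 < R)
    (hbd : ∀ x ∈ Icc (c - R) (c + R), ∀ t ∈ Ioc 0 (2*R), ‖H (x + t * I)‖ ≤ C * t ^ (-(2*s)))
    (hN : ∀ x ∈ Icc (c - R) (c + R), ∀ t ∈ Ioc 0 (2*R), |(H (x + t * I)).re| ≤ N)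
    (hlim : ∀ x ∈ Icc (c - R) (c + R),
      Tendsto (fun t : ℝ => (H (x + t * I)).re) (𝓝[>] 0) (𝓝 0)) :
    ∃ Ht : ℂ → ℂ, DifferentiableOn ℂ Ht (Metric.ball (c : ℂ) R) ∧
      (∀ z ∈ Metric.ball (c : ℂ) R, 0 < z.im → Ht z = H z) ∧
      (∀ z ∈ Metric.ball (c : ℂ) R, z.im < 0 → Ht z = -(starRingEnd ℂ) (H ((starRingEnd ℂ) z))) ∧
      (∀ x : ℝ, (x : ℂ) ∈ Metric.ball (c : ℂ) R → (Ht x).re = 0) := by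
  set p := c - R with hp
  set q := c + R with hq
  have hpq : p < q := by rw [hp, hq]; linarith
  have ho : IsOpen {z : ℂ | 0 < z.im} := isOpen_lt continuous_const continuous_im
  have hsub : Metric.ball (c : ℂ) R ⊆ Ioo p q ×ℂ Ioo (-R) R := by
    intro z hz
    rw [Metric.mem_ball, dist_eq_norm] at hz
    have h1 := (abs_re_le_norm (z - c)).trans_lt hz
    have h2 := (abs_im_le_norm (z - c)).trans_lt hz
    rw [abs_lt] at h1 h2
    simp at h1 h2
    exact ⟨⟨by linarith [h1.1], by linarith [h1.2]⟩, by simpa using h2⟩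
  have hC : 0 ≤ C := by
    have := (norm_nonneg _).trans (hbd p ⟨le_rfl, hpq.le⟩ R ⟨hR, by linarith⟩)
    exact nonneg_of_mul_nonneg_left this (by positivity)
  set m : ℂ → ℂ := fun z => (z - p)^2 * (z - q)^2 with hm
  have hmd : Differentiable ℂ m := by fun_prop
  have hm0 : ∀ z ∈ Ioo p q ×ℂ Ioo (-R) R, m z ≠ 0 := by
    intro z hz
    have h1 : z - p ≠ 0 := by
      intro h; have := congrArg re h; simp at this; linarith [hz.1.1]
    have h2 : z - q ≠ 0 := by
      intro h; have := congrArg re h; simp at this; linarith [hz.1.2]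
    exact mul_ne_zero (pow_ne_zero _ h1) (pow_ne_zero _ h2)
  have hqn : ∀ x ∈ Icc p q, ∀ y ∈ Icc 0 R, ‖(x + y * I : ℂ) - p‖ ≤ 3*R ∧
      ‖(x + y * I : ℂ) - q‖ ≤ 3*R := by
    intro x hx y hy
    have h1 := norm_le_add x y p
    have h2 := norm_le_add x y q
    rw [abs_of_nonneg (by linarith [hx.1]), abs_of_nonneg hy.1] at h1
    rw [abs_of_nonpos (by linarith [hx.2]), abs_of_nonneg hy.1] at h2
    constructor
    · linarith [hx.2, hy.2]
    · linarith [hx.1, hy.2]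
  have hmb : ∀ x ∈ Icc p q, ∀ y ∈ Icc 0 R, ‖m (x + y * I)‖ ≤ (3*R)^4 := by
    intro x hx y hy
    obtain ⟨h1, h2⟩ := hqn x hx y hy
    rw [hm]; simp only [norm_mul, norm_pow]
    calc _ ≤ (3*R)^2 * (3*R)^2 := by gcongr
      _ = _ := by ring
  have hms : ∀ x, (x = p ∨ x = q) → ∀ y ∈ Ioc 0 R, ‖m (x + y * I)‖ ≤ (3*R)^2 * y^2 := by
    intro x hx y hy
    rw [hm]; simp only [norm_mul, norm_pow]
    rcases hx with rfl | rfl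
    · obtain ⟨h1, h2⟩ := hqn p ⟨le_rfl, hpq.le⟩ y ⟨hy.1.le, hy.2⟩
      have : ‖(p + y * I : ℂ) - p‖ = y := by simp [abs_of_pos hy.1]
      rw [this]
      calc _ ≤ y^2 * (3*R)^2 := by gcongr
        _ = _ := by ring
    · obtain ⟨h1, h2⟩ := hqn q ⟨hpq.le, le_rfl⟩ y ⟨hy.1.le, hy.2⟩
      have : ‖(q + y * I : ℂ) - q‖ = y := by simp [abs_of_pos hy.1]
      rw [this]
      gcongr
  set W : ℝ → ℂ → ℂ := fun η ζ => m ζ * H (ζ + η * I) with hW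
  have hneg : -(2*s) ≤ 0 := by linarith
  have hbd' : ∀ x ∈ Icc p q, ∀ y ∈ Ioc 0 R, ∀ η ∈ Icc 0 R,
      ‖H (x + y * I + η * I)‖ ≤ C * y ^ (-(2*s)) := by
    intro x hx y hy η hη
    have := hbd x hx (y + η) ⟨by linarith [hy.1, hη.1], by linarith [hy.2, hη.2]⟩
    have e : (x + y * I + η * I : ℂ) = x + (y + η : ℝ) * I := by push_cast; ring
    rw [e]
    refine this.trans ?_
    exact mul_le_mul_of_nonneg_left (Real.rpow_le_rpow_of_nonpos hy.1 (by linarith [hη.1]) hneg) hC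
  set M1 := (3*R)^4 * (C * R ^ (-(2*s))) with hM1
  set M2 := (3*R)^2 * C * R ^ (2 - 2*s) with hM2
  have hM1' : 0 ≤ M1 := by positivity
  have hM2' : 0 ≤ M2 := by positivity
  have htopb : ∀ η ∈ Icc 0 R, ∀ x ∈ Ioc p q, ‖W η (x + R * I)‖ ≤ M1 + M2 := by
    intro η hη x hx
    have hx' : x ∈ Icc p q := ⟨hx.1.le, hx.2⟩
    rw [hW]; simp only [norm_mul]
    have := mul_le_mul (hmb x hx' R ⟨hR.le, le_rfl⟩) (hbd' x hx' R ⟨hR, le_rfl⟩ η hη)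
      (norm_nonneg _) (by positivity)
    linarith
  have hsideb : ∀ η ∈ Icc 0 R, ∀ x, (x = p ∨ x = q) → ∀ y ∈ Ioc 0 R,
      ‖W η (x + y * I)‖ ≤ M1 + M2 := by
    intro η hη x hx y hy
    have hx' : x ∈ Icc p q := by
      rcases hx with rfl | rfl
      exacts [⟨le_rfl, hpq.le⟩, ⟨hpq.le, le_rfl⟩]
    rw [hW]; simp only [norm_mul]
    have h1 := mul_le_mul (hms x hx y hy) (hbd' x hx' y hy η hη)
      (norm_nonneg _) (by positivity)
    have h2 : y^2 * y ^ (-(2*s)) = y ^ (2 - 2*s) := by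
      rw [← Real.rpow_natCast y 2, ← Real.rpow_add hy.1]
      congr 1
    have h3 : y ^ (2 - 2*s) ≤ R ^ (2 - 2*s) :=
      Real.rpow_le_rpow hy.1.le hy.2 (by linarith)
    have h4 : (3*R)^2 * y^2 * (C * y ^ (-(2*s))) = (3*R)^2 * C * y ^ (2 - 2*s) := by
      rw [← h2]; ring
    have h5 : (3*R)^2 * C * y ^ (2 - 2*s) ≤ M2 := mul_le_mul_of_nonneg_left h3 (by positivity)
    linarith
  have hWd : ∀ η : ℝ, DifferentiableOn ℂ (W η) {z : ℂ | -η < z.im} := by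
    intro η
    refine hmd.differentiableOn.mul (hH.comp (by fun_prop) ?_)
    intro z hz
    have hz' : -η < z.im := hz
    change 0 < (z + η * I).im
    simp; linarith
  have hWc : ∀ η : ℝ, 0 ≤ η → ContinuousOn (W η) {z : ℂ | 0 < z.im} := by
    intro η hη
    refine (hWd η).continuousOn.mono ?_
    intro z hz
    have hz' : 0 < z.im := hz
    change -η < z.im
    linarith
  have hηev : ∀ᶠ η in 𝓝[>] (0:ℝ), η ∈ Ioc 0 R := Ioc_mem_nhdsGT hR
  have hηev' : ∀ᶠ η in 𝓝[>] (0:ℝ), η ∈ Icc 0 R := hηev.mono fun _ h => ⟨h.1.le, h.2⟩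
  have h0R : (0:ℝ) ∈ Icc 0 R := ⟨le_rfl, hR.le⟩
  have hlimW : ∀ ζ : ℂ, 0 < ζ.im → Tendsto (fun η => W η ζ) (𝓝[>] 0) (𝓝 (W 0 ζ)) := by
    intro ζ hζ
    have h1 : ContinuousAt H (ζ + (0:ℝ) * I) := by
      refine hH.continuousOn.continuousAt (ho.mem_nhds ?_)
      simpa using hζ
    have h2 : Tendsto (fun η : ℝ => ζ + η * I) (𝓝[>] 0) (𝓝 (ζ + (0:ℝ) * I)) :=
      (Continuous.tendsto (by fun_prop) 0).mono_left nhdsWithin_le_nhds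
    exact (h1.tendsto.comp h2).const_mul _
  have key : ∀ z ∈ Ioo p q ×ℂ Ioo 0 R, Gam p q R (W 0) z = W 0 z * om p q R z := by
    intro z hz
    have hz' : z ∈ Ioo p q ×ℂ Ioo (-R) R := ⟨hz.1, by linarith [hz.2.1], hz.2.2⟩
    have t1 := Gam_tendsto (z := z) hpq.le hR (hηev'.mono fun η h => hWc η h.1)
      (hηev'.mono fun η h => htopb η h) (hηev'.mono fun η h => hsideb η h q (Or.inr rfl))
      (hηev'.mono fun η h => hsideb η h p (Or.inl rfl)) hlimW hz'
    have t2 := (hlimW z hz.2.1).mul_const (om p q R z)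
    have nr : ∀ x : ℝ, (x : ℂ) ≠ z := by
      rintro x rfl
      have := hz.2.1
      simp at this
    have hmreal : ∀ x : ℝ, (m x).im = 0 := by
      intro x
      rw [hm]
      have : ((x - p : ℂ)^2 * (x - q)^2) = (((x - p)^2 * (x - q)^2 : ℝ) : ℂ) := by push_cast; ring
      simp only [this, ofReal_im]
    have t3 : Tendsto (fun η => cau (fun x => (2 * (W η x).re : ℂ)) (fun x => x) p q z)
        (𝓝[>] 0) (𝓝 (cau (fun x => 0) (fun x => x) p q z)) := by
      refine cau_tendsto (M := 2 * ((3*R)^4 * N)) hpq.le ?_ ?_ ?_ (by fun_prop) (fun y _ => nr y)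
      · filter_upwards [hηev] with η h
        have : ContinuousOn (fun x : ℝ => W η x) (Ioc p q) := by
          refine (hWd η).continuousOn.comp (by fun_prop) ?_
          intro x _
          change -η < (x:ℂ).im
          simpa using h.1
        have h2 : Continuous (fun w : ℂ => (2 * w.re : ℂ)) := by fun_prop
        exact h2.comp_continuousOn this
      · filter_upwards [hηev] with η h x hx
        have hx' : x ∈ Icc p q := ⟨hx.1.le, hx.2⟩
        have h1 := hmb x hx' 0 ⟨le_rfl, hR.le⟩
        have h2 := hN x hx' η ⟨h.1, by linarith [h.2]⟩
        simp only [ofReal_zero, zero_mul, add_zero] at h1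
        have h3 : |(W η x).re| ≤ (3*R)^4 * N := by
          rw [hW]; simp only [mul_re, hmreal, zero_mul, sub_zero, abs_mul]
          exact mul_le_mul ((abs_re_le_norm _).trans h1) h2 (abs_nonneg _) (by positivity)
        rw [norm_mul, norm_real, Real.norm_eq_abs]
        simpa using h3
      · intro x hx
        have hx' : x ∈ Icc p q := ⟨hx.1.le, hx.2⟩
        have h1 := (hlim x hx').const_mul (2 * (m x).re)
        rw [mul_zero] at h1
        have h2 := (continuous_ofReal.tendsto 0).comp h1
        rw [ofReal_zero] at h2
        refine h2.congr ?_
        intro η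
        simp only [hW, Function.comp, mul_re, hmreal]
        push_cast; ring
    have t4 : cau (fun x => 0) (fun x => x) p q z = 0 := by simp [cau]
    rw [t4] at t3
    have t5 := (t1.sub t2).add t3
    have t6 : Tendsto (fun η => Gam p q R (W η) z - W η z * om p q R z +
        cau (fun x => (2 * (W η x).re : ℂ)) (fun x => x) p q z) (𝓝[>] 0) (𝓝 0) := by
      refine tendsto_const_nhds.congr' ?_
      filter_upwards [hηev] with η h
      exact (cauchy_jump hpq hR h.1 (hWd η) hz).symm
    have := tendsto_nhds_unique t5 t6
    linear_combination this
  have hGd := Gam_holo (W := W 0) hpq.le hR (hWc 0 le_rfl) (htopb 0 h0R)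
    (hsideb 0 h0R q (Or.inr rfl)) (hsideb 0 h0R p (Or.inl rfl))
  set Ht : ℂ → ℂ := fun z => Gam p q R (W 0) z / (om p q R z * m z) with hHt
  have hHtd : DifferentiableOn ℂ Ht (Metric.ball (c : ℂ) R) := by
    refine DifferentiableOn.mono ?_ hsub
    exact hGd.div ((om_holo hpq.le hR).mul hmd.differentiableOn)
      fun z hz => mul_ne_zero (om_ne hpq hR hz) (hm0 z hz)
  have hup : ∀ z ∈ Metric.ball (c : ℂ) R, 0 < z.im → Ht z = H z := by
    intro z hz hi
    have h1 := hsub hz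
    have h2 := om_ne hpq hR h1
    have h3 := hm0 z h1
    rw [hHt]
    simp only [key z ⟨h1.1, hi, h1.2.2⟩]
    simp only [hW, ofReal_zero, zero_mul, add_zero]
    field_simp
  have hreal : ∀ x : ℝ, (x : ℂ) ∈ Metric.ball (c : ℂ) R → (Ht x).re = 0 := by
    intro x hx
    have hxm : x ∈ Icc p q := by
      have := (hsub hx).1
      simp at this
      exact ⟨this.1.le, this.2.le⟩
    have hc : ContinuousAt Ht (x : ℂ) :=
      hHtd.continuousOn.continuousAt (Metric.isOpen_ball.mem_nhds hx)
    have h2 : Tendsto (fun t : ℝ => (x + t * I : ℂ)) (𝓝[>] 0) (𝓝 (x : ℂ)) := by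
      have : Tendsto (fun t : ℝ => (x + t * I : ℂ)) (𝓝[>] 0) (𝓝 ((x : ℂ) + (0:ℝ) * I)) :=
        (Continuous.tendsto (by fun_prop) 0).mono_left nhdsWithin_le_nhds
      simpa using this
    have h3 : Tendsto (fun t : ℝ => (Ht (x + t * I)).re) (𝓝[>] 0) (𝓝 (Ht x).re) :=
      (continuous_re.tendsto _).comp (hc.tendsto.comp h2)
    refine tendsto_nhds_unique h3 ((hlim x hxm).congr' ?_)
    filter_upwards [h2 (Metric.isOpen_ball.mem_nhds hx), self_mem_nhdsWithin] with t ht ht0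
    rw [hup _ ht (by simpa using ht0)]
  refine ⟨Ht, hHtd, hup, ?_, hreal⟩
  have hconjball : ∀ z ∈ Metric.ball (c : ℂ) R, (starRingEnd ℂ) z ∈ Metric.ball (c : ℂ) R := by
    intro z hz
    rw [Metric.mem_ball, dist_eq_norm] at *
    have : (starRingEnd ℂ) z - c = (starRingEnd ℂ) (z - c) := by simp
    rw [this, norm_conj]; exact hz
  have hrd : DifferentiableOn ℂ (fun z => -(starRingEnd ℂ) (Ht ((starRingEnd ℂ) z)))
      (Metric.ball (c : ℂ) R) := by
    intro z hz
    have h1 := (hHtd _ (hconjball z hz)).differentiableAt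
      (Metric.isOpen_ball.mem_nhds (hconjball z hz))
    have h2 := (differentiableAt_conj_conj_iff (f := Ht) (x := z)).2 (by simpa using h1)
    exact h2.neg.differentiableWithinAt
  have hcm : (c : ℂ) ∈ Metric.ball (c : ℂ) R := Metric.mem_ball_self hR
  have hid := (hHtd.analyticOnNhd Metric.isOpen_ball).eqOn_of_preconnected_of_frequently_eq
    (hrd.analyticOnNhd Metric.isOpen_ball) (convex_ball _ _).isPreconnected hcm (by
      have h2 : Tendsto (fun t : ℝ => (c + t : ℂ)) (𝓝[>] 0) (𝓝[≠] (c : ℂ)) := by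
        rw [tendsto_nhdsWithin_iff]
        constructor
        · have : Tendsto (fun t : ℝ => (c + t : ℂ)) (𝓝[>] 0) (𝓝 ((c : ℂ) + (0:ℝ))) :=
            (Continuous.tendsto (by fun_prop) 0).mono_left nhdsWithin_le_nhds
          simpa using this
        · filter_upwards [self_mem_nhdsWithin] with t ht
          have : t ≠ 0 := ne_of_gt ht
          simpa using this
      refine h2.frequently (Eventually.frequently ?_)
      have h3 := (h2.mono_right nhdsWithin_le_nhds) (Metric.isOpen_ball.mem_nhds hcm)
      filter_upwards [h3] with t ht
      have e : (c + t : ℂ) = ((c + t : ℝ) : ℂ) := by push_cast; ring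
      have ht' : (c + t : ℂ) ∈ Metric.ball (c : ℂ) R := ht
      rw [e] at ht'
      have := hreal _ ht'
      rw [e, conj_ofReal]
      apply Complex.ext
      · rw [neg_re, conj_re, this, neg_zero]
      · simp)
  intro z hz hi
  rw [hid hz]
  simp only
  rw [hup _ (hconjball z hz) (by simpa using hi)]

end FL

namespace FL
open Complex Set Filter Topology

/-- local boundedness of the real part at the boundary -/
def PB (H : ℂ → ℂ) (x : ℝ) : Prop :=
  ∃ R > 0, ∃ N : ℝ, ∀ y ∈ Icc (x - R) (x + R), ∀ t ∈ Ioc (0:ℝ) 1, |(H (y + t * I)).re| ≤ N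

theorem PB_open (H : ℂ → ℂ) : IsOpen {x | PB H x} := by
  rw [Metric.isOpen_iff]
  rintro x ⟨R, hR, N, h⟩
  refine ⟨R/2, by positivity, ?_⟩
  intro y hy
  rw [Metric.mem_ball, Real.dist_eq, abs_lt] at hy
  refine ⟨R/2, by positivity, N, fun w hw => h w ⟨?_, ?_⟩⟩
  · linarith [hw.1, hy.1]
  · linarith [hw.2, hy.2]

theorem PB_ext {s : ℝ} (hs0 : 0 < s) (hs1 : s < 1) {H : ℂ → ℂ}
    (hH : DifferentiableOn ℂ H {z : ℂ | 0 < z.im})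
    (hbd : ∀ p q : ℝ, 0 < p → p < q → ∃ C : ℝ, ∀ x ∈ Icc p q, ∀ t ∈ Ioc (0:ℝ) 1,
      ‖H (x + t * I)‖ ≤ C * t ^ (-(2*s)))
    (hlim : ∀ x : ℝ, 0 < x → Tendsto (fun t : ℝ => (H (x + t * I)).re) (𝓝[>] 0) (𝓝 0))
    {c : ℝ} (hc : 0 < c) (hP : PB H c) :
    ∃ R > 0, ∃ Ht : ℂ → ℂ, R < c ∧ DifferentiableOn ℂ Ht (Metric.ball (c : ℂ) R) ∧
      (∀ z ∈ Metric.ball (c : ℂ) R, 0 < z.im → Ht z = H z) ∧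
      (∀ z ∈ Metric.ball (c : ℂ) R, z.im < 0 → Ht z = -(starRingEnd ℂ) (H ((starRingEnd ℂ) z))) ∧
      (∀ x : ℝ, (x : ℂ) ∈ Metric.ball (c : ℂ) R → (Ht x).re = 0) := by
  obtain ⟨R0, hR0, N, hN⟩ := hP
  set R := min R0 (min (c/2) (1/2)) with hR
  have h1 : R ≤ R0 := min_le_left _ _
  have h2 : R ≤ c/2 := (min_le_right _ _).trans (min_le_left _ _)
  have h3 : R ≤ 1/2 := (min_le_right _ _).trans (min_le_right _ _)
  have hRpos : 0 < R := lt_min hR0 (lt_min (by linarith) (by norm_num))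
  obtain ⟨C, hC⟩ := hbd (c - R) (c + R) (by linarith) (by linarith)
  obtain ⟨Ht, a1, a2, a3, a4⟩ := ext_lemma hs0 hs1 hH (c := c) (R := R) (C := C) (N := N) hRpos
    (fun x hx t ht => hC x hx t ⟨ht.1, by linarith [ht.2]⟩)
    (fun x hx t ht => hN x ⟨by linarith [hx.1], by linarith [hx.2]⟩ t ⟨ht.1, by linarith [ht.2]⟩)
    (fun x hx => hlim x (by linarith [hx.1]))
  exact ⟨R, hRpos, Ht, by linarith, a1, a2, a3, a4⟩

theorem PB_loc {H Ht : ℂ → ℂ} {c R : ℝ} (hR : 0 < R)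
    (hd : DifferentiableOn ℂ Ht (Metric.ball (c : ℂ) R))
    (hup : ∀ z ∈ Metric.ball (c : ℂ) R, 0 < z.im → Ht z = H z)
    (hre : ∀ x : ℝ, (x : ℂ) ∈ Metric.ball (c : ℂ) R → (Ht x).re = 0) :
    ∀ᶠ q : ℝ × ℝ in 𝓝 c ×ˢ 𝓝[>] (0:ℝ), |(H (q.1 + q.2 * I)).re| ≤ 1 := by
  have hcm : (c : ℂ) ∈ Metric.ball (c : ℂ) R := Metric.mem_ball_self hR
  have hc : ContinuousAt (fun z => |(Ht z).re|) (c : ℂ) :=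
    ((continuous_re.continuousAt).comp
      (hd.continuousOn.continuousAt (Metric.isOpen_ball.mem_nhds hcm))).abs
  have h1 : Tendsto (fun q : ℝ × ℝ => (q.1 + q.2 * I : ℂ)) (𝓝 c ×ˢ 𝓝[>] (0:ℝ)) (𝓝 (c : ℂ)) := by
    have : Tendsto (fun q : ℝ × ℝ => (q.1 + q.2 * I : ℂ)) (𝓝 (c, (0:ℝ))) (𝓝 ((c : ℂ) + (0:ℝ) * I)) :=
      Continuous.tendsto (by fun_prop) (c, (0:ℝ))
    rw [nhds_prod_eq] at this
    simp only [ofReal_zero, zero_mul, add_zero] at this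
    exact this.mono_left (prod_mono le_rfl nhdsWithin_le_nhds)
  have h2 : ∀ᶠ z in 𝓝 (c : ℂ), |(Ht z).re| < 1 := by
    have := hc.tendsto
    rw [hre c hcm, abs_zero] at this
    exact this (Iio_mem_nhds one_pos)
  have h3 : ∀ᶠ q : ℝ × ℝ in 𝓝 c ×ˢ 𝓝[>] (0:ℝ), 0 < q.2 :=
    (tendsto_snd (f := 𝓝 c) (g := 𝓝[>] (0:ℝ))).eventually self_mem_nhdsWithin
  filter_upwards [h1.eventually h2, h1.eventually (Metric.isOpen_ball.mem_nhds hcm), h3]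
    with q a1 a2 a3
  rw [← hup _ a2 (by simpa using a3)]
  exact a1.le

theorem vert_bd {H : ℂ → ℂ} (hH : DifferentiableOn ℂ H {z : ℂ | 0 < z.im}) {x : ℝ}
    (hlim : Tendsto (fun t : ℝ => (H (x + t * I)).re) (𝓝[>] 0) (𝓝 0)) :
    ∃ N : ℝ, ∀ t ∈ Ioc (0:ℝ) 1, |(H (x + t * I)).re| ≤ N := by
  have h1 : ∀ᶠ t : ℝ in 𝓝[>] (0:ℝ), |(H (x + t * I)).re| < 1 := by
    have := hlim.abs
    rw [abs_zero] at this
    exact this (Iio_mem_nhds one_pos)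
  obtain ⟨ε, hε, h2⟩ := (mem_nhdsGT_iff_exists_Ioc_subset).1 h1
  have hε' : (0:ℝ) < ε := hε
  have hcont : ContinuousOn (fun t : ℝ => (H (x + t * I)).re) (Icc ε 1) := by
    refine continuous_re.comp_continuousOn (hH.continuousOn.comp (by fun_prop) ?_)
    intro t ht
    change 0 < (x + t * I : ℂ).im
    simp; linarith [ht.1]
  obtain ⟨N, hN⟩ := isCompact_Icc.exists_bound_of_continuousOn hcont
  refine ⟨max 1 N, fun t ht => ?_⟩
  rcases le_or_gt t ε with h | h
  · have : |(H (x + t * I)).re| < 1 := h2 ⟨ht.1, h⟩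
    exact this.le.trans (le_max_left _ _)
  · exact (hN t ⟨h.le, ht.2⟩).trans (le_max_right _ _)

theorem PB_all {s : ℝ} (hs0 : 0 < s) (hs1 : s < 1) {H : ℂ → ℂ}
    (hH : DifferentiableOn ℂ H {z : ℂ | 0 < z.im})
    (hbd : ∀ p q : ℝ, 0 < p → p < q → ∃ C : ℝ, ∀ x ∈ Icc p q, ∀ t ∈ Ioc (0:ℝ) 1,
      ‖H (x + t * I)‖ ≤ C * t ^ (-(2*s)))
    (hlim : ∀ x : ℝ, 0 < x → Tendsto (fun t : ℝ => (H (x + t * I)).re) (𝓝[>] 0) (𝓝 0))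
    {c : ℝ} (hc : 0 < c) : PB H c := by
  by_contra hcon
  set E : Set ℝ := Ioi 0 ∩ {x | ¬ PB H x} with hE
  have hclosed : IsClosed {x | ¬ PB H x} := (PB_open H).isClosed_compl
  have hEl : IsLocallyClosed E := isOpen_Ioi.isLocallyClosed.inter hclosed.isLocallyClosed
  have : LocallyCompactSpace E := hEl.locallyCompactSpace
  have : Nonempty E := ⟨⟨c, hc, hcon⟩⟩
  have hcontx : ∀ t : ℝ, 0 < t → Continuous (fun x : ℝ => |(H (x + t * I)).re|) := by
    intro t ht
    have : ContinuousOn (fun x : ℝ => H (x + t * I)) univ :=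
      hH.continuousOn.comp (by fun_prop) (fun x _ => by simpa using ht)
    exact (continuous_re.comp (continuousOn_univ.1 this)).abs
  obtain ⟨n, ⟨e, hen⟩⟩ := nonempty_interior_of_iUnion_of_closed
    (X := E) (f := fun n : ℕ => {x : E | ∀ t ∈ Ioc (0:ℝ) 1, |(H (x + t * I)).re| ≤ n})
    (by
      intro n
      have : {x : E | ∀ t ∈ Ioc (0:ℝ) 1, |(H (x + t * I)).re| ≤ n}
          = ⋂ t ∈ Ioc (0:ℝ) 1, {x : E | |(H (x + t * I)).re| ≤ n} := by
        ext x; simp only [mem_iInter]; rfl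
      rw [this]
      refine isClosed_biInter fun t ht => ?_
      exact isClosed_le ((hcontx t ht.1).comp continuous_subtype_val) continuous_const)
    (by
      rw [eq_univ_iff_forall]
      intro x
      obtain ⟨N, hN⟩ := vert_bd hH (hlim x x.2.1)
      obtain ⟨n, hn⟩ := exists_nat_ge N
      exact mem_iUnion.2 ⟨n, fun t ht => (hN t ht).trans hn⟩)
  rw [mem_interior_iff_mem_nhds, Metric.mem_nhds_iff] at hen
  obtain ⟨r, hr, hball⟩ := hen
  have he0 : (0:ℝ) < e := e.2.1
  have hEb : ∀ x ∈ E, |x - e| < r → ∀ t ∈ Ioc (0:ℝ) 1, |(H (x + t * I)).re| ≤ n := by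
    intro x hx hxe
    have : (⟨x, hx⟩ : E) ∈ Metric.ball e r := by
      rw [Metric.mem_ball, Subtype.dist_eq, Real.dist_eq]; exact hxe
    exact hball this
  set r' := min (r/2) (min (e/2 : ℝ) (1/2)) with hr'
  have h1 : r' ≤ r/2 := min_le_left _ _
  have h2 : r' ≤ e/2 := (min_le_right _ _).trans (min_le_left _ _)
  have h3 : r' ≤ 1/2 := (min_le_right _ _).trans (min_le_right _ _)
  have hr'0 : 0 < r' := lt_min (by linarith) (lt_min (by linarith) (by norm_num))
  obtain ⟨p, hp⟩ : ∃ p : ℝ, p = e - r' := ⟨_, rfl⟩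
  obtain ⟨q, hq⟩ : ∃ q : ℝ, q = e + r' := ⟨_, rfl⟩
  have hp0 : 0 < p := by linarith
  have hpq : p < q := by linarith
  obtain ⟨C0, hC0⟩ := hbd p q hp0 hpq
  obtain ⟨Np, hNp⟩ := vert_bd hH (hlim p hp0)
  obtain ⟨Nq, hNq⟩ := vert_bd hH (hlim q (by linarith))
  obtain ⟨Nt, hNt⟩ := (isCompact_Icc (a := p) (b := q)).exists_bound_of_continuousOn
    (hcontx 1 one_pos).continuousOn
  have hC : 0 ≤ C0 := by
    have := (norm_nonneg _).trans (hC0 p ⟨le_rfl, hpq.le⟩ 1 ⟨one_pos, le_rfl⟩)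
    simpa using this
  obtain ⟨N, hNn, hNp', hNq', hNt', hN1⟩ : ∃ N : ℝ, n ≤ N ∧ Np ≤ N ∧ Nq ≤ N ∧ Nt ≤ N ∧ 1 ≤ N := by
    refine ⟨max (n:ℝ) (max Np (max Nq (max Nt 1))), ?_, ?_, ?_, ?_, ?_⟩ <;> simp
  have main : ∀ x ∈ Icc p q, ∀ t ∈ Ioc (0:ℝ) 1, |(H (x + t * I)).re| ≤ N := by
    have hspec : ∀ x ∈ Icc p q, (¬ PB H x ∨ x = p ∨ x = q) → ∀ t ∈ Ioc (0:ℝ) 1,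
        |(H (x + t * I)).re| ≤ N := by
      intro x hx h t ht
      rcases h with h | h | h
      · refine (hEb x ⟨lt_of_lt_of_le hp0 hx.1, h⟩ ?_ t ht).trans hNn
        rw [abs_lt]; constructor <;> linarith [hx.1, hx.2]
      · rw [h]; exact (hNp t ht).trans hNp'
      · rw [h]; exact (hNq t ht).trans hNq'
    intro x hx
    by_cases hxs : ¬ PB H x ∨ x = p ∨ x = q
    · exact hspec x hx hxs
    push Not at hxs
    obtain ⟨hxP, hxp, hxq⟩ := hxs
    have hpx : p < x := lt_of_le_of_ne hx.1 (Ne.symm hxp)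
    have hxq' : x < q := lt_of_le_of_ne hx.2 hxq
    set S1 := ({x | ¬ PB H x} ∪ {p}) ∩ Icc p x with hS1
    set S2 := ({x | ¬ PB H x} ∪ {q}) ∩ Icc x q with hS2
    have k1 : IsCompact S1 := isCompact_Icc.inter_left (hclosed.union isClosed_singleton)
    have k2 : IsCompact S2 := isCompact_Icc.inter_left (hclosed.union isClosed_singleton)
    have n1 : S1.Nonempty := ⟨p, Or.inr rfl, le_rfl, hpx.le⟩
    have n2 : S2.Nonempty := ⟨q, Or.inr rfl, hxq'.le, le_rfl⟩
    have m1 := k1.sSup_mem n1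
    have m2 := k2.sInf_mem n2
    obtain ⟨a, ha⟩ : ∃ a, a = sSup S1 := ⟨_, rfl⟩
    obtain ⟨b, hb⟩ : ∃ b, b = sInf S2 := ⟨_, rfl⟩
    rw [← ha] at m1
    rw [← hb] at m2
    have hax : a < x := by
      refine lt_of_le_of_ne m1.2.2 ?_
      rintro rfl
      rcases m1.1 with h | h
      · exact h hxP
      · exact hxp h
    have hxb : x < b := by
      refine lt_of_le_of_ne m2.2.1 ?_
      rintro rfl
      rcases m2.1 with h | h
      · exact h hxP
      · exact hxq h
    have hapq : a ∈ Icc p q := ⟨m1.2.1, by linarith⟩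
    have hbpq : b ∈ Icc p q := ⟨by linarith, m2.2.2⟩
    have hsubI : Icc a b ⊆ Icc p q := Icc_subset_Icc hapq.1 hbpq.2
    have hgood : ∀ y ∈ Ioo a b, PB H y := by
      intro y hy
      by_contra h
      rcases le_total y x with hyx | hyx
      · have : y ≤ a := by
          rw [ha]
          exact le_csSup k1.bddAbove ⟨Or.inl h, by linarith [hapq.1, hy.1], hyx⟩
        linarith [hy.1]
      · have : b ≤ y := by
          rw [hb]
          exact csInf_le k2.bddBelow ⟨Or.inl h, hyx, by linarith [hbpq.2, hy.2]⟩
        linarith [hy.2]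
    have hloc : ∀ y ∈ Ioo a b, ∀ᶠ q : ℝ × ℝ in 𝓝 y ×ˢ 𝓝[>] (0:ℝ),
        |(H (q.1 + q.2 * I)).re| ≤ 1 := by
      intro y hy
      obtain ⟨R, hR, Ht, -, g1, g2, -, g4⟩ := PB_ext hs0 hs1 hH hbd hlim
        (c := y) (by linarith [hy.1, hapq.1]) (hgood y hy)
      exact PB_loc hR g1 g2 g4
    have hla : ∀ t ∈ Ioc (0:ℝ) 1, |(H (a + t * I)).re| ≤ N :=
      hspec a hapq (by rcases m1.1 with h | h; exacts [Or.inl h, Or.inr (Or.inl h)])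
    have hlb : ∀ t ∈ Ioc (0:ℝ) 1, |(H (b + t * I)).re| ≤ N :=
      hspec b hbpq (by rcases m2.1 with h | h; exacts [Or.inl h, Or.inr (Or.inr h)])
    have hlt : ∀ y ∈ Icc a b, |(H (y + (1:ℝ) * I)).re| ≤ N := by
      intro y hy
      have := hNt y (hsubI hy)
      rw [Real.norm_eq_abs, abs_abs] at this
      exact this.trans hNt'
    have hbd1 : ∀ y ∈ Icc a b, ∀ t ∈ Ioc (0:ℝ) 1, |(H (y + t * I)).re| ≤ C0 * t ^ (-(2*s)) :=
      fun y hy t ht => (abs_re_le_norm _).trans (hC0 y (hsubI hy) t ht)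
    have hab : a < b := hax.trans hxb
    have hab1 : b - a ≤ 1 := by linarith [hapq.1, hbpq.2]
    have hxab : x ∈ Icc a b := ⟨hax.le, hxb.le⟩
    have r1 := pl_rect hs0 hs1 hH hab hab1 hC (fun y hy t ht => (abs_le.1 (hbd1 y hy t ht)).2)
      (fun y hy => (hloc y hy).mono fun _ h => (abs_le.1 h).2) hN1
      (fun t ht => (abs_le.1 (hla t ht)).2) (fun t ht => (abs_le.1 (hlb t ht)).2)
      (fun y hy => (abs_le.1 (hlt y hy)).2) x hxab
    have r2 := pl_rect (H := fun z => - H z) hs0 hs1 hH.neg hab hab1 hC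
      (fun y hy t ht => by have := (abs_le.1 (hbd1 y hy t ht)).1; simp only [neg_re]; linarith)
      (fun y hy => (hloc y hy).mono fun _ h => by
        have := (abs_le.1 h).1; simp only [neg_re]; linarith) hN1
      (fun t ht => by have := (abs_le.1 (hla t ht)).1; simp only [neg_re]; linarith)
      (fun t ht => by have := (abs_le.1 (hlb t ht)).1; simp only [neg_re]; linarith)
      (fun y hy => by have := (abs_le.1 (hlt y hy)).1; simp only [neg_re]; linarith) x hxab
    intro t ht
    have q1 := r1 t ht
    have q2 := r2 t ht
    simp only [neg_re] at q2
    rw [abs_le]; constructor <;> linarith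
  exact e.2.2 ⟨r', hr'0, N, by rw [← hp, ← hq]; exact main⟩

/-- Extension at every positive point. -/
theorem ext_all {s : ℝ} (hs0 : 0 < s) (hs1 : s < 1) {H : ℂ → ℂ}
    (hH : DifferentiableOn ℂ H {z : ℂ | 0 < z.im})
    (hbd : ∀ p q : ℝ, 0 < p → p < q → ∃ C : ℝ, ∀ x ∈ Icc p q, ∀ t ∈ Ioc (0:ℝ) 1,
      ‖H (x + t * I)‖ ≤ C * t ^ (-(2*s)))
    (hlim : ∀ x : ℝ, 0 < x → Tendsto (fun t : ℝ => (H (x + t * I)).re) (𝓝[>] 0) (𝓝 0))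
    {c : ℝ} (hc : 0 < c) :
    ∃ R > 0, ∃ Ht : ℂ → ℂ, R < c ∧ DifferentiableOn ℂ Ht (Metric.ball (c : ℂ) R) ∧
      (∀ z ∈ Metric.ball (c : ℂ) R, 0 < z.im → Ht z = H z) ∧
      (∀ z ∈ Metric.ball (c : ℂ) R, z.im < 0 → Ht z = -(starRingEnd ℂ) (H ((starRingEnd ℂ) z))) ∧
      (∀ x : ℝ, (x : ℂ) ∈ Metric.ball (c : ℂ) R → (Ht x).re = 0) :=
  PB_ext hs0 hs1 hH hbd hlim hc (PB_all hs0 hs1 hH hbd hlim hc)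

end FL

namespace FL
open Complex Set Filter Topology

theorem mul_cpow' {a b : ℂ} (ha : a ≠ 0) (hb : b ≠ 0) (h : a.arg + b.arg ∈ Ioc (-Real.pi) Real.pi)
    (c : ℂ) : (a * b) ^ c = a ^ c * b ^ c := by
  rw [cpow_def_of_ne_zero (mul_ne_zero ha hb), cpow_def_of_ne_zero ha, cpow_def_of_ne_zero hb,
    (Complex.log_mul_eq_add_log_iff ha hb).2 h, add_mul, Complex.exp_add]

/-- basic integrability of the weights -/
theorem int_weight {s a x : ℝ} (ha : -1 < a) (has : a < 2*s) (hx : 0 < x) :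
    IntegrableOn (fun y : ℝ => y ^ a * (y + x) ^ (-1 - 2*s)) (Ioi 0) := by
  have hs : -1 - 2*s ≤ 0 := by linarith
  have hm : ∀ A : Set ℝ, A ⊆ Ioi 0 → MeasurableSet A →
      AEStronglyMeasurable (fun y : ℝ => y ^ a * (y + x) ^ (-1 - 2*s)) (volume.restrict A) := by
    intro A hA hAm
    refine ContinuousOn.aestronglyMeasurable ?_ hAm
    intro y hy
    have hy0 : 0 < y := hA hy
    refine ContinuousAt.continuousWithinAt ?_
    refine (Real.continuousAt_rpow_const _ _ (Or.inl hy0.ne')).mul ?_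
    exact ContinuousAt.rpow_const (by fun_prop) (Or.inl (by positivity))
  have h1 : IntegrableOn (fun y : ℝ => y ^ a * (y + x) ^ (-1 - 2*s)) (Ioc 0 1) := by
    have : IntegrableOn (fun y : ℝ => y ^ a * x ^ (-1 - 2*s)) (Ioc 0 1) := by
      refine Integrable.mul_const ?_ _
      have := (intervalIntegral.intervalIntegrable_rpow' (a := 0) (b := 1) ha)
      rwa [intervalIntegrable_iff_integrableOn_Ioc_of_le zero_le_one] at this
    refine Integrable.mono' this (hm _ Ioc_subset_Ioi_self measurableSet_Ioc) ?_
    filter_upwards [ae_restrict_mem measurableSet_Ioc] with y hy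
    have hy0 : 0 < y := hy.1
    rw [Real.norm_of_nonneg (by positivity)]
    gcongr ?_ * ?_
    exact Real.rpow_le_rpow_of_nonpos hx (by linarith) hs
  have h2 : IntegrableOn (fun y : ℝ => y ^ a * (y + x) ^ (-1 - 2*s)) (Ioi 1) := by
    have : IntegrableOn (fun y : ℝ => y ^ (a + (-1 - 2*s))) (Ioi 1) :=
      integrableOn_Ioi_rpow_of_lt (by linarith) one_pos
    refine Integrable.mono' this (hm _ (Ioi_subset_Ioi zero_le_one) measurableSet_Ioi) ?_
    filter_upwards [ae_restrict_mem measurableSet_Ioi] with y hy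
    have hy0 : 0 < y := lt_trans one_pos hy
    rw [Real.norm_of_nonneg (by positivity), Real.rpow_add hy0]
    gcongr ?_ * ?_
    exact Real.rpow_le_rpow_of_nonpos hy0 (by linarith) hs
  rw [← Ioc_union_Ioi_eq_Ioi zero_le_one]
  exact h1.union h2

/-- the constant -/
noncomputable def cc (s a : ℝ) : ℝ := ∫ y in Ioi (0:ℝ), y ^ a * (y + 1) ^ (-1 - 2*s)

theorem int_scale {s a x : ℝ} (hx : 0 < x) :
    ∫ y in Ioi (0:ℝ), y ^ a * (y + x) ^ (-1 - 2*s) = cc s a * x ^ (a - 2*s) := by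
  have h := integral_comp_mul_left_Ioi (fun y : ℝ => y ^ a * (y + x) ^ (-1 - 2*s)) 0 hx
  rw [mul_zero] at h
  have h2 : ∫ y in Ioi (0:ℝ), (x * y) ^ a * (x * y + x) ^ (-1 - 2*s)
      = cc s a * x ^ (a + (-1 - 2*s)) := by
    rw [cc, ← integral_mul_const]
    refine setIntegral_congr_fun measurableSet_Ioi ?_
    intro y hy
    have hy0 : 0 < y := hy
    simp only
    rw [show x * y + x = x * (y + 1) by ring, Real.mul_rpow hx.le hy0.le,
      Real.mul_rpow hx.le (by positivity), Real.rpow_add hx]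
    ring
  rw [h2, smul_eq_mul] at h
  have h3 : x ^ (a - 2*s) = x ^ (a + (-1 - 2*s)) * x := by
    rw [show a - 2*s = a + (-1 - 2*s) + 1 by ring, Real.rpow_add_one hx.ne']
  rw [h3, ← mul_assoc, h]
  field_simp

theorem cc_pos {s a : ℝ} (ha : -1 < a) (has : a < 2*s) : 0 < cc s a := by
  rw [cc, setIntegral_pos_iff_support_of_nonneg_ae]
  · have : Ioi (0:ℝ) ⊆ Function.support (fun y : ℝ => y ^ a * (y + 1) ^ (-1 - 2*s)) ∩ Ioi 0 := by
      intro y hy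
      have hy0 : 0 < y := hy
      refine ⟨?_, hy⟩
      rw [Function.mem_support]
      positivity
    refine lt_of_lt_of_le ?_ (measure_mono this)
    simp
  · filter_upwards [ae_restrict_mem measurableSet_Ioi] with y hy
    have hy0 : 0 < y := hy
    change 0 ≤ _
    positivity
  · exact int_weight ha has one_pos

/-- Package of the assumptions on the density. -/
structure Dens (s : ℝ) (u : ℝ → ℝ) (K d β : ℝ) : Prop where
  s0 : 0 < s
  s1 : s < 1
  meas : AEStronglyMeasurable u (volume.restrict (Ioi 0))
  K0 : 0 ≤ K
  d0 : 0 < d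
  d1 : d < 1
  β0 : 0 < β
  βs : β < 2 * s
  bd : ∀ y : ℝ, 0 < y → |u y| ≤ K * (y ^ (d - 1) + y ^ β)

variable {s K d β : ℝ} {u : ℝ → ℝ}

theorem Dens.int_dom (D : Dens s u K d β) {x : ℝ} (hx : 0 < x) :
    IntegrableOn (fun y => K * (y ^ (d - 1) + y ^ β) * (y + x) ^ (-1 - 2*s)) (Ioi 0) := by
  have h1 := int_weight (s := s) (a := d - 1) (x := x) (by linarith [D.d0]) (by linarith [D.d1, D.s0]) hx
  have h2 := int_weight (s := s) (a := β) (x := x) (by linarith [D.β0]) D.βs hx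
  have := (h1.add h2).const_mul K
  refine this.congr (Eventually.of_forall fun y => ?_)
  simp only [Pi.add_apply]
  ring

theorem Dens.int_dom_eq (D : Dens s u K d β) {x : ℝ} (hx : 0 < x) :
    ∫ y in Ioi 0, K * (y ^ (d - 1) + y ^ β) * (y + x) ^ (-1 - 2*s) =
      K * (cc s (d-1) * x ^ (d - 1 - 2*s) + cc s β * x ^ (β - 2*s)) := by
  have h1 := int_weight (s := s) (a := d - 1) (x := x) (by linarith [D.d0]) (by linarith [D.d1, D.s0]) hx
  have h2 := int_weight (s := s) (a := β) (x := x) (by linarith [D.β0]) D.βs hx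
  rw [← int_scale hx, ← int_scale hx, ← integral_add h1 h2, ← integral_const_mul]
  congr 1; funext y; ring

/-- A general kernel majorised by the weight gives an integrable product. -/
theorem Dens.int_ker (D : Dens s u K d β) {k : ℝ → ℂ}
    (hk : AEStronglyMeasurable k (volume.restrict (Ioi 0))) {c x : ℝ} (hx : 0 < x)
    (hb : ∀ y : ℝ, 0 < y → ‖k y‖ ≤ c * (y + x) ^ (-1 - 2*s)) :
    IntegrableOn (fun y => (u y : ℂ) * k y) (Ioi 0) ∧
    ∀ y : ℝ, 0 < y → ‖(u y : ℂ) * k y‖ ≤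
      c * (K * (y ^ (d - 1) + y ^ β) * (y + x) ^ (-1 - 2*s)) := by
  have hc : ∀ y : ℝ, 0 < y → ‖(u y : ℂ) * k y‖ ≤
      c * (K * (y ^ (d - 1) + y ^ β) * (y + x) ^ (-1 - 2*s)) := by
    intro y hy
    rw [norm_mul, norm_real, Real.norm_eq_abs]
    have h1 := D.bd y hy
    have h2 := hb y hy
    calc _ ≤ (K * (y ^ (d - 1) + y ^ β)) * (c * (y + x) ^ (-1 - 2*s)) :=
          mul_le_mul h1 h2 (norm_nonneg _) ((abs_nonneg _).trans h1)
      _ = _ := by ring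
  refine ⟨?_, hc⟩
  refine Integrable.mono' ((D.int_dom hx).const_mul c) ?_ ?_
  · exact (continuous_ofReal.comp_aestronglyMeasurable D.meas).mul hk
  · filter_upwards [ae_restrict_mem measurableSet_Ioi] with y hy using hc y hy

/-- the transform -/
noncomputable def F (s : ℝ) (u : ℝ → ℝ) (z : ℂ) : ℂ :=
  ∫ y in Ioi (0:ℝ), (u y : ℂ) * ((y : ℂ) - z) ^ ((-1 - 2*s : ℝ) : ℂ)

theorem slit_sub {z : ℂ} (hz : -z ∈ slitPlane) {y : ℝ} (hy : 0 ≤ y) : (y : ℂ) - z ∈ slitPlane := by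
  rw [mem_slitPlane_iff] at *
  rcases hz with h | h
  · left; simp at *; linarith
  · right; simpa using h

theorem slit_of_im {z : ℂ} (hz : z.im ≠ 0) : -z ∈ slitPlane := by
  rw [mem_slitPlane_iff]; right; simpa using hz

theorem ker_meas (s : ℝ) {z : ℂ} (hz : -z ∈ slitPlane) :
    AEStronglyMeasurable (fun y : ℝ => ((y : ℂ) - z) ^ ((-1 - 2*s : ℝ) : ℂ))
      (volume.restrict (Ioi 0)) := by
  refine ContinuousOn.aestronglyMeasurable ?_ measurableSet_Ioi
  intro y hy
  have hy0 : 0 < y := hy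
  have hc : ContinuousAt (fun y : ℝ => (y : ℂ) - z) y := by fun_prop
  exact (hc.cpow continuousAt_const (slit_sub hz hy0.le)).continuousWithinAt

theorem ker_bd {s : ℝ} (hs : 0 < s) {z : ℂ} {y c x : ℝ} (hc : 0 < c) (hyx : 0 < y + x)
    (h : c * (y + x) ≤ ‖(y : ℂ) - z‖) :
    ‖((y : ℂ) - z) ^ ((-1 - 2*s : ℝ) : ℂ)‖ ≤ c ^ (-1 - 2*s) * (y + x) ^ (-1 - 2*s) := by
  rw [norm_cpow_real, ← Real.mul_rpow hc.le hyx.le]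
  exact Real.rpow_le_rpow_of_nonpos (by positivity) h (by linarith)

theorem low_loc {z0 : ℂ} (hz0 : -z0 ∈ slitPlane) : ∃ ε > 0, ∃ c > 0, ∀ z ∈ Metric.ball z0 ε,
    -z ∈ slitPlane ∧ ∀ y : ℝ, 0 ≤ y → c * (y + 1) ≤ ‖(y : ℂ) - z‖ := by
  have hopen : IsOpen {z : ℂ | -z ∈ slitPlane} := isOpen_slitPlane.preimage continuous_neg
  obtain ⟨ε, hε, hb⟩ := Metric.isOpen_iff.1 hopen z0 hz0
  set L := ‖z0‖ + ε with hL
  have hL0 : 0 < L := by positivity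
  refine ⟨ε/2, by positivity, min (1/2) (ε/(4*L+4)), by positivity, ?_⟩
  intro z hz
  refine ⟨hb (Metric.ball_subset_ball (by linarith) hz), ?_⟩
  intro y hy
  have h1 : ε ≤ dist (y : ℂ) z0 := by
    by_contra h
    push Not at h
    have : -(y : ℂ) ∈ slitPlane := hb h
    rw [mem_slitPlane_iff] at this
    simp at this
    linarith
  rw [Metric.mem_ball] at hz
  have h2 : ε/2 ≤ ‖(y : ℂ) - z‖ := by
    rw [← dist_eq_norm]
    have := dist_triangle (y : ℂ) z z0
    linarith
  have h3 : ‖z‖ ≤ L := by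
    have := norm_le_norm_add_norm_sub' z z0
    rw [dist_eq_norm] at hz
    linarith
  have h4 : y - L ≤ ‖(y : ℂ) - z‖ := by
    have := norm_sub_norm_le (y : ℂ) z
    rw [norm_real, Real.norm_of_nonneg hy] at this
    linarith
  rcases le_or_gt y (2*L+1) with h | h
  · calc _ ≤ ε/(4*L+4) * (y + 1) := by gcongr; exact min_le_right _ _
      _ ≤ ε/(4*L+4) * (2*L+2) := mul_le_mul_of_nonneg_left (by linarith) (by positivity)
      _ = ε/2 := by field_simp; ring
      _ ≤ _ := h2
  · calc _ ≤ 1/2 * (y + 1) := by gcongr; exact min_le_left _ _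
      _ ≤ y - L := by linarith
      _ ≤ _ := h4

theorem Dens.F_holo (D : Dens s u K d β) : DifferentiableOn ℂ (F s u) {z | -z ∈ slitPlane} := by
  have hopen : IsOpen {z : ℂ | -z ∈ slitPlane} := isOpen_slitPlane.preimage continuous_neg
  refine holo_integral hopen ?_ ?_ ?_
  · intro z hz
    exact (continuous_ofReal.comp_aestronglyMeasurable D.meas).mul (ker_meas s hz)
  · filter_upwards [ae_restrict_mem measurableSet_Ioi] with y hy
    have hy0 : 0 < y := hy
    refine DifferentiableOn.const_mul ?_ _
    refine DifferentiableOn.cpow_const (by fun_prop) ?_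
    intro z hz
    exact slit_sub hz hy0.le
  · intro z0 hz0
    obtain ⟨ε, hε, c, hc, h⟩ := low_loc hz0
    refine ⟨ε, hε, fun y => c ^ (-1 - 2*s) * (K * (y ^ (d - 1) + y ^ β) * (y + 1) ^ (-1 - 2*s)),
      (D.int_dom one_pos).const_mul _, ?_⟩
    filter_upwards [ae_restrict_mem measurableSet_Ioi] with y hy z hz
    exact (D.int_ker (ker_meas s (h z hz).1) one_pos
      (fun y hy => ker_bd D.s0 hc (by positivity) ((h z hz).2 y hy.le))).2 y hy

theorem Dens.F_int (D : Dens s u K d β) {z : ℂ} (hz : -z ∈ slitPlane) :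
    IntegrableOn (fun y => (u y : ℂ) * ((y : ℂ) - z) ^ ((-1 - 2*s : ℝ) : ℂ)) (Ioi 0) := by
  obtain ⟨ε, hε, c, hc, h⟩ := low_loc hz
  have h0 := h z (Metric.mem_ball_self hε)
  exact (D.int_ker (ker_meas s hz) one_pos
      (fun y hy => ker_bd D.s0 hc (by positivity) (h0.2 y hy.le))).1

theorem F_conj {z : ℂ} (hz : -z ∈ slitPlane) :
    F s u ((starRingEnd ℂ) z) = (starRingEnd ℂ) (F s u z) := by
  unfold F
  rw [← integral_conj]
  refine setIntegral_congr_fun measurableSet_Ioi ?_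
  intro y hy
  have hy0 : 0 < y := hy
  simp only [map_mul, conj_ofReal]
  congr 1
  have h := slit_sub hz hy0.le
  have := conj_cpow ((y : ℂ) - z) ((-1 - 2*s : ℝ) : ℂ) (mem_slitPlane_iff_arg.1 h).1
  rw [conj_ofReal] at this
  rw [← this]; simp

/-- global growth -/
theorem Dens.F_bd (D : Dens s u K d β) {z : ℂ} (hz : z.im ≠ 0) :
    ‖F s u z‖ ≤ (|z.im| / (4 * ‖z‖)) ^ (-1 - 2*s) *
      (K * (cc s (d-1) * ‖z‖ ^ (d - 1 - 2*s) + cc s β * ‖z‖ ^ (β - 2*s))) := by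
  have hz0 : 0 < ‖z‖ := by
    rw [norm_pos_iff]; rintro rfl; simp at hz
  have him : 0 < |z.im| := abs_pos.2 hz
  have hle : |z.im| ≤ ‖z‖ := abs_im_le_norm z
  have hlow : ∀ y : ℝ, 0 ≤ y → |z.im| / (4 * ‖z‖) * (y + ‖z‖) ≤ ‖(y : ℂ) - z‖ := by
    intro y hy
    have h1 : |z.im| ≤ ‖(y : ℂ) - z‖ := by
      have := abs_im_le_norm ((y : ℂ) - z)
      simpa using this
    have h4 : y - ‖z‖ ≤ ‖(y : ℂ) - z‖ := by
      have := norm_sub_norm_le (y : ℂ) z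
      rwa [norm_real, Real.norm_of_nonneg hy] at this
    rw [div_mul_eq_mul_div, div_le_iff₀ (by positivity)]
    rcases le_or_gt y (3*‖z‖) with h | h
    · calc _ ≤ |z.im| * (4*‖z‖) := by gcongr; linarith
        _ ≤ _ := by gcongr
    · calc |z.im| * (y + ‖z‖) ≤ ‖z‖ * (y + ‖z‖) := by gcongr
        _ ≤ ‖z‖ * (4 * (y - ‖z‖)) := by gcongr; linarith
        _ = (y - ‖z‖) * (4 * ‖z‖) := by ring
        _ ≤ _ := by gcongr
  have hk := D.int_ker (ker_meas s (slit_of_im hz)) hz0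
    (fun y hy => ker_bd D.s0 (by positivity) (by positivity) (hlow y hy.le))
  rw [← D.int_dom_eq hz0, ← integral_const_mul]
  refine norm_integral_le_of_norm_le ((D.int_dom hz0).const_mul _) ?_
  filter_upwards [ae_restrict_mem measurableSet_Ioi] with y hy using hk.2 y hy

end FL

namespace FL
open Complex Set Filter Topology

variable {s K d β : ℝ} {u : ℝ → ℝ}

/-- rotated transform -/
noncomputable def HH (s : ℝ) (u : ℝ → ℝ) (z : ℂ) : ℂ := I ^ ((-1 - 2*s : ℝ) : ℂ) * F s u z

theorem Ialpha_norm (a : ℝ) : ‖I ^ (a : ℂ)‖ = 1 := by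
  rw [norm_cpow_real]; simp

theorem norm_yz_ge (x t y : ℝ) (ht : 0 < t) : (|y - x| + t) / 2 ≤ ‖(y : ℂ) - (x + t * I)‖ := by
  have h1 := abs_re_le_norm ((y : ℂ) - (x + t * I))
  have h2 := abs_im_le_norm ((y : ℂ) - (x + t * I))
  simp at h1 h2
  rw [abs_of_pos ht] at h2
  linarith

theorem Dens.HH_loc (D : Dens s u K d β) : ∀ p q : ℝ, 0 < p → p < q → ∃ C, ∀ x ∈ Icc p q,
    ∀ t ∈ Ioc (0:ℝ) 1, ‖HH s u (x + t * I)‖ ≤ C * t ^ (-(2*s)) := by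
  intro p q hp hpq
  have hs := D.s0
  have hK := D.K0
  have hq : 0 < q := hp.trans hpq
  have hg : Integrable (fun r : ℝ => (1 + ‖r‖) ^ (-(1 + 2*s))) :=
    integrable_one_add_norm (by simp; linarith)
  set M := K * ((p/2) ^ (d-1) + (2*q) ^ β) with hM
  have hM0 : 0 ≤ M := by positivity
  set c0 := 1 / (1 + 2*(q+1)/p) with hc0
  have hc0p : 0 < c0 := by positivity
  set J := ∫ r : ℝ, (1 + ‖r‖) ^ (-(1 + 2*s)) with hJ
  set L := ∫ y in Ioi (0:ℝ), c0 ^ (-1 - 2*s) * (K * (y ^ (d - 1) + y ^ β) * (y + 1) ^ (-1 - 2*s)) with hL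
  have hL0 : 0 ≤ L := by
    refine setIntegral_nonneg measurableSet_Ioi ?_
    intro y hy
    have hy0 : 0 < y := hy
    positivity
  refine ⟨M * (2 ^ (1 + 2*s)) * J + L, ?_⟩
  intro x hx t ht
  have ht0 := ht.1
  set B1 : ℝ → ℝ := fun y => M * (2 ^ (1+2*s) * t ^ (-1 - 2*s)) * (1 + ‖(y - x)/t‖) ^ (-(1 + 2*s)) with hB1
  have hB1i : Integrable B1 := by
    refine Integrable.const_mul ?_ _
    exact (hg.comp_div ht0.ne').comp_sub_right x
  have hB1e : ∫ y, B1 y = M * 2 ^ (1+2*s) * J * t ^ (-(2*s)) := by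
    rw [hB1, integral_const_mul, integral_sub_right_eq_self (fun y : ℝ => (1 + ‖y/t‖) ^ (-(1 + 2*s))) x,
      Measure.integral_comp_div (fun y : ℝ => (1 + ‖y‖) ^ (-(1 + 2*s))), smul_eq_mul, abs_of_pos ht0, ← hJ]
    rw [show -(2*s) = (-1-2*s) + 1 by ring, Real.rpow_add_one ht0.ne']
    ring
  have hB1pos : ∀ y, 0 ≤ B1 y := fun y => by simp only [hB1]; positivity
  have hker : ∀ y : ℝ, ‖((y : ℂ) - (x + t * I)) ^ ((-1 - 2*s : ℝ) : ℂ)‖ ≤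
      2 ^ (1+2*s) * t ^ (-1 - 2*s) * (1 + ‖(y - x)/t‖) ^ (-(1 + 2*s)) := by
    intro y
    rw [norm_cpow_real]
    have h1 : (|y - x| + t)/2 = t * (1 + ‖(y-x)/t‖) * 2⁻¹ := by
      rw [norm_div, Real.norm_eq_abs, Real.norm_eq_abs, abs_of_pos ht0]; field_simp; ring
    calc _ ≤ ((|y - x| + t)/2) ^ (-1 - 2*s) :=
          Real.rpow_le_rpow_of_nonpos (by positivity) (norm_yz_ge x t y ht0) (by linarith)
      _ = _ := by
        rw [h1, Real.mul_rpow (by positivity) (by positivity), Real.mul_rpow ht0.le (by positivity),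
          Real.inv_rpow (by norm_num), ← Real.rpow_neg (by norm_num)]
        rw [show -(-1-2*s) = 1+2*s by ring, show -(1+2*s) = -1-2*s by ring]
        ring
  have hpt : ∀ y : ℝ, 0 < y → ‖(u y : ℂ) * ((y : ℂ) - (x + t * I)) ^ ((-1 - 2*s : ℝ) : ℂ)‖ ≤
      B1 y + c0 ^ (-1 - 2*s) * (K * (y ^ (d - 1) + y ^ β) * (y + 1) ^ (-1 - 2*s)) := by
    intro y hy
    rw [norm_mul, norm_real, Real.norm_eq_abs]
    rcases lt_or_ge |y - x| (p/2) with h | h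
    · have hu : |u y| ≤ M := by
        refine (D.bd y hy).trans ?_
        rw [abs_lt] at h
        have h1 : y ^ (d-1) ≤ (p/2) ^ (d-1) :=
          Real.rpow_le_rpow_of_nonpos (by positivity) (by linarith [hx.1]) (by linarith [D.d1])
        have h2 : y ^ β ≤ (2*q) ^ β :=
          Real.rpow_le_rpow hy.le (by linarith [hx.2]) D.β0.le
        exact mul_le_mul_of_nonneg_left (add_le_add h1 h2) hK
      have : |u y| * ‖((y : ℂ) - (x + t * I)) ^ ((-1 - 2*s : ℝ) : ℂ)‖ ≤ B1 y := by
        refine (mul_le_mul hu (hker y) (norm_nonneg _) hM0).trans (le_of_eq ?_)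
        simp only [hB1]; ring
      have h3 : 0 ≤ c0 ^ (-1 - 2*s) * (K * (y ^ (d - 1) + y ^ β) * (y + 1) ^ (-1 - 2*s)) := by
        positivity
      linarith
    · have hlow : c0 * (y + 1) ≤ ‖(y : ℂ) - (x + t * I)‖ := by
        have h1 := abs_re_le_norm ((y : ℂ) - (x + t * I))
        simp at h1
        refine le_trans ?_ h1
        rw [hc0, one_div, inv_mul_le_iff₀ (by positivity)]
        have h2 : y - x ≤ |y - x| := le_abs_self _
        have h3 : 2*(q+1)/p * (p/2) ≤ 2*(q+1)/p * |y-x| :=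
          mul_le_mul_of_nonneg_left h (by positivity)
        have h4 : 2*(q+1)/p * (p/2) = q + 1 := by field_simp
        linarith [hx.2]
      have hk := ker_bd D.s0 hc0p (by positivity) hlow
      have := mul_le_mul (D.bd y hy) hk (norm_nonneg _) (by positivity)
      refine this.trans ?_
      have := hB1pos y
      linarith
  have hmain : ‖F s u (x + t*I)‖ ≤ (∫ y in Ioi (0:ℝ), B1 y) + L := by
    have hi2 := (D.int_dom one_pos).const_mul (c0 ^ (-1 - 2*s))
    rw [hL, ← integral_add hB1i.integrableOn hi2]
    refine norm_integral_le_of_norm_le (hB1i.integrableOn.add hi2) ?_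
    filter_upwards [ae_restrict_mem measurableSet_Ioi] with y hy using hpt y hy
  have h5 : ∫ y in Ioi (0:ℝ), B1 y ≤ ∫ y, B1 y :=
    setIntegral_le_integral hB1i (Eventually.of_forall hB1pos)
  rw [HH, norm_mul, Ialpha_norm, one_mul]
  refine hmain.trans ?_
  rw [hB1e] at h5
  have h6 : 1 ≤ t ^ (-(2*s)) := Real.one_le_rpow_of_pos_of_le_one_of_nonpos ht0 ht.2 (by linarith)
  nlinarith

/-- the rotated kernel -/
noncomputable def kap (s t r : ℝ) : ℂ := ((t : ℂ) + r * I) ^ ((-1 - 2*s : ℝ) : ℂ)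

theorem base_slit {t r : ℝ} (ht : 0 < t) : (t : ℂ) + r * I ∈ slitPlane := by
  rw [mem_slitPlane_iff]; left; simpa using ht

theorem kap_even {s t r : ℝ} (ht : 0 < t) : (kap s t (-r)).re = (kap s t r).re := by
  have h := conj_cpow ((t : ℂ) + r * I) ((-1 - 2*s : ℝ) : ℂ) (mem_slitPlane_iff_arg.1 (base_slit ht)).1
  rw [conj_ofReal] at h
  have h2 : (starRingEnd ℂ) ((t : ℂ) + r * I) = (t : ℂ) + ((-r : ℝ) : ℂ) * I := by simp
  rw [h2] at h
  unfold kap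
  rw [h, conj_re]

theorem kap_norm_le {s t r : ℝ} (hs : 0 < s) (hr : r ≠ 0) :
    ‖kap s t r‖ ≤ |r| ^ (-1 - 2*s) := by
  unfold kap
  rw [norm_cpow_real]
  refine Real.rpow_le_rpow_of_nonpos (abs_pos.2 hr) ?_ (by linarith)
  have := abs_im_le_norm ((t : ℂ) + r * I)
  simpa using this

theorem kap_cont {s t : ℝ} (ht : 0 < t) : Continuous (kap s t) := by
  rw [continuous_iff_continuousAt]
  intro r
  have hc : ContinuousAt (fun r : ℝ => (t : ℂ) + r * I) r := by fun_prop
  exact hc.cpow continuousAt_const (base_slit ht)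

theorem kap_int {s t : ℝ} (hs : 0 < s) (ht : 0 < t) : Integrable (kap s t) := by
  have hg : Integrable (fun r : ℝ => (1 + ‖r‖) ^ (-(1 + 2*s))) :=
    integrable_one_add_norm (by simp; linarith)
  refine Integrable.mono' ((hg.comp_div ht.ne').const_mul ((t/2) ^ (-(1+2*s))))
    (kap_cont ht).aestronglyMeasurable ?_
  refine Eventually.of_forall fun r => ?_
  unfold kap
  rw [norm_cpow_real, ← Real.mul_rpow (by positivity) (by positivity), show -(1+2*s) = -1-2*s by ring]
  refine Real.rpow_le_rpow_of_nonpos (by positivity) ?_ (by linarith)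
  have h1 := abs_re_le_norm ((t : ℂ) + r * I)
  have h2 := abs_im_le_norm ((t : ℂ) + r * I)
  simp at h1 h2
  rw [abs_of_pos ht] at h1
  have h3 : t/2 * (1 + ‖r/t‖) = (t + |r|)/2 := by
    rw [norm_div, Real.norm_eq_abs, Real.norm_eq_abs, abs_of_pos ht]; field_simp
  rw [h3]; linarith

theorem kap_integral {s t : ℝ} (hs : 0 < s) (ht : 0 < t) : ∫ r, kap s t r = 0 := by
  have ha : ((-2*s : ℝ) : ℂ) ≠ 0 := by exact_mod_cast (by linarith : (-2*s) ≠ 0)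
  have hder : ∀ r : ℝ, HasDerivAt
      (fun r : ℝ => ((t : ℂ) + r * I) ^ ((-2*s : ℝ) : ℂ) / (((-2*s : ℝ) : ℂ) * I)) (kap s t r) r := by
    intro r
    have h0 : HasDerivAt (fun w : ℂ => (t : ℂ) + w * I) I (r : ℂ) := by
      have := ((hasDerivAt_id (r : ℂ)).mul_const I).const_add (t : ℂ)
      simpa using this
    have h1 := ((h0.cpow_const (c := ((-2*s : ℝ) : ℂ)) (base_slit ht)).div_const (((-2*s : ℝ) : ℂ) * I)).comp_ofReal
    convert h1 using 1
    unfold kap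
    rw [show (((-2*s : ℝ) : ℂ) - 1) = ((-1-2*s : ℝ) : ℂ) by push_cast; ring]
    rw [eq_div_iff (mul_ne_zero ha I_ne_zero)]
    ring
  have hlim : ∀ l : Filter ℝ, Tendsto (fun r : ℝ => |r|) l atTop → Tendsto
      (fun r : ℝ => ((t : ℂ) + r * I) ^ ((-2*s : ℝ) : ℂ) / (((-2*s : ℝ) : ℂ) * I)) l (𝓝 0) := by
    intro l hl
    rw [show (0:ℂ) = 0 / (((-2*s : ℝ) : ℂ) * I) by simp]
    refine Tendsto.div_const ?_ _
    rw [tendsto_zero_iff_norm_tendsto_zero]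
    have h1 : Tendsto (fun r : ℝ => |r| ^ (-(2*s))) l (𝓝 0) :=
      (tendsto_rpow_neg_atTop (by linarith)).comp hl
    refine squeeze_zero' (Eventually.of_forall fun _ => norm_nonneg _) ?_ h1
    filter_upwards [hl.eventually_gt_atTop 0] with r hr
    rw [norm_cpow_real, show -(2*s) = -2*s by ring]
    refine Real.rpow_le_rpow_of_nonpos hr ?_ (by linarith)
    have := abs_im_le_norm ((t : ℂ) + r * I)
    simpa using this
  have := integral_of_hasDerivAt_of_tendsto hder (kap_int hs ht)
    (hlim _ tendsto_abs_atBot_atTop) (hlim _ tendsto_abs_atTop_atTop)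
  simpa using this

theorem arg_sum {r t : ℝ} (ht : 0 < t) : I.arg + ((r : ℂ) - t * I).arg ∈ Ioc (-Real.pi) Real.pi := by
  have h1 : ((r : ℂ) - t * I).arg < 0 := by rw [arg_neg_iff]; simpa using ht
  have h2 := neg_pi_lt_arg ((r : ℂ) - t * I)
  rw [arg_I]
  have := Real.pi_pos
  constructor <;> linarith

theorem ker_rot {s r t : ℝ} (ht : 0 < t) :
    I ^ ((-1 - 2*s : ℝ) : ℂ) * ((r : ℂ) - t * I) ^ ((-1 - 2*s : ℝ) : ℂ) = kap s t r := by
  have hne : ((r : ℂ) - t * I) ≠ 0 := by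
    intro h
    have := congrArg Complex.im h
    simp at this
    exact ht.ne' this
  rw [← mul_cpow' I_ne_zero hne (arg_sum ht)]
  unfold kap
  congr 1
  rw [mul_sub, mul_left_comm, I_mul_I]; ring

theorem Dens.HH_eq (D : Dens s u K d β) (hzero : ∀ x ≤ 0, u x = 0) {x t : ℝ} (ht : 0 < t) :
    Integrable (fun r : ℝ => (u (x + r) : ℂ) * kap s t r) ∧
    HH s u (x + t * I) = ∫ r : ℝ, (u (x + r) : ℂ) * kap s t r := by
  have hz : -((x : ℂ) + t * I) ∈ slitPlane := slit_of_im (by simpa using ht.ne')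
  have hF := D.F_int hz
  have hsupp : Function.support (fun y : ℝ => (u y : ℂ) * ((y : ℂ) - (x + t*I)) ^ ((-1 - 2*s : ℝ) : ℂ)) ⊆ Ioi 0 := by
    intro y hy
    by_contra h
    simp only [mem_Ioi, not_lt] at h
    simp [hzero y h] at hy
  rw [integrableOn_iff_integrable_of_support_subset hsupp] at hF
  have hfun : (fun r : ℝ => (u (x + r) : ℂ) * kap s t r) = fun r : ℝ => I ^ ((-1 - 2*s : ℝ) : ℂ) *
      ((u (x + r) : ℂ) * (((x + r : ℝ) : ℂ) - (x + t*I)) ^ ((-1 - 2*s : ℝ) : ℂ)) := by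
    funext r
    rw [← ker_rot ht, show (((x + r : ℝ) : ℂ) - (x + t*I)) = (r : ℂ) - t * I by push_cast; ring]
    ring
  have h2 := hF.comp_add_left x
  rw [hfun]
  refine ⟨h2.const_mul _, ?_⟩
  rw [integral_const_mul, HH, F]
  congr 1
  rw [integral_add_left_eq_self (fun y : ℝ => (u y : ℂ) * ((y : ℂ) - (x + t*I)) ^ ((-1 - 2*s : ℝ) : ℂ)) x]
  refine setIntegral_eq_integral_of_forall_compl_eq_zero ?_
  intro y hy
  by_contra h
  exact hy (hsupp h)

theorem kap_zero_re {s r : ℝ} (hr : r ≠ 0) :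
    (kap s 0 r).re = Real.cos (Real.pi / 2 * (-1 - 2*s)) * |r| ^ (-1 - 2*s) := by
  unfold kap
  rw [cpow_ofReal_re]
  have hn : ‖((0:ℝ) : ℂ) + r * I‖ = |r| := by simp
  rw [hn, mul_comm]
  congr 1
  rcases lt_or_gt_of_ne hr with h | h
  · have : (((0:ℝ) : ℂ) + r * I).arg = -(Real.pi/2) := by
      rw [arg_eq_neg_pi_div_two_iff]; simpa using h
    rw [this, neg_mul, Real.cos_neg]
  · have : (((0:ℝ) : ℂ) + r * I).arg = (Real.pi/2) := by
      rw [arg_eq_pi_div_two_iff]; simpa using h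
    rw [this]

theorem Dens.HH_lim (D : Dens s u K d β) (hzero : ∀ x ≤ 0, u x = 0)
    (heq : ∀ x : ℝ, 0 < x →
      Integrable (fun r : ℝ => (u (x + r) + u (x - r) - 2 * u x) / |r| ^ (1 + 2 * s)) ∧
        ∫ r : ℝ, (u (x + r) + u (x - r) - 2 * u x) / |r| ^ (1 + 2 * s) = 0) :
    ∀ x : ℝ, 0 < x → Tendsto (fun t : ℝ => (HH s u (x + t * I)).re) (𝓝[>] 0) (𝓝 0) := by
  intro x hx
  obtain ⟨hQi, hQ0⟩ := heq x hx
  set Q : ℝ → ℝ := fun r => u (x + r) + u (x - r) - 2 * u x with hQ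
  have hrep : ∀ t : ℝ, 0 < t → Integrable (fun r => Q r * (kap s t r).re) ∧
      (HH s u (x + t * I)).re = 1/2 * ∫ r, Q r * (kap s t r).re := by
    intro t ht
    obtain ⟨hi, he⟩ := D.HH_eq hzero (x := x) ht
    have hi1 : Integrable (fun r : ℝ => u (x + r) * (kap s t r).re) := by
      refine hi.re.congr (Eventually.of_forall fun r => ?_)
      simp
    have he1 : (HH s u (x + t * I)).re = ∫ r : ℝ, u (x + r) * (kap s t r).re := by
      rw [he]
      have := integral_re hi
      simp only [RCLike.re_eq_complex_re, re_ofReal_mul] at this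
      exact this.symm
    have hi2 : Integrable (fun r : ℝ => u (x - r) * (kap s t r).re) := by
      refine hi1.comp_neg.congr (Eventually.of_forall fun r => ?_)
      simp only [kap_even ht]; rw [sub_eq_add_neg]
    have he2 : ∫ r : ℝ, u (x - r) * (kap s t r).re = ∫ r : ℝ, u (x + r) * (kap s t r).re := by
      rw [← integral_neg_eq_self (fun r : ℝ => u (x + r) * (kap s t r).re)]
      simp only [kap_even ht, sub_eq_add_neg]
    have hi3 : Integrable (fun r : ℝ => (kap s t r).re) := (kap_int D.s0 ht).re
    have he3 : ∫ r : ℝ, (kap s t r).re = 0 := by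
      have := integral_re (kap_int D.s0 ht)
      rw [kap_integral D.s0 ht] at this
      simpa using this
    have hsplit : (fun r => Q r * (kap s t r).re) = fun r => (u (x + r) * (kap s t r).re +
        u (x - r) * (kap s t r).re) - 2 * u x * (kap s t r).re := by
      funext r; simp only [hQ]; ring
    rw [hsplit]
    refine ⟨(hi1.add hi2).sub (hi3.const_mul _), ?_⟩
    have hi12 : Integrable (fun r : ℝ => u (x + r) * (kap s t r).re + u (x - r) * (kap s t r).re) :=
      hi1.add hi2
    rw [integral_sub hi12 (hi3.const_mul _), integral_add hi1 hi2, integral_const_mul, he3, he2, he1]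
    ring
  have hne : ∀ᵐ r : ℝ, r ≠ 0 := by
    rw [ae_iff]; simp
  have habs : ∀ r : ℝ, r ≠ 0 → Q r / |r| ^ (1 + 2*s) = Q r * |r| ^ (-1 - 2*s) := by
    intro r hr
    rw [show -1 - 2*s = -(1+2*s) by ring, Real.rpow_neg (abs_nonneg r)]; rfl
  have hdct : Tendsto (fun t : ℝ => ∫ r, Q r * (kap s t r).re) (𝓝[>] 0)
      (𝓝 (∫ r, Q r * (kap s 0 r).re)) := by
    refine tendsto_integral_filter_of_dominated_convergence
      (fun r => ‖Q r / |r| ^ (1 + 2*s)‖) ?_ ?_ hQi.norm ?_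
    · filter_upwards [self_mem_nhdsWithin] with t ht using (hrep t ht).1.aestronglyMeasurable
    · refine Eventually.of_forall fun t => ?_
      filter_upwards [hne] with r hr
      rw [habs r hr, norm_mul, norm_mul]
      refine mul_le_mul_of_nonneg_left ?_ (norm_nonneg _)
      rw [Real.norm_eq_abs, Real.norm_eq_abs, abs_of_nonneg (a := |r| ^ (-1-2*s)) (by positivity)]
      exact (abs_re_le_norm _).trans (kap_norm_le D.s0 hr)
    · filter_upwards [hne] with r hr
      refine Tendsto.const_mul _ ?_
      have hc : ContinuousAt (fun t : ℝ => ((t : ℂ) + r * I)) 0 := by fun_prop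
      have hm : ((0:ℝ) : ℂ) + r * I ∈ slitPlane := by
        rw [mem_slitPlane_iff]; right; simpa using hr
      have := hc.cpow (continuousAt_const (y := ((-1 - 2*s : ℝ) : ℂ))) hm
      exact ((continuous_re.continuousAt.comp this).tendsto).mono_left nhdsWithin_le_nhds
  have h0 : ∫ r, Q r * (kap s 0 r).re = 0 := by
    have : ∫ r, Q r * (kap s 0 r).re =
        ∫ r, Real.cos (Real.pi / 2 * (-1 - 2*s)) * (Q r / |r| ^ (1 + 2*s)) := by
      refine integral_congr_ae ?_
      filter_upwards [hne] with r hr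
      rw [kap_zero_re hr, habs r hr]; ring
    rw [this, integral_const_mul, hQ0, mul_zero]
  rw [h0] at hdct
  have := hdct.const_mul (1/2)
  rw [mul_zero] at this
  refine this.congr' ?_
  filter_upwards [self_mem_nhdsWithin] with t ht using ((hrep t ht).2).symm

theorem Dens.HH_holo (D : Dens s u K d β) : DifferentiableOn ℂ (HH s u) {z | 0 < z.im} := by
  refine DifferentiableOn.const_mul (D.F_holo.mono ?_) _
  intro z hz
  have hz' : 0 < z.im := hz
  exact slit_of_im hz'.ne'

end FL

namespace FL
open Complex Set Filter Topology

theorem slit_cases {z : ℂ} (hz : z ≠ 0) (h : -z ∉ slitPlane) : 0 < z.re ∧ ((z.re : ℝ) : ℂ) = z := by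
  rw [mem_slitPlane_iff] at h
  push Not at h
  simp at h
  have : ((z.re : ℝ) : ℂ) = z := by
    apply Complex.ext <;> simp [h.2]
  refine ⟨lt_of_le_of_ne h.1 ?_, this⟩
  intro h0
  rw [← h0] at this
  exact hz (by simpa using this.symm)

theorem glue {f : ℂ → ℂ} (hf : DifferentiableOn ℂ f {z | -z ∈ slitPlane})
    (hext : ∀ c : ℝ, 0 < c → ∃ R > 0, ∃ g : ℂ → ℂ, DifferentiableOn ℂ g (Metric.ball (c : ℂ) R) ∧
      ∀ z ∈ Metric.ball (c : ℂ) R, z.im ≠ 0 → g z = f z) :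
    ∃ ft : ℂ → ℂ, DifferentiableOn ℂ ft {0}ᶜ ∧ ∀ z, -z ∈ slitPlane → ft z = f z := by
  classical
  have hext' : ∀ c : ℝ, ∃ R : ℝ, ∃ g : ℂ → ℂ, 0 < c → (0 < R ∧
      DifferentiableOn ℂ g (Metric.ball (c : ℂ) R) ∧
      ∀ z ∈ Metric.ball (c : ℂ) R, z.im ≠ 0 → g z = f z) := by
    intro c
    by_cases hc : 0 < c
    · obtain ⟨R, hR, g, h⟩ := hext c hc
      exact ⟨R, g, fun _ => ⟨hR, h⟩⟩
    · exact ⟨0, 0, fun h => absurd h hc⟩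
  choose R g h using hext'
  have hopen : IsOpen {z : ℂ | -z ∈ slitPlane} := isOpen_slitPlane.preimage continuous_neg
  refine ⟨fun z => if -z ∈ slitPlane then f z else g z.re z, ?_, fun z hz => if_pos hz⟩
  intro z hz
  refine DifferentiableAt.differentiableWithinAt ?_
  by_cases hzs : -z ∈ slitPlane
  · have h1 : DifferentiableAt ℂ f z := (hf z hzs).differentiableAt (hopen.mem_nhds hzs)
    refine h1.congr_of_eventuallyEq ?_
    filter_upwards [hopen.mem_nhds hzs] with w hw
    exact if_pos hw
  · obtain ⟨hc, hcz⟩ := slit_cases hz hzs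
    obtain ⟨hR, hg, hgf⟩ := h z.re hc
    have hmem : z ∈ Metric.ball ((z.re : ℝ) : ℂ) (R z.re) := by
      rw [hcz]; exact Metric.mem_ball_self hR
    have h1 : DifferentiableAt ℂ (g z.re) z :=
      (hg z hmem).differentiableAt (Metric.isOpen_ball.mem_nhds hmem)
    refine h1.congr_of_eventuallyEq ?_
    have hre : {w : ℂ | 0 < w.re} ∈ 𝓝 z := (isOpen_lt continuous_const continuous_re).mem_nhds hc
    filter_upwards [Metric.isOpen_ball.mem_nhds hmem, hre] with w hw hwre
    have hwre' : 0 < w.re := hwre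
    by_cases hwim : w.im = 0
    · have hws : -w ∉ slitPlane := by
        rw [mem_slitPlane_iff]; simp [hwim]; exact hwre'.le
      simp only [if_neg hws]
      have hw0 : w ≠ 0 := by rintro rfl; simp at hwre'
      obtain ⟨hc2, hcw⟩ := slit_cases hw0 hws
      obtain ⟨hR2, hg2, hgf2⟩ := h w.re hc2
      have hmem2 : w ∈ Metric.ball ((w.re : ℝ) : ℂ) (R w.re) := by
        rw [hcw]; exact Metric.mem_ball_self hR2
      have t1 := ((hg2 w hmem2).differentiableAt (Metric.isOpen_ball.mem_nhds hmem2)).continuousAt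
      have t2 := ((hg w hw).differentiableAt (Metric.isOpen_ball.mem_nhds hw)).continuousAt
      have tl : Tendsto (fun t : ℝ => w + t * I) (𝓝[>] 0) (𝓝 w) := by
        have : Continuous (fun t : ℝ => w + t * I) := by fun_prop
        have := (this.tendsto 0).mono_left (nhdsWithin_le_nhds (s := Ioi 0))
        simpa using this
      refine tendsto_nhds_unique_of_eventuallyEq (t1.tendsto.comp tl) (t2.tendsto.comp tl) ?_
      filter_upwards [tl (Metric.isOpen_ball.mem_nhds hw), tl (Metric.isOpen_ball.mem_nhds hmem2),
        self_mem_nhdsWithin] with t ht1 ht2 ht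
      have ht' : 0 < t := ht
      have him : (w + t * I).im ≠ 0 := by simp [hwim]; exact ht'.ne'
      simp only [Function.comp]
      rw [hgf _ ht1 him, hgf2 _ ht2 him]
    · simp only [if_pos (slit_of_im hwim)]
      exact (hgf w hw hwim).symm

theorem rpow_comp {σ ρ e : ℝ} (hσ : 0 < σ) (h1 : σ / 4 ≤ ρ) (h2 : ρ ≤ 4 * σ) (he1 : -2 ≤ e)
    (he2 : e ≤ 2) : ρ ^ e ≤ 16 * σ ^ e := by
  have hρ : 0 < ρ := by linarith
  have h16 : ∀ e' : ℝ, 0 ≤ e' → e' ≤ 2 → (4:ℝ) ^ e' ≤ 16 := by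
    intro e' _ h
    calc (4:ℝ) ^ e' ≤ 4 ^ (2:ℝ) := Real.rpow_le_rpow_of_exponent_le (by norm_num) h
      _ = 16 := by norm_num
  rcases le_or_gt 0 e with he | he
  · calc ρ ^ e ≤ (4*σ) ^ e := Real.rpow_le_rpow hρ.le h2 he
      _ = 4 ^ e * σ ^ e := Real.mul_rpow (by norm_num) hσ.le
      _ ≤ _ := by gcongr; exact h16 e he he2
  · calc ρ ^ e ≤ (σ * 4⁻¹) ^ e := Real.rpow_le_rpow_of_nonpos (by positivity) (by linarith) he.le
      _ = 4 ^ (-e) * σ ^ e := by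
        rw [Real.mul_rpow hσ.le (by norm_num), Real.inv_rpow (by norm_num), Real.rpow_neg (by norm_num)]
        ring
      _ ≤ _ := by gcongr; exact h16 (-e) (by linarith) (by linarith)

theorem remove_angle {f : ℂ → ℂ} (hf : DifferentiableOn ℂ f {0}ᶜ) {C e1 e2 : ℝ} (hC : 0 ≤ C)
    (h1 : -2 ≤ e1) (h1' : e1 ≤ 2) (h2 : -2 ≤ e2) (h2' : e2 ≤ 2)
    (hb : ∀ z : ℂ, z.im ≠ 0 → ‖f z‖ ≤ (‖z‖ / |z.im|) ^ 3 * (C * (‖z‖ ^ e1 + ‖z‖ ^ e2))) :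
    ∀ z : ℂ, z ≠ 0 → ‖f z‖ ≤ 100000 * C * (‖z‖ ^ e1 + ‖z‖ ^ e2) := by
  intro z hz
  have hz0 : 0 < ‖z‖ := norm_pos_iff.2 hz
  rcases le_or_gt |z.re| (8 * |z.im|) with h | h
  · have him : 0 < |z.im| := by
      rcases (abs_nonneg z.im).eq_or_lt with h0 | h0
      · exfalso
        rw [← h0, mul_zero] at h
        have h3 := abs_nonpos_iff.1 h
        have h4 := abs_eq_zero.1 h0.symm
        exact hz (Complex.ext h3 h4)
      · exact h0
    have h3 := Complex.norm_le_abs_re_add_abs_im z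
    have h4 : ‖z‖ / |z.im| ≤ 9 := by rw [div_le_iff₀ him]; linarith
    have h5 : (‖z‖ / |z.im|) ^ 3 ≤ 9 ^ 3 := by gcongr
    refine (hb z (abs_pos.1 him)).trans ?_
    have h6 : 0 ≤ C * (‖z‖ ^ e1 + ‖z‖ ^ e2) := by positivity
    nlinarith
  · set x0 := z.re with hx0
    have hx : 0 < |x0| := by linarith [abs_nonneg z.im]
    set r := |x0| / 2 with hr
    have hr0 : 0 < r := by positivity
    have hzx : z - x0 = z.im * I := by
      apply Complex.ext <;> simp [hx0]
    have hzn1 : |x0| ≤ ‖z‖ := abs_re_le_norm z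
    have hzn2 : ‖z‖ ≤ 9/8 * |x0| := by
      have := Complex.norm_le_abs_re_add_abs_im z
      linarith
    set Φ := ‖z‖ ^ e1 + ‖z‖ ^ e2 with hΦ
    have hΦ0 : 0 ≤ Φ := by positivity
    have hzmem : z ∈ Metric.ball (x0 : ℂ) r := by
      rw [Metric.mem_ball, dist_eq_norm, hzx]; simp; linarith
    have hsub : Metric.closedBall (x0 : ℂ) r ⊆ {0}ᶜ := by
      intro w hw h0
      rw [mem_singleton_iff] at h0
      rw [h0, Metric.mem_closedBall, dist_eq_norm] at hw
      simp at hw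
      linarith
    have hd : DifferentiableOn ℂ (fun w => ((w - x0)^2 - r^2)^3 * f w) (Metric.closedBall (x0 : ℂ) r) :=
      DifferentiableOn.mul (by fun_prop) (hf.mono hsub)
    have hdc : DiffContOnCl ℂ (fun w => ((w - x0)^2 - r^2)^3 * f w) (Metric.ball (x0 : ℂ) r) := by
      refine DifferentiableOn.diffContOnCl ?_
      rwa [closure_ball _ hr0.ne']
    have hmax := Complex.norm_le_of_forall_mem_frontier_norm_le Metric.isBounded_ball hdc
      (C := (2*r*(3*r))^3 * (C * (16 * Φ))) ?_ (subset_closure hzmem)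
    · simp only [norm_mul, norm_pow, hzx] at hmax
      have h3 : r^2/2 ≤ ‖((z.im : ℂ) * I)^2 - (r:ℂ)^2‖ := by
        have : ((z.im : ℂ) * I)^2 - (r:ℂ)^2 = ((-(z.im^2 + r^2) : ℝ) : ℂ) := by
          push_cast; rw [mul_pow, I_sq]; ring
        rw [this, norm_real, Real.norm_eq_abs, abs_neg, abs_of_nonneg (by positivity)]
        nlinarith [sq_nonneg z.im]
      have h4 : (r^2/2)^3 * ‖f z‖ ≤ (2*r*(3*r))^3 * (C * (16 * Φ)) := by
        refine le_trans ?_ hmax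
        gcongr
      have h5 : (2*r*(3*r))^3 * (C * (16 * Φ)) = (r^2/2)^3 * (27648 * C * Φ) := by ring
      rw [h5] at h4
      have h6 := le_of_mul_le_mul_left h4 (by positivity)
      have h7 : 0 ≤ C * Φ := by positivity
      nlinarith
    · intro w hw
      rw [frontier_ball _ hr0.ne', Metric.mem_sphere, dist_eq_norm] at hw
      have hkey : ‖(w - x0)^2 - (r:ℂ)^2‖ = 2 * r * |w.im| := by
        have h3 : (w - x0)^2 - (r:ℂ)^2 = (w - x0) * (2 * w.im * I) := by
          have h4 : ((r:ℂ))^2 = (w - x0) * (starRingEnd ℂ) (w - x0) := by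
            rw [mul_conj, normSq_eq_norm_sq, hw]; push_cast; ring
          have h5 : (w - x0) - (starRingEnd ℂ) (w - x0) = 2 * w.im * I := by
            rw [Complex.sub_conj]; simp
          rw [h4, ← h5]; ring
        rw [h3, norm_mul, hw]; simp; ring
      rw [norm_mul, norm_pow, hkey]
      rcases eq_or_ne w.im 0 with him | him
      · simp only [him]; simp; positivity
      · have hai : 0 < |w.im| := abs_pos.2 him
        have hw1 : r ≤ ‖w‖ := by
          have := norm_sub_norm_le (x0 : ℂ) w
          rw [norm_sub_rev, hw, norm_real, Real.norm_eq_abs] at this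
          linarith
        have hw2 : ‖w‖ ≤ 3*r := by
          have := norm_sub_norm_le w (x0 : ℂ)
          rw [hw, norm_real, Real.norm_eq_abs] at this
          linarith
        have g1 := rpow_comp (e := e1) hz0 (ρ := ‖w‖) (by linarith) (by linarith) h1 h1'
        have g2 := rpow_comp (e := e2) hz0 (ρ := ‖w‖) (by linarith) (by linarith) h2 h2'
        calc (2*r*|w.im|)^3 * ‖f w‖ ≤ (2*r*|w.im|)^3 * ((‖w‖ / |w.im|) ^ 3 * (C * (‖w‖ ^ e1 + ‖w‖ ^ e2))) := by
              gcongr; exact hb w him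
          _ = (2*r*‖w‖)^3 * (C * (‖w‖ ^ e1 + ‖w‖ ^ e2)) := by field_simp
          _ ≤ (2*r*(3*r))^3 * (C * (16 * Φ)) := by
              gcongr
              rw [hΦ]; linarith

theorem liouville {f : ℂ → ℂ} (hf : DifferentiableOn ℂ f {0}ᶜ) {C e1 e2 : ℝ} (hC : 0 ≤ C)
    (h1 : -1 < e1) (h12 : e1 ≤ e2) (h2 : e2 < 2) (h20 : 0 < e2)
    (hb : ∀ z : ℂ, z ≠ 0 → ‖f z‖ ≤ C * (‖z‖ ^ e1 + ‖z‖ ^ e2)) :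
    ∃ A B : ℂ, ∀ z ≠ 0, f z = A * z + B := by
  set g := Function.update f 0 (limUnder (𝓝[≠] 0) f) with hg
  have hgd : Differentiable ℂ g := by
    rw [← differentiableOn_univ]
    refine differentiableOn_update_limUnder_of_isLittleO univ_mem ?_ ?_
    · refine hf.mono ?_
      intro z hz; exact hz.2
    · have hn : Tendsto (fun z : ℂ => ‖z‖) (𝓝[≠] 0) (𝓝[>] 0) := tendsto_norm_nhdsNE_zero
      have hpw : ∀ e : ℝ, -1 < e → Tendsto (fun z : ℂ => ‖z‖ ^ e * ‖z‖) (𝓝[≠] 0) (𝓝 0) := by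
        intro e he
        have h3 : Tendsto (fun t : ℝ => t ^ (e+1)) (𝓝[>] 0) (𝓝 0) := by
          have := (Real.continuousAt_rpow_const 0 (e+1) (Or.inr (by linarith))).tendsto
          rw [Real.zero_rpow (by linarith)] at this
          exact this.mono_left nhdsWithin_le_nhds
        refine (h3.comp hn).congr' ?_
        filter_upwards [self_mem_nhdsWithin] with z hz
        have : 0 < ‖z‖ := norm_pos_iff.2 hz
        simp only [Function.comp]
        rw [Real.rpow_add_one this.ne']
      rw [Asymptotics.isLittleO_iff_tendsto']
      · rw [tendsto_zero_iff_norm_tendsto_zero]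
        have h4 : Tendsto (fun z : ℂ => C * (‖z‖ ^ e1 * ‖z‖ + ‖z‖ ^ e2 * ‖z‖) + ‖f 0‖ * ‖z‖) (𝓝[≠] 0)
            (𝓝 0) := by
          have := (((hpw e1 h1).add (hpw e2 (by linarith))).const_mul C).add
            ((hn.mono_right nhdsWithin_le_nhds).const_mul ‖f 0‖)
          simpa using this
        refine squeeze_zero' (Eventually.of_forall fun _ => norm_nonneg _) ?_ h4
        filter_upwards [self_mem_nhdsWithin] with z hz
        rw [sub_zero, div_inv_eq_mul, norm_mul]
        have h5 := norm_sub_le (f z) (f 0)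
        have h6 := hb z hz
        calc _ ≤ (C * (‖z‖ ^ e1 + ‖z‖ ^ e2) + ‖f 0‖) * ‖z‖ := by gcongr; linarith
          _ = _ := by ring
      · filter_upwards [self_mem_nhdsWithin] with z hz h0
        simp at h0
        exact absurd h0 hz
  have hgf : ∀ z ≠ 0, g z = f z := fun z hz => Function.update_of_ne hz _ _
  have hgb : ∀ z : ℂ, 1 ≤ ‖z‖ → ‖g z‖ ≤ 2 * C * ‖z‖ ^ e2 := by
    intro z hz
    have hz0 : z ≠ 0 := by rintro rfl; simp at hz; linarith
    rw [hgf z hz0]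
    refine (hb z hz0).trans ?_
    have := Real.rpow_le_rpow_of_exponent_le hz h12
    nlinarith
  have hdd : ∀ w, iteratedDeriv 2 g w = 0 := by
    intro w
    rw [← norm_le_zero_iff]
    have hlim : Tendsto (fun R : ℝ => (2 * (2 * C * (2:ℝ) ^ e2)) * R ^ (-(2 - e2))) atTop (𝓝 0) := by
      have := (tendsto_rpow_neg_atTop (y := 2 - e2) (by linarith)).const_mul (2 * (2 * C * (2:ℝ) ^ e2))
      simpa using this
    refine ge_of_tendsto hlim ?_
    filter_upwards [eventually_ge_atTop (‖w‖ + 1)] with R hR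
    have hR0 : 0 < R := by linarith [norm_nonneg w]
    have hbd : ∀ z ∈ Metric.sphere w R, ‖g z‖ ≤ 2 * C * (2*R) ^ e2 := by
      intro z hz
      rw [Metric.mem_sphere, dist_eq_norm] at hz
      have a1 := norm_sub_norm_le z w
      have a2 := norm_sub_le z w
      rw [hz] at a1 a2
      refine (hgb z (by linarith)).trans ?_
      gcongr
      linarith
    have := Complex.norm_iteratedDeriv_le_of_forall_mem_sphere_norm_le 2 hR0
      hgd.diffContOnCl hbd
    refine this.trans (le_of_eq ?_)
    rw [Real.mul_rpow (by norm_num) hR0.le, show -(2 - e2) = e2 - 2 by ring, Real.rpow_sub hR0]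
    simp [Nat.factorial]
    field_simp
  have hdd2 : ∀ w, deriv (deriv g) w = 0 := by
    intro w
    have := hdd w
    rwa [iteratedDeriv_succ, iteratedDeriv_one] at this
  have hd1 : Differentiable ℂ (deriv g) := hgd.deriv
  have hconst : ∀ w, deriv g w = deriv g 0 := fun w => is_const_of_deriv_eq_zero hd1 hdd2 w 0
  have hk : ∀ z, g z - deriv g 0 * z = g 0 := by
    intro z
    have hdk : Differentiable ℂ (fun z => g z - deriv g 0 * z) := by fun_prop
    have := is_const_of_deriv_eq_zero hdk (fun w => by
      have : HasDerivAt (fun z => g z - deriv g 0 * z) (deriv g w - deriv g 0 * 1) w :=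
        (hgd w).hasDerivAt.sub ((hasDerivAt_id w).const_mul _)
      rw [this.deriv, hconst w]; ring) z 0
    simpa using this
  refine ⟨deriv g 0, g 0, fun z hz => ?_⟩
  rw [← hgf z hz, ← hk z]; ring

end FL

namespace FL
open Complex Set Filter Topology

variable {s K d β : ℝ} {u : ℝ → ℝ}

/-- the glued function -/
noncomputable def ff (s : ℝ) (u : ℝ → ℝ) (z : ℂ) : ℂ := z * (-z) ^ (s : ℂ) * F s u z

theorem Dens.ff_holo (D : Dens s u K d β) : DifferentiableOn ℂ (ff s u) {z | -z ∈ slitPlane} := by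
  refine DifferentiableOn.mul (DifferentiableOn.mul differentiableOn_id ?_) D.F_holo
  exact DifferentiableOn.cpow_const (by fun_prop) (fun z hz => hz)

theorem ff_conj {z : ℂ} (hz : -z ∈ slitPlane) :
    ff s u ((starRingEnd ℂ) z) = (starRingEnd ℂ) (ff s u z) := by
  unfold ff
  rw [F_conj hz, map_mul, map_mul]
  congr 2
  have := conj_cpow (-z) (s : ℂ) (mem_slitPlane_iff_arg.1 hz).1
  rw [conj_ofReal] at this
  rw [← this]; simp

theorem ff_upper {z : ℂ} (hz : 0 < z.im) : ff s u z = I * z * z ^ (s : ℂ) * HH s u z := by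
  have hz0 : z ≠ 0 := by rintro rfl; simp at hz
  have h1 : (-z) ^ (s : ℂ) = z ^ (s : ℂ) * exp (-(Real.pi * s * I)) := by
    rw [cpow_def_of_ne_zero (neg_ne_zero.2 hz0), cpow_def_of_ne_zero hz0, ← Complex.exp_add]
    congr 1
    rw [Complex.log, Complex.log, norm_neg, arg_neg_eq_arg_sub_pi_of_im_pos hz]
    push_cast; ring
  have h2 : I * I ^ ((-1 - 2*s : ℝ) : ℂ) = exp (-(Real.pi * s * I)) := by
    rw [cpow_def_of_ne_zero I_ne_zero, log_I]
    have hI : I = exp (Real.pi / 2 * I) := by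
      rw [exp_pi_div_two_mul_I]
    nth_rewrite 1 [hI]
    rw [← Complex.exp_add]
    congr 1
    push_cast; ring
  unfold ff HH
  rw [h1, ← h2]; ring

theorem Dens.ff_ext (D : Dens s u K d β) (hzero : ∀ x ≤ 0, u x = 0)
    (heq : ∀ x : ℝ, 0 < x →
      Integrable (fun r : ℝ => (u (x + r) + u (x - r) - 2 * u x) / |r| ^ (1 + 2 * s)) ∧
        ∫ r : ℝ, (u (x + r) + u (x - r) - 2 * u x) / |r| ^ (1 + 2 * s) = 0) :
    ∀ c : ℝ, 0 < c → ∃ R > 0, ∃ g : ℂ → ℂ, DifferentiableOn ℂ g (Metric.ball (c : ℂ) R) ∧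
      ∀ z ∈ Metric.ball (c : ℂ) R, z.im ≠ 0 → g z = ff s u z := by
  intro c hc
  obtain ⟨R, hR, Ht, hRc, hd, hup, hlow, -⟩ :=
    ext_all D.s0 D.s1 D.HH_holo D.HH_loc (D.HH_lim hzero heq) hc
  refine ⟨R, hR, fun z => I * z * z ^ (s : ℂ) * Ht z, ?_, ?_⟩
  · refine DifferentiableOn.mul (DifferentiableOn.mul (by fun_prop) ?_) hd
    refine DifferentiableOn.cpow_const differentiableOn_id ?_
    intro z hz
    rw [mem_slitPlane_iff]
    left
    rw [Metric.mem_ball, dist_eq_norm] at hz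
    have := abs_re_le_norm (z - c)
    simp at this
    have h2 := (abs_le.1 (this.trans hz.le)).1
    linarith
  · intro z hz him
    beta_reduce
    rcases lt_or_gt_of_ne him with h | h
    · have hc1 : 0 < ((starRingEnd ℂ) z).im := by simpa using h
      have h3 := ff_conj (s := s) (u := u) (slit_of_im hc1.ne')
      rw [conj_conj] at h3
      rw [h3, ff_upper hc1, hlow z hz h]
      have h4 : (starRingEnd ℂ) (((starRingEnd ℂ) z) ^ (s : ℂ)) = z ^ (s : ℂ) := by
        have h5 := conj_cpow z (s : ℂ) (mem_slitPlane_iff_arg.1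
          (mem_slitPlane_iff.2 (Or.inr him))).1
        rw [conj_ofReal] at h5
        rw [h5, conj_conj]
      simp only [map_mul, h4, conj_conj, conj_I]
      ring
    · rw [hup z hz h, ff_upper h]

theorem Dens.ff_bd (D : Dens s u K d β) {z : ℂ} (hz : z.im ≠ 0) :
    ‖ff s u z‖ ≤ (‖z‖ / |z.im|) ^ 3 *
      ((64 * K * (cc s (d-1) + cc s β)) * (‖z‖ ^ (d - s) + ‖z‖ ^ (1 + β - s))) := by
  have hz0 : 0 < ‖z‖ := by
    rw [norm_pos_iff]; rintro rfl; simp at hz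
  have him : 0 < |z.im| := abs_pos.2 hz
  have hle : |z.im| ≤ ‖z‖ := abs_im_le_norm z
  have hs0 := D.s0
  have hs1 := D.s1
  have hK := D.K0
  have c1 := cc_pos (s := s) (a := d - 1) (by linarith [D.d0]) (by linarith [D.d1])
  have c2 := cc_pos (s := s) (a := β) (by linarith [D.β0]) D.βs
  have h1 : (|z.im| / (4 * ‖z‖)) ^ (-1 - 2*s) ≤ 64 * (‖z‖ / |z.im|) ^ 3 := by
    rw [show -1 - 2*s = -(1+2*s) by ring, Real.rpow_neg (by positivity), ← Real.inv_rpow (by positivity), inv_div]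
    have h2 : 1 ≤ 4 * ‖z‖ / |z.im| := by rw [le_div_iff₀ him]; linarith
    calc _ ≤ (4 * ‖z‖ / |z.im|) ^ (3:ℝ) := Real.rpow_le_rpow_of_exponent_le h2 (by linarith)
      _ = (4 * ‖z‖ / |z.im|) ^ (3:ℕ) := by exact_mod_cast Real.rpow_natCast _ 3
      _ = _ := by ring
  unfold ff
  rw [norm_mul, norm_mul, norm_cpow_real, norm_neg]
  have e1 : ‖z‖ ^ (d - s) = ‖z‖ * ‖z‖ ^ s * ‖z‖ ^ (d - 1 - 2*s) := by
    rw [← Real.rpow_one_add' hz0.le (by linarith), ← Real.rpow_add hz0]; congr 1; ring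
  have e2 : ‖z‖ ^ (1 + β - s) = ‖z‖ * ‖z‖ ^ s * ‖z‖ ^ (β - 2*s) := by
    rw [← Real.rpow_one_add' hz0.le (by linarith), ← Real.rpow_add hz0]; congr 1; ring
  calc _ ≤ ‖z‖ * ‖z‖ ^ s * (64 * (‖z‖ / |z.im|) ^ 3 *
      (K * (cc s (d-1) * ‖z‖ ^ (d - 1 - 2*s) + cc s β * ‖z‖ ^ (β - 2*s)))) := by
        refine mul_le_mul_of_nonneg_left ((D.F_bd hz).trans ?_) (by positivity)
        exact mul_le_mul_of_nonneg_right h1 (by positivity)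
    _ = (‖z‖ / |z.im|) ^ 3 * (64 * K * (cc s (d-1) * ‖z‖ ^ (d-s) + cc s β * ‖z‖ ^ (1 + β - s))) := by
        rw [e1, e2]; ring
    _ ≤ _ := by
        refine mul_le_mul_of_nonneg_left ?_ (by positivity)
        rw [mul_assoc (64 * K)]
        refine mul_le_mul_of_nonneg_left ?_ (by positivity)
        have p1 : 0 ≤ cc s (d-1) * ‖z‖ ^ (1 + β - s) := by positivity
        have p2 : 0 ≤ cc s β * ‖z‖ ^ (d - s) := by positivity
        nlinarith

/-- The Stieltjes type transform of a solution is explicit. -/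
theorem Dens.transform (D : Dens s u K d β) (hzero : ∀ x ≤ 0, u x = 0)
    (heq : ∀ x : ℝ, 0 < x →
      Integrable (fun r : ℝ => (u (x + r) + u (x - r) - 2 * u x) / |r| ^ (1 + 2 * s)) ∧
        ∫ r : ℝ, (u (x + r) + u (x - r) - 2 * u x) / |r| ^ (1 + 2 * s) = 0) :
    ∃ A B : ℝ, ∀ x : ℝ, 0 < x →
      ∫ y in Ioi (0:ℝ), u y * (y + x) ^ (-1 - 2*s) = A * x ^ (-s) + B * x ^ (-1 - s) := by
  have hs0 := D.s0
  have hs1 := D.s1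
  have hd0 := D.d0
  have hd1 := D.d1
  have hβ0 := D.β0
  have hβs := D.βs
  have hK := D.K0
  have c1 := cc_pos (s := s) (a := d - 1) (by linarith [D.d0]) (by linarith [D.d1])
  have c2 := cc_pos (s := s) (a := β) (by linarith [D.β0]) D.βs
  obtain ⟨ft, hft, hfe⟩ := glue D.ff_holo (D.ff_ext hzero heq)
  have hb := remove_angle hft (C := 64 * K * (cc s (d-1) + cc s β)) (e1 := d - s) (e2 := 1 + β - s)
    (by positivity) (by linarith) (by linarith) (by linarith) (by linarith) (fun z hz => by
      rw [hfe z (slit_of_im hz)]; exact D.ff_bd hz)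
  obtain ⟨A, B, hAB⟩ := liouville hft (by positivity) (by linarith) (by linarith) (by linarith)
    (by linarith) hb
  refine ⟨A.re, -B.re, fun x hx => ?_⟩
  have hxs : -(-(x : ℂ)) ∈ slitPlane := by
    rw [neg_neg]; exact ofReal_mem_slitPlane.2 hx
  have h1 := hAB (-(x : ℂ)) (by simpa using hx.ne')
  rw [hfe _ hxs] at h1
  have h2 : F s u (-(x : ℂ)) = ((∫ y in Ioi (0:ℝ), u y * (y + x) ^ (-1 - 2*s) : ℝ) : ℂ) := by
    unfold F
    rw [← integral_complex_ofReal]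
    refine setIntegral_congr_fun measurableSet_Ioi ?_
    intro y hy
    have hy0 : 0 < y := hy
    simp only
    rw [sub_neg_eq_add, ← ofReal_add, ← ofReal_cpow (by positivity), ← ofReal_mul]
  set J := ∫ y in Ioi (0:ℝ), u y * (y + x) ^ (-1 - 2*s) with hJ
  have h3 : -(x * x ^ s * J) = -(A.re * x) + B.re := by
    unfold ff at h1
    rw [h2, neg_neg, ← ofReal_cpow hx.le] at h1
    have := congrArg Complex.re h1
    have h4 : -(x:ℂ) * ((x ^ s : ℝ) : ℂ) * (J : ℂ) = ((-(x * x ^ s * J) : ℝ) : ℂ) := by push_cast; ring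
    rw [h4, ofReal_re] at this
    simpa using this
  rw [show -1 - s = -(s + 1) by ring, Real.rpow_neg hx.le, Real.rpow_neg hx.le, Real.rpow_add_one hx.ne']
  have hxp : 0 < x ^ s := by positivity
  field_simp
  linarith

end FL

namespace FL
open Complex Set Filter Topology

variable {s K d β : ℝ} {u : ℝ → ℝ}

theorem Dens.real_int (D : Dens s u K d β) (n : ℕ) {x : ℝ} (hx : 0 < x) :
    IntegrableOn (fun y => u y * (y + x) ^ (-1 - 2*s - n)) (Ioi 0) := by
  have hs := D.s0
  have hK := D.K0
  refine Integrable.mono' ((D.int_dom hx).const_mul (x ^ (-(n:ℝ)))) ?_ ?_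
  · refine D.meas.mul ?_
    refine ContinuousOn.aestronglyMeasurable ?_ measurableSet_Ioi
    intro y hy
    have hy0 : 0 < y := hy
    exact (ContinuousAt.rpow_const (by fun_prop) (Or.inl (by positivity))).continuousWithinAt
  · filter_upwards [ae_restrict_mem measurableSet_Ioi] with y hy
    have hy0 : 0 < y := hy
    rw [norm_mul, Real.norm_eq_abs, Real.norm_of_nonneg (by positivity), sub_eq_add_neg (-1-2*s),
      Real.rpow_add (by positivity)]
    have h1 : (y + x) ^ (-(n:ℝ)) ≤ x ^ (-(n:ℝ)) :=
      Real.rpow_le_rpow_of_nonpos hx (by linarith) (by simp)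
    calc _ ≤ (K * (y ^ (d-1) + y ^ β)) * ((y + x) ^ (-1 - 2*s) * x ^ (-(n:ℝ))) := by
          gcongr
          exact D.bd y hy0
      _ = _ := by ring

theorem Dens.moments (D : Dens s u K d β)
    (h0 : ∀ x : ℝ, 0 < x → ∫ y in Ioi (0:ℝ), u y * (y + x) ^ (-1 - 2*s) = 0) (n : ℕ) :
    ∀ x : ℝ, 0 < x → ∫ y in Ioi (0:ℝ), u y * (y + x) ^ (-1 - 2*s - n) = 0 := by
  induction n with
  | zero => simpa using h0
  | succ n ih =>
    intro x hx
    have hs := D.s0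
    have hne : -1 - 2*s - n ≠ 0 := by
      have : (0:ℝ) ≤ n := Nat.cast_nonneg n
      linarith
    have hder := hasDerivAt_integral_of_dominated_loc_of_deriv_le (μ := volume.restrict (Ioi (0:ℝ)))
      (F := fun x y => u y * (y + x) ^ (-1 - 2*s - n))
      (F' := fun x y => (-1 - 2*s - n) * (u y * (y + x) ^ (-1 - 2*s - (n+1 : ℕ))))
      (x₀ := x) (s := Metric.ball x (x/2))
      (bound := fun y => |-1 - 2*s - n| * ‖u y * (y + x/2) ^ (-1 - 2*s - (n+1 : ℕ))‖)
      (Metric.ball_mem_nhds x (by positivity)) ?_ (D.real_int n hx)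
      (((D.real_int (n+1) hx).const_mul _).aestronglyMeasurable) ?_
      (((D.real_int (n+1) (half_pos hx)).norm).const_mul _) ?_
    · have h1 := hder.2
      have h2 : HasDerivAt (fun x => ∫ y in Ioi (0:ℝ), u y * (y + x) ^ (-1 - 2*s - n)) 0 x := by
        refine (hasDerivAt_const x (0:ℝ)).congr_of_eventuallyEq ?_
        filter_upwards [lt_mem_nhds hx] with x' hx' using ih x' hx'
      have h3 := h1.unique h2
      rw [integral_const_mul] at h3
      exact (mul_eq_zero.1 h3).resolve_left hne
    · filter_upwards [lt_mem_nhds hx] with x' hx' using (D.real_int n hx').aestronglyMeasurable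
    · filter_upwards [ae_restrict_mem measurableSet_Ioi] with y hy x' hx'
      have hy0 : 0 < y := hy
      rw [Real.ball_eq_Ioo] at hx'
      have hx0 : x/2 < x' := by linarith [hx'.1]
      have hx00 : 0 < x' := by linarith
      rw [norm_mul, norm_mul, norm_mul, Real.norm_eq_abs]
      gcongr
      rw [Real.norm_of_nonneg (by positivity), Real.norm_of_nonneg (by positivity)]
      refine Real.rpow_le_rpow_of_nonpos (by positivity) (by linarith) ?_
      have : (0:ℝ) ≤ ((n+1 : ℕ) : ℝ) := Nat.cast_nonneg _
      linarith
    · filter_upwards [ae_restrict_mem measurableSet_Ioi] with y hy x' hx'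
      have hy0 : 0 < y := hy
      rw [Real.ball_eq_Ioo] at hx'
      have hx00 : 0 < x' := by linarith [hx'.1]
      have h1 := ((hasDerivAt_id x').const_add y).rpow_const (p := -1 - 2*s - n)
        (Or.inl (by simp; positivity))
      have h2 := h1.const_mul (u y)
      have h3 : u y * (1 * (-1 - 2*s - n) * (y + id x') ^ (-1 - 2*s - n - 1)) =
          (-1 - 2*s - n) * (u y * (y + x') ^ (-1 - 2*s - (n+1 : ℕ))) := by
        rw [show -1 - 2*s - ((n+1 : ℕ) : ℝ) = -1 - 2*s - n - 1 by push_cast; ring, id]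
        ring
      rw [h3] at h2
      exact h2

theorem Dens.zero_of_moments (D : Dens s u K d β)
    (h0 : ∀ x : ℝ, 0 < x → ∫ y in Ioi (0:ℝ), u y * (y + x) ^ (-1 - 2*s) = 0) :
    ∀ᵐ y : ℝ, y ∈ Ioi (0:ℝ) → u y = 0 := by
  have hs := D.s0
  set v : ℝ → ℝ := fun y => u y * (y + 1) ^ (-1 - 2*s) with hv
  have hvi : IntegrableOn v (Ioi 0) := by
    have := D.real_int 0 one_pos
    simpa using this
  have hq : ∀ y : ℝ, 0 < y → (y+1)⁻¹ ∈ Icc (0:ℝ) 1 := by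
    intro y hy
    exact ⟨by positivity, inv_le_one_of_one_le₀ (by linarith)⟩
  have hmul : ∀ g : ℝ → ℝ, Continuous g → IntegrableOn (fun y => v y * g ((y+1)⁻¹)) (Ioi 0) := by
    intro g hg
    obtain ⟨M, hM⟩ := (isCompact_Icc (a := (0:ℝ)) (b := 1)).exists_bound_of_continuousOn hg.continuousOn
    refine Integrable.mono' (hvi.norm.mul_const M) ?_ ?_
    · refine hvi.aestronglyMeasurable.mul ?_
      have hco : ContinuousOn (fun y : ℝ => g ((y+1)⁻¹)) (Ioi 0) := by
        refine hg.comp_continuousOn ?_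
        intro y hy
        have hy0 : 0 < y := hy
        exact (ContinuousAt.inv₀ (by fun_prop) (by positivity)).continuousWithinAt
      exact hco.aestronglyMeasurable measurableSet_Ioi
    · refine (ae_restrict_mem (measurableSet_Ioi (a := (0:ℝ)))).mono fun y hy => ?_
      rw [norm_mul]
      exact mul_le_mul_of_nonneg_left (hM _ (hq y hy)) (norm_nonneg _)
  have hpow : ∀ n : ℕ, ∫ y in Ioi (0:ℝ), v y * ((y+1)⁻¹) ^ n = 0 := by
    intro n
    refine Eq.trans ?_ (D.moments h0 n 1 one_pos)
    refine setIntegral_congr_fun measurableSet_Ioi ?_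
    intro y hy
    have hy0 : 0 < y := hy
    simp only [hv]
    rw [Real.rpow_sub (by positivity) (-1 - 2*s) (n : ℝ), Real.rpow_natCast, inv_pow]
    ring
  have hpoly : ∀ p : Polynomial ℝ, ∫ y in Ioi (0:ℝ), v y * p.eval ((y+1)⁻¹) = 0 := by
    intro p
    induction p using Polynomial.induction_on' with
    | add p q hp hq =>
      simp only [Polynomial.eval_add, mul_add]
      rw [integral_add (hmul _ p.continuous) (hmul _ q.continuous), hp, hq, add_zero]
    | monomial n a =>
      simp only [Polynomial.eval_monomial]
      have : ∀ y : ℝ, v y * (a * ((y+1)⁻¹) ^ n) = a * (v y * ((y+1)⁻¹) ^ n) := fun y => by ring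
      simp only [this]
      rw [integral_const_mul, hpow, mul_zero]
  have hv0 : ∀ᵐ y : ℝ, y ∈ Ioi (0:ℝ) → v y = 0 := by
    refine IsOpen.ae_eq_zero_of_integral_contDiff_smul_eq_zero isOpen_Ioi hvi.locallyIntegrableOn ?_
    intro g hg hgc hgs
    have hg0 : ∀ y, y ≤ 0 → g y = 0 := by
      intro y hy
      by_contra h
      have : y ∈ Ioi (0:ℝ) := hgs (subset_tsupport g h)
      exact absurd this (not_lt.2 hy)
    have hset : ∫ y, g y • v y = ∫ y in Ioi (0:ℝ), v y * g y := by
      rw [setIntegral_eq_integral_of_forall_compl_eq_zero]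
      · congr 1; funext y; rw [smul_eq_mul, mul_comm]
      · intro y hy
        rw [hg0 y (not_lt.1 hy), mul_zero]
    rw [hset]
    have hgcont := hg.continuous
    obtain ⟨M, hM⟩ := hgc.isCompact.isBounded.subset_closedBall 0
    have hψ : ContinuousOn (fun q : ℝ => g (q⁻¹ - 1)) (Icc 0 1) := by
      intro q hq
      rcases hq.1.eq_or_lt with h | h
      · subst h
        have : (fun q : ℝ => g (q⁻¹ - 1)) =ᶠ[𝓝[Icc 0 1] 0] fun _ => 0 := by
          have h1 : Iio (|M| + 2)⁻¹ ∈ 𝓝[Icc (0:ℝ) 1] 0 := nhdsWithin_le_nhds (Iio_mem_nhds (by positivity))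
          filter_upwards [h1, self_mem_nhdsWithin] with q hq1 hq2
          rcases hq2.1.eq_or_lt with h | h
          · subst h; apply hg0; simp
          · by_contra hne
            have h2 := hM (subset_tsupport g hne)
            rw [Metric.mem_closedBall, Real.dist_0_eq_abs] at h2
            have h3 : |M| + 2 < q⁻¹ := by
              rw [lt_inv_comm₀ (by positivity) h]; exact hq1
            have := le_abs_self M
            have := le_abs_self (q⁻¹ - 1)
            linarith
        refine (continuousWithinAt_const (b := (0:ℝ))).congr_of_eventuallyEq this ?_
        apply hg0; simp
      · exact (ContinuousAt.comp (g := g) hgcont.continuousAt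
          ((continuousAt_inv₀ h.ne').sub continuousAt_const)).continuousWithinAt
    have hgi : IntegrableOn (fun y => v y * g y) (Ioi 0) := by
      obtain ⟨M', hM'⟩ := hgc.exists_bound_of_continuous hgcont
      refine Integrable.mono' (hvi.norm.mul_const M') ?_ ?_
      · exact hvi.aestronglyMeasurable.mul hgcont.aestronglyMeasurable
      · filter_upwards with y
        rw [norm_mul]
        exact mul_le_mul_of_nonneg_left (hM' _) (norm_nonneg _)
    rw [← norm_le_zero_iff]
    refine le_of_forall_pos_le_add fun ε hε => ?_
    set V := ∫ y in Ioi (0:ℝ), ‖v y‖ with hV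
    have hV0 : 0 ≤ V := integral_nonneg fun _ => norm_nonneg _
    obtain ⟨p, hp⟩ := exists_polynomial_near_of_continuousOn 0 1 _ hψ (ε / (V + 1)) (by positivity)
    have hsub : ∫ y in Ioi (0:ℝ), v y * g y =
        ∫ y in Ioi (0:ℝ), (v y * g y - v y * p.eval ((y+1)⁻¹)) := by
      rw [integral_sub hgi (hmul _ p.continuous), hpoly, sub_zero]
    rw [hsub, zero_add]
    have : ‖∫ y in Ioi (0:ℝ), (v y * g y - v y * p.eval ((y+1)⁻¹))‖ ≤
        ∫ y in Ioi (0:ℝ), ‖v y‖ * (ε / (V+1)) := by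
      refine norm_integral_le_of_norm_le (hvi.norm.mul_const _) ?_
      filter_upwards [ae_restrict_mem measurableSet_Ioi] with y hy
      have hy0 : 0 < y := hy
      rw [← mul_sub, norm_mul]
      refine mul_le_mul_of_nonneg_left ?_ (norm_nonneg _)
      have := hp _ (hq y hy0)
      simp only [inv_inv, add_sub_cancel_right] at this
      rw [norm_sub_rev]
      exact this.le
    refine this.trans ?_
    rw [integral_mul_const, ← hV, mul_div_assoc', div_le_iff₀ (by positivity)]
    nlinarith
  filter_upwards [hv0] with y hy hy0
  have hy0' : 0 < y := hy0
  have h1 := hy hy0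
  have h2 : (y + 1) ^ (-1 - 2*s) ≠ 0 := by positivity
  exact (mul_eq_zero.1 h1).resolve_right h2

theorem rpow_between {y e e1 e2 : ℝ} (hy : 0 < y) (h1 : e1 ≤ e) (h2 : e ≤ e2) :
    y ^ e ≤ y ^ e1 + y ^ e2 := by
  have p1 : 0 < y ^ e1 := by positivity
  have p2 : 0 < y ^ e2 := by positivity
  rcases le_or_gt y 1 with h | h
  · have := Real.rpow_le_rpow_of_exponent_ge hy h h1
    linarith
  · have := Real.rpow_le_rpow_of_exponent_le h.le h2
    linarith

theorem Dens.sub (D : Dens s u K d β) (a b : ℝ) :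
    Dens s (fun y => u y - a * y ^ s - b * y ^ (s-1)) (2*K + |a| + |b|) (min d s) (max β s) where
  s0 := D.s0
  s1 := D.s1
  meas := by
    have h : ∀ e : ℝ, AEStronglyMeasurable (fun y : ℝ => y ^ e) (volume.restrict (Ioi 0)) :=
      fun e => (measurable_id.pow_const e).aestronglyMeasurable
    exact (D.meas.sub ((h s).const_mul a)).sub ((h (s-1)).const_mul b)
  K0 := by have := D.K0; positivity
  d0 := lt_min D.d0 D.s0
  d1 := (min_le_left _ _).trans_lt D.d1
  β0 := lt_max_of_lt_left D.β0
  βs := max_lt D.βs (by linarith [D.s0])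
  bd := by
    intro y hy
    have hK := D.K0
    have hd1 := D.d1
    have hs1 := D.s1
    have hs0 := D.s0
    have hβ0 := D.β0
    have m1 : min d s - 1 ≤ d - 1 := by linarith [min_le_left d s]
    have m2 : min d s - 1 ≤ s - 1 := by linarith [min_le_right d s]
    have m3 := le_max_left β s
    have m4 := le_max_right β s
    have b1 := rpow_between hy m1 (by linarith : d - 1 ≤ max β s)
    have b2 := rpow_between hy (by linarith : min d s - 1 ≤ β) m3
    have b3 := rpow_between hy (by linarith : min d s - 1 ≤ s) m4
    have b4 := rpow_between hy m2 (by linarith : s - 1 ≤ max β s)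
    have h0 := D.bd y hy
    set T := y ^ (min d s - 1) + y ^ (max β s) with hT
    have t1 : |u y| ≤ 2 * K * T := by nlinarith
    have t2 : |a * y ^ s| ≤ |a| * T := by
      rw [abs_mul, abs_of_nonneg (a := y ^ s) (by positivity)]
      exact mul_le_mul_of_nonneg_left b3 (abs_nonneg _)
    have t3 : |b * y ^ (s-1)| ≤ |b| * T := by
      rw [abs_mul, abs_of_nonneg (a := y ^ (s-1)) (by positivity)]
      exact mul_le_mul_of_nonneg_left b4 (abs_nonneg _)
    have t4 := abs_sub (u y - a * y ^ s) (b * y ^ (s-1))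
    have t5 := abs_sub (u y) (a * y ^ s)
    calc _ ≤ |u y| + |a * y ^ s| + |b * y ^ (s-1)| := by linarith
      _ ≤ _ := by linarith

theorem Dens.ae_form (D : Dens s u K d β) {A B : ℝ}
    (h : ∀ x : ℝ, 0 < x →
      ∫ y in Ioi (0:ℝ), u y * (y + x) ^ (-1 - 2*s) = A * x ^ (-s) + B * x ^ (-1 - s)) :
    ∃ a b : ℝ, ∀ᵐ y : ℝ, y ∈ Ioi (0:ℝ) → u y = a * y ^ s + b * y ^ (s-1) := by
  have hs0 := D.s0
  have hs1 := D.s1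
  have c1 := cc_pos (s := s) (a := s) (by linarith) (by linarith)
  have c2 := cc_pos (s := s) (a := s - 1) (by linarith) (by linarith)
  refine ⟨A / cc s s, B / cc s (s-1), ?_⟩
  have D' := D.sub (A / cc s s) (B / cc s (s-1))
  have := D'.zero_of_moments ?_
  · filter_upwards [this] with y hy hy0
    have := hy hy0
    linarith
  · intro x hx
    have i0 := D.real_int 0 hx
    simp only [Nat.cast_zero, sub_zero] at i0
    have i1 := (int_weight (s := s) (a := s) (x := x) (by linarith) (by linarith) hx).const_mul (A / cc s s)
    have i2 := (int_weight (s := s) (a := s-1) (x := x) (by linarith) (by linarith) hx).const_mul (B / cc s (s-1))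
    have e : ∀ y : ℝ, (u y - A / cc s s * y ^ s - B / cc s (s-1) * y ^ (s-1)) * (y + x) ^ (-1 - 2*s)
      = (u y * (y + x) ^ (-1 - 2*s) - A / cc s s * (y ^ s * (y + x) ^ (-1 - 2*s))) -
        B / cc s (s-1) * (y ^ (s-1) * (y + x) ^ (-1 - 2*s)) := fun y => by ring
    simp only [e]
    have i01 : IntegrableOn (fun y => u y * (y + x) ^ (-1 - 2*s) - A / cc s s * (y ^ s * (y + x) ^ (-1 - 2*s))) (Ioi 0) :=
      i0.sub i1
    rw [integral_sub i01 i2, integral_sub i0 i1, integral_const_mul, integral_const_mul, int_scale hx,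
      int_scale hx, h x hx, show s - 2*s = -s by ring, show s - 1 - 2*s = -1 - s by ring]
    field_simp
    ring

/-- From almost everywhere to everywhere. -/
theorem everywhere {h : ℝ → ℝ} (hs : 0 < s) (hu : ∀ᵐ y : ℝ, y ∈ Ioi (0:ℝ) → u y = h y)
    {x : ℝ} (hx : 0 < x) (hc : ContinuousAt h x)
    (hi : Integrable (fun r : ℝ => (u (x + r) + u (x - r) - 2 * u x) / |r| ^ (1 + 2 * s))) :
    u x = h x := by
  by_contra hne
  set η := |h x - u x| with hη
  have hη0 : 0 < η := abs_pos.2 (sub_ne_zero.2 (Ne.symm hne))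
  have hlim : Tendsto (fun r : ℝ => |h (x + r) + h (x - r) - 2 * u x|) (𝓝 0) (𝓝 (2 * η)) := by
    have l1 : Tendsto (fun r : ℝ => h (x + r)) (𝓝 0) (𝓝 (h x)) := by
      have : Tendsto (fun r : ℝ => x + r) (𝓝 0) (𝓝 x) := by
        have := (by fun_prop : Continuous fun r : ℝ => x + r).tendsto 0
        simpa using this
      exact hc.tendsto.comp this
    have l2 : Tendsto (fun r : ℝ => h (x - r)) (𝓝 0) (𝓝 (h x)) := by
      have : Tendsto (fun r : ℝ => x - r) (𝓝 0) (𝓝 x) := by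
        have := (by fun_prop : Continuous fun r : ℝ => x - r).tendsto 0
        simpa using this
      exact hc.tendsto.comp this
    have l3 := ((l1.add l2).sub_const (2 * u x)).abs
    have : |h x + h x - 2 * u x| = 2 * η := by
      rw [show h x + h x - 2 * u x = 2 * (h x - u x) by ring, abs_mul, hη]; norm_num
    rwa [this] at l3
  have hev := hlim.eventually (lt_mem_nhds (by linarith : η < 2 * η))
  obtain ⟨ρ, hρ, hball⟩ := Metric.eventually_nhds_iff.1 hev
  set ρ' := min ρ x with hρ'
  have hρ0 : 0 < ρ' := lt_min hρ hx
  have a1 : ∀ᵐ r : ℝ, x + r ∈ Ioi (0:ℝ) → u (x + r) = h (x + r) :=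
    (measurePreserving_add_left volume x).quasiMeasurePreserving.ae hu
  have a2 : ∀ᵐ r : ℝ, x - r ∈ Ioi (0:ℝ) → u (x - r) = h (x - r) :=
    (Measure.measurePreserving_sub_left volume x).quasiMeasurePreserving.ae hu
  have hIntg : IntegrableOn (fun r : ℝ => r ^ (-1 - 2*s)) (Ioo 0 ρ') := by
    refine Integrable.mono' (hi.integrableOn.norm.const_mul η⁻¹) ?_ ?_
    · exact (measurable_id.pow_const _).aestronglyMeasurable
    · filter_upwards [ae_restrict_mem measurableSet_Ioo, ae_restrict_of_ae a1, ae_restrict_of_ae a2]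
        with r hr h1 h2
      have hr0 : 0 < r := hr.1
      have hrρ : r < ρ := hr.2.trans_le (min_le_left _ _)
      have hrx : r < x := hr.2.trans_le (min_le_right _ _)
      rw [h1 (by simp; linarith), h2 (by simp; linarith), norm_div, Real.norm_eq_abs (_ - _),
        Real.norm_of_nonneg (by positivity), Real.norm_of_nonneg (by positivity), abs_of_pos hr0]
      have h3 := @hball r (by rw [Real.dist_0_eq_abs, abs_of_pos hr0]; exact hrρ)
      rw [show -1 - 2*s = -(1+2*s) by ring, Real.rpow_neg hr0.le, div_eq_mul_inv, ← mul_assoc]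
      have h4 : 1 ≤ η⁻¹ * |h (x + r) + h (x - r) - 2 * u x| := by
        rw [inv_mul_eq_div, le_div_iff₀ hη0]; linarith
      have h5 : 0 < (r ^ (1 + 2*s))⁻¹ := by positivity
      nlinarith
  rw [intervalIntegral.integrableOn_Ioo_rpow_iff hρ0] at hIntg
  linarith

theorem meas_of_heq
    (heq : ∀ x : ℝ, 0 < x →
      Integrable (fun r : ℝ => (u (x + r) + u (x - r) - 2 * u x) / |r| ^ (1 + 2 * s)))
    (hzero : ∀ x : ℝ, x ≤ 0 → u x = 0) : AEStronglyMeasurable u (volume.restrict (Ioi 0)) := by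
  have hU : Ioi (0:ℝ) = ⋃ n : ℕ, Ioi (2 * (1 / ((n:ℝ) + 1))) := by
    ext y
    simp only [mem_Ioi, mem_iUnion]
    constructor
    · intro hy
      obtain ⟨n, hn⟩ := exists_nat_one_div_lt (half_pos hy)
      exact ⟨n, by linarith⟩
    · rintro ⟨n, hn⟩
      refine lt_trans ?_ hn
      positivity
  rw [hU, aestronglyMeasurable_iUnion_iff]
  intro n
  set x : ℝ := 1 / ((n:ℝ) + 1) with hx
  have hx0 : 0 < x := by positivity
  have h1 := (heq x hx0).aestronglyMeasurable
  have h2 : AEStronglyMeasurable (fun r : ℝ => (u (x + r) + u (x - r) - 2 * u x) / |r| ^ (1 + 2 * s)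
      * |r| ^ (1 + 2*s) + 2 * u x) volume := by
    refine (h1.mul ?_).add aestronglyMeasurable_const
    exact (measurable_norm.pow_const (1+2*s)).aestronglyMeasurable
  have h3 := h2.comp_quasiMeasurePreserving (measurePreserving_sub_right volume x).quasiMeasurePreserving
  refine h3.restrict.congr ?_
  filter_upwards [ae_restrict_mem measurableSet_Ioi] with y hy
  have hy' : 2 * x < y := hy
  simp only [Function.comp]
  have hp : 0 < |y - x| := abs_pos.2 (by linarith)
  have hp2 : |y - x| ^ (1 + 2*s) ≠ 0 := by positivity
  rw [div_mul_cancel₀ _ hp2, hzero (x - (y - x)) (by linarith), add_sub_cancel]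
  ring

end FL

/-- 1D Liouville theorem allowing a singularity at the origin: if `u` satisfies
`(-Δ)^s u = 0` on `(0,∞)` (second-difference form), `u ≡ 0` on `ℝ₋`,
`|u(x)| ≤ C x^{δ-1}` on `(0,1)` for some `δ > 0` and `|u(x)| ≤ C x^β` for `x ≥ 1` with
`β ∈ (0,2s)`, then `u(x) = a (x_+)^s + b (x_+)^{s-1}`. -/
theorem stmt9 (s : ℝ) (hs0 : 0 < s) (hs1 : s < 1)
    (u : ℝ → ℝ)
    (heq : ∀ x : ℝ, 0 < x →
      Integrable (fun r : ℝ => (u (x + r) + u (x - r) - 2 * u x) / |r| ^ (1 + 2 * s)) ∧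
        ∫ r : ℝ, (u (x + r) + u (x - r) - 2 * u x) / |r| ^ (1 + 2 * s) = 0)
    (hzero : ∀ x : ℝ, x ≤ 0 → u x = 0)
    (C δ β : ℝ) (hδ : 0 < δ) (hβ0 : 0 < β) (hβ : β < 2 * s)
    (hgrowth0 : ∀ x : ℝ, 0 < x → x < 1 → |u x| ≤ C * x ^ (δ - 1))
    (hgrowth1 : ∀ x : ℝ, 1 ≤ x → |u x| ≤ C * x ^ β) :
    ∃ a b : ℝ, ∀ x : ℝ,
      u x = a * (max x 0) ^ s + b * (if 0 < x then x ^ (s - 1) else 0) := by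
  have D : FL.Dens s u |C| (min δ (1/2)) β :=
    { s0 := hs0
      s1 := hs1
      meas := FL.meas_of_heq (fun x hx => (heq x hx).1) hzero
      K0 := abs_nonneg C
      d0 := lt_min hδ (by norm_num)
      d1 := (min_le_right _ _).trans_lt (by norm_num)
      β0 := hβ0
      βs := hβ
      bd := by
        intro y hy
        have p1 : 0 < y ^ (min δ (1/2) - 1) := by positivity
        have p2 : 0 < y ^ β := by positivity
        have hC := le_abs_self C
        have hC0 := abs_nonneg C
        rcases lt_or_ge y 1 with h | h
        · have h1 := hgrowth0 y hy h
          have h2 : y ^ (δ - 1) ≤ y ^ (min δ (1/2) - 1) :=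
            Real.rpow_le_rpow_of_exponent_ge hy h.le (by linarith [min_le_left δ (1/2)])
          have p3 : 0 < y ^ (δ - 1) := by positivity
          calc _ ≤ C * y ^ (δ - 1) := h1
            _ ≤ |C| * y ^ (δ - 1) := by gcongr
            _ ≤ _ := by gcongr; linarith
        · have h1 := hgrowth1 y h
          calc _ ≤ C * y ^ β := h1
            _ ≤ |C| * y ^ β := by gcongr
            _ ≤ _ := by gcongr; linarith }
  obtain ⟨A, B, hAB⟩ := D.transform hzero heq
  obtain ⟨a, b, hab⟩ := D.ae_form hAB
  refine ⟨a, b, fun x => ?_⟩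
  rcases lt_or_ge 0 x with hx | hx
  · rw [if_pos hx, max_eq_left hx.le]
    refine FL.everywhere (h := fun y => a * y ^ s + b * y ^ (s-1)) hs0 hab hx ?_ (heq x hx).1
    exact (continuousAt_const.mul (Real.continuousAt_rpow_const _ _ (Or.inl hx.ne'))).add
      (continuousAt_const.mul (Real.continuousAt_rpow_const _ _ (Or.inl hx.ne')))
  · rw [if_neg (not_lt.2 hx), max_eq_right hx, hzero x hx, Real.zero_rpow hs0.ne']
    ring
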